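/- Assume f satisfies (f1), (f2), (f3), (f5) and q satisfies (q1), (q2), (q3), (q4), (q5). Then: (a) if u₁ and u₂ are solutions of (E) with u_i ≥ 0 on [0,∞), u_i(0) > 0 and lim_{r→∞} u_i(r) = 0 (i = 1,2), then u₁ = u₂; and (b) if u₁ and u₂ are solutions of (E) with u_i(0) > 0, lim_{r→∞} u_i(r) = 0 and exactly one sign change in (0,∞) (i = 1,2), then u₁ = u₂. -/

import Mathlib

open Set Filter MeasureTheory Topology

noncomputable section

/-- `F(s) = ∫₀ˢ f(t) dt`. -/
def Fint (f : ℝ → ℝ) (s : ℝ) : ℝ := ∫ t in (0:ℝ)..s, f t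

/-- `s ∈ (−c, c)` where `c ∈ (0, ∞]` is viewed as an extended real. -/
def InCC (c : EReal) (s : ℝ) : Prop := -c < (s : EReal) ∧ (s : EReal) < c

/-- A solution of equation (E):  `u'' + (q'/q) u' + f(u) = 0` on `(0,∞)`,
`u` with values in `(−c,c)`, `C¹` on `[0,∞)`, twice differentiable on `(0,∞)`,
and `u'(0) = 0`. -/
structure IsSolutionE (c : EReal) (f q u : ℝ → ℝ) : Prop where
  mem : ∀ r : ℝ, 0 ≤ r → InCC c (u r)
  c1 : ContDiffOn ℝ 1 u (Ici (0:ℝ))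
  diff2 : ∀ r : ℝ, 0 < r → DifferentiableAt ℝ (deriv u) r
  ode : ∀ r : ℝ, 0 < r →
    deriv (deriv u) r + (deriv q r / q r) * deriv u r + f (u r) = 0
  d0 : deriv u 0 = 0

/-- Condition (f1). -/
def CondF1 (c : EReal) (f : ℝ → ℝ) (b β : ℝ) : Prop :=
  (∀ s : ℝ, f (-s) = - f s) ∧ f 0 = 0 ∧
  0 < b ∧ b < β ∧ (β : EReal) < c ∧
  (∀ s : ℝ, b < s → (s : EReal) < c → 0 < f s) ∧
  (∀ s : ℝ, s ∈ Icc (0:ℝ) b → f s ≤ 0) ∧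
  (∃ s ∈ Icc (0:ℝ) b, f s ≠ 0) ∧
  Fint f β = 0

/-- Condition (f2). -/
def CondF2 (c : EReal) (f : ℝ → ℝ) : Prop :=
  ContDiffOn ℝ 1 f {s : ℝ | 0 < s ∧ (s : EReal) < c} ∧
  IntegrableOn (deriv f) (Ioo (0:ℝ) 1)

/-- Condition (q1). -/
def CondQ1 (q : ℝ → ℝ) : Prop :=
  ContDiffOn ℝ 1 q (Ioi (0:ℝ)) ∧
  (∀ r : ℝ, 0 < r → 0 < q r ∧ 0 < deriv q r) ∧
  q 0 = 0 ∧ ContinuousWithinAt q (Ici (0:ℝ)) 0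

/-- Condition (q2). -/
def CondQ2 (q : ℝ → ℝ) : Prop :=
  StrictAntiOn (fun r => deriv q r / q r) (Ioi (0:ℝ))

/-- `Q(r) = ∫₀ʳ q(s) ds`. -/
def Qint (q : ℝ → ℝ) (r : ℝ) : ℝ := ∫ s in (0:ℝ)..r, q s

/-- `H = (Q/q)'`. -/
def Hfun (q : ℝ → ℝ) (r : ℝ) : ℝ := deriv (fun t => Qint q t / q t) r

/-- Condition (q3), with `Hinf = H∞`. -/
def CondQ3 (q : ℝ → ℝ) (Hinf : ℝ) : Prop :=
  AntitoneOn (Hfun q) (Ioi (0:ℝ)) ∧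
  (∃ H0 : ℝ, Tendsto (Hfun q) (nhdsWithin 0 (Ioi 0)) (nhds H0) ∧ H0 < 1/2) ∧
  Tendsto (Hfun q) atTop (nhds Hinf) ∧ 0 < Hinf ∧
  MonotoneOn (fun r => q r * (Hfun q r - Hinf)) (Ioi (0:ℝ))

/-- Condition (f3). -/
def CondF3 (c : EReal) (f : ℝ → ℝ) (β Hinf : ℝ) : Prop :=
  ∀ s : ℝ, β < s → (s : EReal) < c →
    (1 - 2 * Hinf) / 2 ≤ deriv (fun t => Fint f t / f t) s

/-- `h(r) = q(r) ∫_r^∞ ds / q(s)`. -/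
def hfun (q : ℝ → ℝ) (r : ℝ) : ℝ := q r * ∫ s in Ioi r, 1 / q s

/-- Condition (q4), with `linf = ℓ∞`. -/
def CondQ4 (q : ℝ → ℝ) (linf : ℝ) : Prop :=
  IntegrableOn (fun r => 1 / q r) (Ioi (1:ℝ)) ∧
  ¬ IntegrableOn (fun r => 1 / q r) (Ioo (0:ℝ) 1) ∧
  (∀ r : ℝ, 0 < r → 0 < deriv (hfun q) r) ∧
  AntitoneOn (deriv (hfun q)) (Ioi (0:ℝ)) ∧
  Tendsto (deriv (hfun q)) atTop (nhds linf) ∧ 0 < linf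

/-- Condition (f4): `s ↦ s f'(s)/f(s)` is decreasing for `s ≥ b`. -/
def CondF4 (c : EReal) (f : ℝ → ℝ) (b : ℝ) : Prop :=
  StrictAntiOn (fun s => s * deriv f s / f s) {s : ℝ | b ≤ s ∧ (s : EReal) < c}

/-- Condition (q5). -/
def CondQ5 (q : ℝ → ℝ) : Prop :=
  StrictMonoOn (fun r => deriv q r * q r) (Ioi (0:ℝ))

/-- Condition (f5). -/
def CondF5 (c : EReal) (f : ℝ → ℝ) (b : ℝ) : Prop :=
  ∀ s : ℝ, b ≤ s → (s : EReal) < c → deriv f s * (s - b) ≤ f s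

/-- Condition (f6). -/
def CondF6 (f : ℝ → ℝ) (β linf : ℝ) : Prop :=
  β * deriv f β / f β ≤ 1 + 2 * linf

/-- `G(r) = (q'/(q h)) ∫₀ʳ h − 1/2`. -/
def Gfun (q : ℝ → ℝ) (r : ℝ) : ℝ :=
  deriv q r / (q r * hfun q r) * (∫ s in (0:ℝ)..r, hfun q s) - 1/2

/-- Condition (q6), with `Gbar = sup_{r>0} G(r)`. -/
def CondQ6 (q : ℝ → ℝ) (Gbar : ℝ) : Prop :=
  (∀ r : ℝ, 0 < r → 0 ≤ Gfun q r) ∧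
  IsLUB (Gfun q '' Ioi (0:ℝ)) Gbar ∧
  MonotoneOn (fun r => Gfun q r * hfun q r / Real.sqrt (∫ s in (0:ℝ)..r, hfun q s))
    (Ioi (0:ℝ))

/-- Condition (q7), with constant `C`. -/
def CondQ7 (q : ℝ → ℝ) (Gbar C : ℝ) : Prop :=
  Gbar ≤ C ∧ C ≤ 1 ∧
  ∃ a : ℝ, a ∈ Ioo (0:ℝ) 1 ∧
    MonotoneOn (fun r => hfun q r ^ (1 - a) * (C - Gfun q r)) (Ioi (0:ℝ))

/-- Condition (f7). -/
def CondF7 (c : EReal) (f : ℝ → ℝ) (β C : ℝ) : Prop :=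
  ∀ s : ℝ, β < s → (s : EReal) < c → C ≤ deriv (fun t => Fint f t / f t) s

/-- `u` has exactly `k` sign changes on `(0,∞)`: there are
`0 = z₀ < z₁ < ⋯ < z_k` such that for `i = 0,…,k` the function `(−1)^i u`
is nonnegative and not identically zero on `[z_i, z_{i+1}]` (with `z_{k+1} = ∞`). -/
def ExactSignChanges (u : ℝ → ℝ) (k : ℕ) : Prop :=
  ∃ z : ℕ → ℝ, z 0 = 0 ∧ (∀ i, i < k → z i < z (i + 1)) ∧
    ∀ i, i ≤ k →
      (∀ r ∈ (if i < k then Icc (z i) (z (i + 1)) else Ici (z i)),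
        0 ≤ (-1 : ℝ) ^ i * u r) ∧
      ∃ r ∈ (if i < k then Icc (z i) (z (i + 1)) else Ici (z i)),
        (-1 : ℝ) ^ i * u r ≠ 0

/-- A first variation `φ` along a solution `u` of (E). -/
structure IsFirstVariation (c : EReal) (f q u φ : ℝ → ℝ) : Prop where
  c1 : ContDiffOn ℝ 1 φ (Ici (0:ℝ))
  init : φ 0 = 1
  dinit : deriv φ 0 = 0
  diff2 : ∀ r : ℝ, 0 < r → u r ≠ 0 → DifferentiableAt ℝ (deriv φ) r
  ode : ∀ r : ℝ, 0 < r → u r ≠ 0 →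
    deriv (deriv φ) r + (deriv q r / q r) * deriv φ r + deriv f (u r) * φ r = 0

/-- The filter of approach to `Z ∈ (0,∞]` from the left. -/
def leftFilter (Z : EReal) : Filter ℝ :=
  if Z = ⊤ then atTop else nhdsWithin Z.toReal (Iio Z.toReal)

/-- `Z₁` for a single solution `w`: the supremum of the radii `r > 0` such that
`w > 0` and `w' < 0 ` on `(0,r)`. -/
def Z1 (w : ℝ → ℝ) : EReal :=
  sSup {z : EReal | ∃ r : ℝ, z = (r : EReal) ∧ 0 < r ∧
    ∀ s : ℝ, 0 < s → s < r → 0 < w s ∧ deriv w s < 0}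

namespace BoundState

section

/-- The logarithmic derivative `q'/q`. -/
def logd (q : ℝ → ℝ) (r : ℝ) : ℝ := deriv q r / q r

/-- The quotient `Q/q`. -/
def Kq (q : ℝ → ℝ) (r : ℝ) : ℝ := Qint q r / q r

/-- The consequences of (q1)-(q5) which are used in the uniqueness argument. -/
structure Coeff (q : ℝ → ℝ) (Hinf : ℝ) : Prop where
  cont : ContinuousOn q (Ici 0)
  zero : q 0 = 0
  pos : ∀ r, 0 < r → 0 < q r
  dpos : ∀ r, 0 < r → 0 < deriv q r
  der : ∀ r, 0 < r → HasDerivAt q (deriv q r) r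
  mono : ∀ r s, 0 ≤ r → r ≤ s → q r ≤ q s
  smono : ∀ r s, 0 ≤ r → r < s → q r < q s
  logd_anti : ∀ r s, 0 < r → r ≤ s → logd q s ≤ logd q r
  qd_mono : ∀ r s, 0 < r → r ≤ s → deriv q r * q r ≤ deriv q s * q s
  Kpos : ∀ r, 0 < r → 0 < Kq q r
  Kder : ∀ r, 0 < r → HasDerivAt (Kq q) (Hfun q r) r
  Heq : ∀ r, 0 < r → Hfun q r = 1 - Kq q r * logd q r
  Hanti : ∀ r s, 0 < r → r ≤ s → Hfun q s ≤ Hfun q r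
  Hlt : ∀ r, 0 < r → Hfun q r < 1 / 2
  Hge : ∀ r, 0 < r → Hinf ≤ Hfun q r
  Hinf_pos : 0 < Hinf
  qH_mono : ∀ r s, 0 < r → r ≤ s → q r * (Hfun q r - Hinf) ≤ q s * (Hfun q s - Hinf)
  Kq_anti : ∀ r s, 0 < r → r ≤ s → Kq q s / q s ≤ Kq q r / q r
  K_mono : ∀ r s, 0 < r → r ≤ s → Kq q r ≤ Kq q s
  Kq_lim : Tendsto (fun r => Kq q r / q r) atTop (𝓝 0)

theorem tendsto_div_of_integrable_inv {q : ℝ → ℝ} (hpos : ∀ r, 0 < r → 0 < q r)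
    (hmono : ∀ r s, 0 ≤ r → r ≤ s → q r ≤ q s)
    (hint : IntegrableOn (fun r => 1 / q r) (Ioi (1 : ℝ))) :
    Tendsto (fun r => r / q r) atTop (𝓝 0) := by
  have h1 := intervalIntegral_tendsto_integral_Ioi (1 : ℝ) hint tendsto_id
  have h2 := intervalIntegral_tendsto_integral_Ioi (1 : ℝ) hint
    (tendsto_id.atTop_div_const (show (0 : ℝ) < 2 by norm_num))
  have h3 := (h1.sub h2).const_mul 2
  simp only [sub_self, mul_zero, id] at h3
  refine squeeze_zero' ?_ ?_ h3
  · filter_upwards [eventually_gt_atTop 0] with r hr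
    exact div_nonneg hr.le (hpos r hr).le
  · filter_upwards [eventually_gt_atTop 2] with r hr
    have hii : ∀ x, 1 ≤ x → IntervalIntegrable (fun r => 1 / q r) volume 1 x := fun x hx =>
      (intervalIntegrable_iff_integrableOn_Ioc_of_le hx).2
        (hint.mono_set Ioc_subset_Ioi_self)
    have hI := intervalIntegral.integral_interval_sub_left (hii r (by linarith))
      (hii (r / 2) (by linarith))
    rw [hI]
    have hcon : ∫ x in (r / 2)..r, (1 / q r) ≤ ∫ x in (r / 2)..r, 1 / q x := by
      apply intervalIntegral.integral_mono_on (by linarith) intervalIntegrable_const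
      · exact (hii (r / 2) (by linarith)).symm.trans (hii r (by linarith))
      · intro x hx
        exact one_div_le_one_div_of_le (hpos x (by linarith [hx.1]))
          (hmono x r (by linarith [hx.1]) hx.2)
    rw [intervalIntegral.integral_const, smul_eq_mul] at hcon
    calc r / q r = 2 * ((r - r / 2) * (1 / q r)) := by ring
      _ ≤ _ := by linarith

theorem coeff_of_cond {q : ℝ → ℝ} {Hinf linf : ℝ}
    (hq1 : CondQ1 q) (hq2 : CondQ2 q) (hq3 : CondQ3 q Hinf)
    (hq4 : CondQ4 q linf) (hq5 : CondQ5 q) : Coeff q Hinf := by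
  obtain ⟨hC, hp, h0, hc0⟩ := hq1
  obtain ⟨hHa, ⟨H0, hH0, hH0'⟩, hHl, hHp, hqH⟩ := hq3
  have hpos : ∀ r, 0 < r → 0 < q r := fun r hr => (hp r hr).1
  have hder : ∀ r, 0 < r → HasDerivAt q (deriv q r) r := fun r hr =>
    ((hC.differentiableOn one_ne_zero).differentiableAt (Ioi_mem_nhds hr)).hasDerivAt
  have hcont : ContinuousOn q (Ici 0) := by
    intro r hr
    rcases eq_or_lt_of_le (show (0 : ℝ) ≤ r from hr) with h | h
    · rw [← h]; exact hc0
    · exact (hder r h).continuousAt.continuousWithinAt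
  have hs : StrictMonoOn q (Ici 0) := by
    apply strictMonoOn_of_deriv_pos (convex_Ici 0) hcont
    intro x hx
    rw [interior_Ici] at hx
    exact (hp x hx).2
  have hmono : ∀ r s, 0 ≤ r → r ≤ s → q r ≤ q s := fun r s hr hrs =>
    hs.monotoneOn hr (le_trans hr hrs : (0 : ℝ) ≤ s) hrs
  have hii : ∀ r, 0 ≤ r → IntervalIntegrable q volume 0 r := fun r hr =>
    (hcont.mono (by rw [uIcc_of_le hr]; exact Icc_subset_Ici_self)).intervalIntegrable
  have hQder : ∀ r, 0 < r → HasDerivAt (Qint q) (q r) r := by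
    intro r hr
    refine intervalIntegral.integral_hasDerivAt_right (hii r hr.le) ?_ (hder r hr).continuousAt
    exact (hcont.mono Ioi_subset_Ici_self).stronglyMeasurableAtFilter isOpen_Ioi r hr
  have hKder0 : ∀ r, 0 < r → HasDerivAt (Kq q) (1 - Kq q r * logd q r) r := by
    intro r hr
    have h := (hQder r hr).div (hder r hr) (hpos r hr).ne'
    refine h.congr_deriv ?_
    have := (hpos r hr).ne'
    unfold Kq logd
    field_simp
  have Heq : ∀ r, 0 < r → Hfun q r = 1 - Kq q r * logd q r := fun r hr => (hKder0 r hr).deriv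
  have hKder : ∀ r, 0 < r → HasDerivAt (Kq q) (Hfun q r) r := fun r hr => by
    rw [Heq r hr]; exact hKder0 r hr
  have hlt : ∀ r, 0 < r → Hfun q r < 1 / 2 := by
    intro r hr
    refine lt_of_le_of_lt ?_ hH0'
    refine ge_of_tendsto hH0 ?_
    filter_upwards [Ioo_mem_nhdsGT hr] with t ht
    exact hHa ht.1 hr ht.2.le
  have hge : ∀ r, 0 < r → Hinf ≤ Hfun q r := by
    intro r hr
    refine le_of_tendsto hHl ?_
    filter_upwards [eventually_ge_atTop r] with t ht
    exact hHa hr (lt_of_lt_of_le hr ht) ht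
  have hKpos : ∀ r, 0 < r → 0 < Kq q r := by
    intro r hr
    refine div_pos ?_ (hpos r hr)
    exact intervalIntegral.intervalIntegral_pos_of_pos_on (hii r hr.le)
      (fun x hx => hpos x hx.1) hr
  have hKq : ∀ r, 0 < r → HasDerivAt (fun r => Kq q r / q r) ((2 * Hfun q r - 1) / q r) r := by
    intro r hr
    have h := (hKder r hr).div (hder r hr) (hpos r hr).ne'
    refine h.congr_deriv ?_
    have h1 := (hpos r hr).ne'
    have h2 : Kq q r * deriv q r = (1 - Hfun q r) * q r := by
      rw [Heq r hr]; unfold logd; field_simp; ring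
    rw [h2]; field_simp; ring
  have hKqa : AntitoneOn (fun r => Kq q r / q r) (Ioi 0) := by
    apply antitoneOn_of_deriv_nonpos (convex_Ioi 0)
      (fun r hr => (hKq r hr).continuousAt.continuousWithinAt)
    · intro r hr
      rw [interior_Ioi] at hr
      exact (hKq r hr).differentiableAt.differentiableWithinAt
    · intro r hr
      rw [interior_Ioi] at hr
      rw [(hKq r hr).deriv]
      exact div_nonpos_of_nonpos_of_nonneg (by linarith [hlt r hr]) (hpos r hr).le
  have hKm : MonotoneOn (Kq q) (Ioi 0) := by
    apply monotoneOn_of_deriv_nonneg (convex_Ioi 0)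
      (fun r hr => (hKder r hr).continuousAt.continuousWithinAt)
    · intro r hr
      rw [interior_Ioi] at hr
      exact (hKder r hr).differentiableAt.differentiableWithinAt
    · intro r hr
      rw [interior_Ioi] at hr
      rw [(hKder r hr).deriv]
      linarith [hge r hr]
  refine ⟨hcont, h0, hpos, fun r hr => (hp r hr).2, hder, hmono,
    fun r s hr hrs => hs hr (le_trans hr hrs.le : (0 : ℝ) ≤ s) hrs, ?_, ?_, hKpos, hKder, Heq, ?_,
    hlt, hge, hHp, ?_, ?_, ?_, ?_⟩
  · exact fun r s hr hrs => hq2.antitoneOn hr (lt_of_lt_of_le hr hrs) hrs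
  · exact fun r s hr hrs => hq5.monotoneOn hr (lt_of_lt_of_le hr hrs) hrs
  · exact fun r s hr hrs => hHa hr (lt_of_lt_of_le hr hrs) hrs
  · exact fun r s hr hrs => hqH hr (lt_of_lt_of_le hr hrs) hrs
  · exact fun r s hr hrs => hKqa hr (lt_of_lt_of_le hr hrs) hrs
  · exact fun r s hr hrs => hKm hr (lt_of_lt_of_le hr hrs) hrs
  · refine squeeze_zero' ?_ ?_ (tendsto_div_of_integrable_inv hpos hmono hq4.1)
    · filter_upwards [eventually_gt_atTop 0] with r hr
      exact div_nonneg (hKpos r hr).le (hpos r hr).le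
    · filter_upwards [eventually_gt_atTop 0] with r hr
      gcongr
      · exact (hpos r hr).le
      unfold Kq
      rw [div_le_iff₀ (hpos r hr)]
      have : Qint q r ≤ ∫ x in (0 : ℝ)..r, q r :=
        intervalIntegral.integral_mono_on hr.le (hii r hr.le) intervalIntegrable_const
          (fun x hx => hmono x r hx.1 hx.2)
      simpa [intervalIntegral.integral_const] using this

end

section

/-- `|s| < c`. -/
def InAbs (c : EReal) (s : ℝ) : Prop := ((|s| : ℝ) : EReal) < c

theorem InAbs.of_le {c : EReal} {s t : ℝ} (h : InAbs c s) (hts : |t| ≤ |s|) : InAbs c t :=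
  lt_of_le_of_lt (EReal.coe_le_coe_iff.2 hts) h

theorem InAbs.neg {c : EReal} {s : ℝ} (h : InAbs c s) : InAbs c (-s) :=
  h.of_le (abs_neg s).le

theorem InCC.inAbs {c : EReal} {s : ℝ} (h : InCC c s) : InAbs c s := by
  unfold InAbs
  rcases abs_cases s with ⟨h1, _⟩ | ⟨h1, _⟩
  · rw [h1]; exact h.2
  · rw [h1, EReal.coe_neg]
    exact EReal.neg_lt_comm.1 h.1

theorem InAbs.nhds {c : EReal} {s : ℝ} (h : InAbs c s) : ∀ᶠ t in 𝓝 s, InAbs c t := by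
  have : ContinuousAt (fun t : ℝ => ((|t| : ℝ) : EReal)) s :=
    (continuous_coe_real_ereal.comp continuous_abs).continuousAt
  exact this.eventually_lt_const h

/-- The quotient `F/f`. -/
def Lam (f : ℝ → ℝ) (s : ℝ) : ℝ := Fint f s / f s

/-- The consequences of (f1), (f2), (f3), (f5) which are used in the uniqueness argument. -/
structure Nonlin (c : EReal) (f : ℝ → ℝ) (b β Hinf : ℝ) : Prop where
  odd : ∀ s, f (-s) = -f s
  b_pos : 0 < b
  b_lt : b < β
  β_mem : InAbs c β
  pos : ∀ s, b < s → InAbs c s → 0 < f s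
  nonpos : ∀ s, 0 ≤ s → s ≤ b → f s ≤ 0
  Fder : ∀ s, s ≠ 0 → InAbs c s → HasDerivAt (Fint f) (f s) s
  Fcont : ∀ s, InAbs c s → ContinuousAt (Fint f) s
  Feven : ∀ s, Fint f (-s) = Fint f s
  Fle : ∀ s, |s| ≤ β → Fint f s ≤ 0
  Fgt : ∀ s, β < |s| → InAbs c s → 0 < Fint f s
  Fβ : Fint f β = 0
  Lder : ∀ s, b < |s| → InAbs c s → HasDerivAt (Lam f) (deriv (Lam f) |s|) s
  Lge : ∀ s, β < |s| → InAbs c s → (1 - 2 * Hinf) / 2 ≤ deriv (Lam f) |s|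
  ratio : ∀ t s, b < t → t ≤ s → InAbs c s → f s * (t - b) ≤ f t * (s - b)
  bdd : ∀ S, InAbs c S → ∃ M, 0 < M ∧ ∀ s, |s| ≤ |S| → |f s| ≤ M
  lip : ∀ s₀ s₁, 0 < s₀ → InAbs c s₁ → ∃ L, 0 < L ∧
    ∀ x ∈ Icc s₀ s₁, ∀ y ∈ Icc s₀ s₁, |f x - f y| ≤ L * |x - y|

theorem nonlin_of_cond {c : EReal} {f : ℝ → ℝ} {b β Hinf : ℝ}
    (hf1 : CondF1 c f b β) (hf2 : CondF2 c f)
    (hf3 : CondF3 c f β Hinf) (hf5 : CondF5 c f b) : Nonlin c f b β Hinf := by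
  obtain ⟨hodd, h00, hb, hbβ, hβc, hpos, hnp, -, hFβ⟩ := hf1
  obtain ⟨hC, hfi⟩ := hf2
  set D : Set ℝ := {s : ℝ | 0 < s ∧ (s : EReal) < c} with hD
  have hDo : IsOpen D := isOpen_Ioi.inter
    (isOpen_lt continuous_coe_real_ereal continuous_const)
  have hDin : ∀ s, 0 < s → InAbs c s → s ∈ D := fun s hs h => by
    refine ⟨hs, ?_⟩; unfold InAbs at h; rwa [abs_of_pos hs] at h
  have hDord : ∀ s t, 0 < s → s ≤ t → t ∈ D → s ∈ D := fun s t hs hst ht =>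
    ⟨hs, lt_of_le_of_lt (EReal.coe_le_coe_iff.2 hst) ht.2⟩
  have hfd : ∀ s ∈ D, HasDerivAt f (deriv f s) s := fun s hs =>
    ((hC.differentiableOn one_ne_zero).differentiableAt (hDo.mem_nhds hs)).hasDerivAt
  have hfc : ContinuousOn f D := hC.continuousOn
  have hfdc : ContinuousOn (deriv f) D := hC.continuousOn_deriv_of_isOpen hDo le_rfl
  have hbpos : ∀ s, b < s → InAbs c s → 0 < f s := fun s hs h =>
    hpos s hs (hDin s (hb.trans hs) h).2
  have hbdd1 : ∀ S ∈ D, ∃ M, 0 < M ∧ ∀ s, 0 < s → s ≤ S → |f s| ≤ M := by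
    intro S hS
    set δ := min S (1 / 2) with hδ
    have hδ0 : 0 < δ := lt_min hS.1 (by norm_num)
    have hδD : δ ∈ D := hDord δ S hδ0 (min_le_left _ _) hS
    have hsub : ∀ s, 0 < s → Icc s S ⊆ D := fun s hs x hx =>
      hDord x S (lt_of_lt_of_le hs hx.1) hx.2 hS
    obtain ⟨M1, hM1⟩ := isCompact_Icc.exists_bound_of_continuousOn (hfc.mono (hsub δ hδ0))
    set I := ∫ x in Ioo (0 : ℝ) 1, |deriv f x| with hI
    have hI0 : 0 ≤ I := integral_nonneg (fun x => abs_nonneg _)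
    have hM10 : 0 ≤ M1 := (norm_nonneg _).trans (hM1 δ ⟨le_rfl, min_le_left _ _⟩)
    refine ⟨M1 + I + 1, by positivity, fun s hs hsS => ?_⟩
    rcases le_total δ s with h | h
    · have := hM1 s ⟨h, hsS⟩
      rw [Real.norm_eq_abs] at this
      linarith
    · have hcd : ContinuousOn (deriv f) (uIcc s δ) := by
        rw [uIcc_of_le h]
        exact hfdc.mono (fun x hx => hDord x δ (lt_of_lt_of_le hs hx.1) hx.2 hδD)
      have hft := intervalIntegral.integral_eq_sub_of_hasDerivAt (a := s) (b := δ) (f := f)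
        (f' := deriv f) (fun x hx => by
          rw [uIcc_of_le h] at hx
          exact hfd x (hDord x δ (lt_of_lt_of_le hs hx.1) hx.2 hδD)) hcd.intervalIntegrable
      have h1 : |∫ x in s..δ, deriv f x| ≤ I := by
        have h2 := intervalIntegral.norm_integral_le_integral_norm (f := deriv f) (μ := volume) h
        simp only [Real.norm_eq_abs] at h2
        refine h2.trans ?_
        rw [intervalIntegral.integral_of_le h]
        refine setIntegral_mono_set hfi.abs (ae_of_all _ fun x => abs_nonneg _) ?_
        refine (LE.le.eventuallyLE ?_)
        intro x hx
        exact ⟨hs.trans hx.1, lt_of_le_of_lt (hx.2.trans (min_le_right _ _)) (by norm_num)⟩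
      have h3 := hM1 δ ⟨le_rfl, min_le_left _ _⟩
      rw [Real.norm_eq_abs] at h3
      have : f s = f δ - ∫ x in s..δ, deriv f x := by rw [hft]; ring
      rw [this]
      have := abs_sub (f δ) (∫ x in s..δ, deriv f x)
      linarith
  have hbdd : ∀ S, InAbs c S → ∃ M, 0 < M ∧ ∀ s, |s| ≤ |S| → |f s| ≤ M := by
    intro S hS
    have hfabs : ∀ s, |f s| = |f (|s|)| := fun s => by
      rcases abs_cases s with ⟨h1, _⟩ | ⟨h1, _⟩
      · rw [h1]
      · rw [h1, hodd, abs_neg]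
    rcases eq_or_ne S 0 with h | h
    · refine ⟨1, one_pos, fun s hs => ?_⟩
      rw [h, abs_zero] at hs
      have : s = 0 := abs_eq_zero.1 (le_antisymm hs (abs_nonneg s))
      rw [this, h00]; simp
    · obtain ⟨M, hM0, hM⟩ := hbdd1 |S| ⟨abs_pos.2 h, hS⟩
      refine ⟨M, hM0, fun s hs => ?_⟩
      rw [hfabs]
      rcases eq_or_ne s 0 with h' | h'
      · rw [h', abs_zero, h00, abs_zero]; exact hM0.le
      · exact hM _ (abs_pos.2 h') hs
  have hii : ∀ s, 0 < s → InAbs c s → IntervalIntegrable f volume 0 s := by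
    intro s hs h
    obtain ⟨M, hM0, hM⟩ := hbdd s h
    rw [intervalIntegrable_iff_integrableOn_Ioc_of_le hs.le]
    have hcon : ContinuousOn f (Ioc 0 s) :=
      hfc.mono (fun x hx => hDord x s hx.1 hx.2 (hDin s hs h))
    refine IntegrableOn.of_bound (by simp) (hcon.aestronglyMeasurable measurableSet_Ioc) M ?_
    refine (ae_restrict_iff' measurableSet_Ioc).2 (ae_of_all _ fun x hx => ?_)
    rw [Real.norm_eq_abs]
    exact hM x (by rw [abs_of_pos hx.1, abs_of_pos hs]; exact hx.2)
  have hFeven : ∀ s, Fint f (-s) = Fint f s := by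
    intro s
    unfold Fint
    have h1 : ∫ x in (0 : ℝ)..s, f (-x) = ∫ x in (-s)..(-0), f x :=
      intervalIntegral.integral_comp_neg f
    simp only [hodd, intervalIntegral.integral_neg, neg_zero] at h1
    linarith [intervalIntegral.integral_symm (μ := volume) (f := f) (-s) 0]
  have hFd1 : ∀ s, 0 < s → InAbs c s → HasDerivAt (Fint f) (f s) s := by
    intro s hs h
    have hsD := hDin s hs h
    refine intervalIntegral.integral_hasDerivAt_right (hii s hs h) ?_
      (hfd s hsD).continuousAt
    exact hfc.stronglyMeasurableAtFilter hDo s hsD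
  have hFder : ∀ s, s ≠ 0 → InAbs c s → HasDerivAt (Fint f) (f s) s := by
    intro s hs h
    rcases lt_or_gt_of_ne hs with h1 | h1
    · have h2 := hFd1 (-s) (by linarith) h.neg
      have h3 : HasDerivAt (fun x => Fint f (-x)) (f (-s) * (-1)) s :=
        HasDerivAt.comp s h2 (hasDerivAt_neg s)
      simp only [hFeven, hodd, neg_mul_neg, mul_one] at h3
      simpa using h3
    · exact hFd1 s h1 h
  have hF0 : Fint f 0 = 0 := by simp [Fint]
  have hcpos : ∃ S, 0 < S ∧ InAbs c S := ⟨β, hb.trans hbβ, by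
    unfold InAbs; rwa [abs_of_pos (hb.trans hbβ)]⟩
  have hFcont : ∀ s, InAbs c s → ContinuousAt (Fint f) s := by
    intro s h
    rcases eq_or_ne s 0 with h1 | h1
    · subst h1
      obtain ⟨S, hS0, hS⟩ := hcpos
      obtain ⟨M, hM0, hM⟩ := hbdd S hS
      have : Tendsto (fun t : ℝ => M * |t|) (𝓝 0) (𝓝 0) := by
        have : Continuous (fun t : ℝ => M * |t|) := by fun_prop
        simpa using this.tendsto 0
      rw [ContinuousAt, hF0]
      refine squeeze_zero_norm' ?_ this
      filter_upwards [Ioo_mem_nhds (show -S < 0 by linarith) hS0] with t ht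
      have := intervalIntegral.norm_integral_le_of_norm_le_const (f := f) (a := 0) (b := t)
        (C := M) (fun x hx => by
          rw [Real.norm_eq_abs]
          apply hM
          have h1 : |x| ≤ |t| := by
            rcases le_total 0 t with h2 | h2
            · rw [uIoc_of_le h2] at hx
              rw [abs_of_pos hx.1, abs_of_nonneg h2]; exact hx.2
            · rw [uIoc_of_ge h2] at hx
              rw [abs_of_nonpos hx.2, abs_of_nonpos h2]; linarith [hx.1]
          refine h1.trans ?_
          rw [abs_of_pos hS0]; exact abs_le.2 ⟨by linarith [ht.1], ht.2.le⟩)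
      simpa [Fint] using this
    · exact (hFder s h1 h).continuousAt
  have hβin : InAbs c β := by unfold InAbs; rwa [abs_of_pos (hb.trans hbβ)]
  have hinle : ∀ s t, 0 ≤ s → s ≤ t → InAbs c t → InAbs c s := fun s t hs hst h =>
    h.of_le (by rw [abs_of_nonneg hs, abs_of_nonneg (hs.trans hst)]; exact hst)
  have hFmono : ∀ s t, b ≤ s → s < t → InAbs c t → Fint f s < Fint f t := by
    intro s t hbs hst ht
    have : StrictMonoOn (Fint f) (Icc s t) := by
      apply strictMonoOn_of_deriv_pos (convex_Icc s t)
      · intro x hx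
        exact (hFcont x (hinle x t (by linarith [hx.1]) hx.2 ht)).continuousWithinAt
      · intro x hx
        rw [interior_Icc] at hx
        have hxin := hinle x t (by linarith [hx.1]) hx.2.le ht
        rw [(hFder x (by linarith [hx.1]) hxin).deriv]
        exact hbpos x (by linarith [hx.1]) hxin
    exact this ⟨le_rfl, hst.le⟩ ⟨hst.le, le_rfl⟩ hst
  have hFabs : ∀ s, Fint f |s| = Fint f s := fun s => by
    rcases abs_cases s with ⟨h1, _⟩ | ⟨h1, _⟩
    · rw [h1]
    · rw [h1, hFeven]
  have hLder1 : ∀ s, b < s → InAbs c s → HasDerivAt (Lam f) (deriv (Lam f) s) s := by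
    intro s hs h
    exact ((hFd1 s (hb.trans hs) h).div (hfd s (hDin s (hb.trans hs) h))
      (hbpos s hs h).ne').differentiableAt.hasDerivAt
  refine ⟨hodd, hb, hbβ, hβin, hbpos, fun s h1 h2 => hnp s ⟨h1, h2⟩, hFder, hFcont, hFeven, ?_, ?_,
    hFβ, ?_, ?_, ?_, hbdd, ?_⟩
  · intro s hs
    rw [← hFabs]
    rcases le_or_gt |s| b with h | h
    · unfold Fint
      rw [intervalIntegral.integral_of_le (abs_nonneg s)]
      exact setIntegral_nonpos measurableSet_Ioc (fun x hx => hnp x ⟨hx.1.le, hx.2.trans h⟩)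
    · rcases eq_or_lt_of_le hs with h1 | h1
      · rw [h1, hFβ]
      · rw [← hFβ]; exact (hFmono _ _ h.le h1 hβin).le
  · intro s hs h
    rw [← hFabs, ← hFβ]
    exact hFmono _ _ hbβ.le hs (by unfold InAbs; rwa [abs_abs])
  · intro s hs h
    rcases abs_cases s with ⟨h1, h1'⟩ | ⟨h1, h1'⟩
    · rw [h1]; exact hLder1 s (by linarith) h
    · rw [h1] at hs ⊢
      have h2 := hLder1 (-s) (by linarith) h.neg
      have h3 : HasDerivAt (fun x => Lam f (-x)) (deriv (Lam f) (-s) * (-1)) s :=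
        HasDerivAt.comp s h2 (hasDerivAt_neg s)
      have h4 : (fun x => Lam f (-x)) = fun x => -Lam f x := by
        funext x; simp only [Lam, hFeven, hodd, div_neg]
      rw [h4] at h3
      have h5 := h3.neg
      have h6 : (-fun x => -Lam f x) = Lam f := by ext x; simp
      rw [h6] at h5
      simpa using h5
  · intro s hs h
    exact hf3 |s| hs h
  · intro t s ht hts hs
    have hA : AntitoneOn (fun x => f x / (x - b)) (Icc t s) := by
      have hd : ∀ x ∈ Icc t s, HasDerivAt (fun x => f x / (x - b))
          ((deriv f x * (x - b) - f x * 1) / (x - b) ^ 2) x := fun x hx =>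
        (hfd x (hDin x (by linarith [hx.1]) (hinle x s (by linarith [hx.1]) hx.2 hs))).div
          ((hasDerivAt_id x).sub_const b) (sub_pos.2 (lt_of_lt_of_le ht hx.1)).ne'
      apply antitoneOn_of_deriv_nonpos (convex_Icc t s)
        (fun x hx => (hd x hx).continuousAt.continuousWithinAt)
      · intro x hx
        rw [interior_Icc] at hx
        exact (hd x (Ioo_subset_Icc_self hx)).differentiableAt.differentiableWithinAt
      · intro x hx
        rw [interior_Icc] at hx
        rw [(hd x (Ioo_subset_Icc_self hx)).deriv]
        have hxD := hDin x (by linarith [hx.1]) (hinle x s (by linarith [hx.1]) hx.2.le hs)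
        have := hf5 x (by linarith [hx.1]) hxD.2
        exact div_nonpos_of_nonpos_of_nonneg (by linarith) (sq_nonneg _)
    have := hA ⟨le_rfl, hts⟩ ⟨hts, le_rfl⟩ hts
    simp only at this
    rwa [div_le_div_iff₀ (by linarith) (by linarith)] at this
  · intro s₀ s₁ hs₀ hs₁
    have hsub : Icc s₀ s₁ ⊆ D := fun x hx => hDin x (lt_of_lt_of_le hs₀ hx.1)
      (hinle x s₁ (by linarith [hx.1]) hx.2 hs₁)
    obtain ⟨L, hL⟩ := isCompact_Icc.exists_bound_of_continuousOn (hfdc.mono hsub)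
    refine ⟨max L 1, by positivity, fun x hx y hy => ?_⟩
    have := (convex_Icc s₀ s₁).norm_image_sub_le_of_norm_hasDerivWithin_le
      (fun z hz => (hfd z (hsub hz)).hasDerivWithinAt)
      (fun z hz => (hL z hz).trans (le_max_left L 1)) hy hx
    simpa [Real.norm_eq_abs] using this

end

section

theorem le_of_deriv_nonpos {g : ℝ → ℝ} {x y : ℝ} (hxy : x ≤ y) (hc : ContinuousOn g (Icc x y))
    (hd : ∀ s ∈ Ioo x y, s ≠ 0 → ∃ d ≤ 0, HasDerivAt g d s) : g y ≤ g x := by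
  have key : ∀ x' y', x ≤ x' → x' ≤ y' → y' ≤ y → (0 ∉ Ioo x' y') → g y' ≤ g x' := by
    intro x' y' h1 h2 h3 h4
    have hsub : ∀ s ∈ Ioo x' y', s ∈ Ioo x y := fun s hs =>
      ⟨lt_of_le_of_lt h1 hs.1, lt_of_lt_of_le hs.2 h3⟩
    have hA : AntitoneOn g (Icc x' y') := by
      apply antitoneOn_of_deriv_nonpos (convex_Icc x' y') (hc.mono (Icc_subset_Icc h1 h3))
      · intro s hs
        rw [interior_Icc] at hs
        obtain ⟨d, -, h⟩ := hd s (hsub s hs) (fun h => h4 (h ▸ hs))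
        exact h.differentiableAt.differentiableWithinAt
      · intro s hs
        rw [interior_Icc] at hs
        obtain ⟨d, hd0, h⟩ := hd s (hsub s hs) (fun h => h4 (h ▸ hs))
        rw [h.deriv]; exact hd0
    exact hA ⟨le_rfl, h2⟩ ⟨h2, le_rfl⟩ h2
  by_cases h0 : (0 : ℝ) ∈ Ioo x y
  · exact (key 0 y h0.1.le h0.2.le le_rfl (fun h => lt_irrefl _ h.1)).trans
      (key x 0 le_rfl h0.1.le h0.2.le (fun h => lt_irrefl _ h.2))
  · exact key x y le_rfl hxy le_rfl h0

theorem le_of_deriv_nonneg {g : ℝ → ℝ} {x y : ℝ} (hxy : x ≤ y) (hc : ContinuousOn g (Icc x y))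
    (hd : ∀ s ∈ Ioo x y, s ≠ 0 → ∃ d ≥ 0, HasDerivAt g d s) : g x ≤ g y := by
  have := le_of_deriv_nonpos (g := fun s => -g s) hxy hc.neg (fun s hs h0 => by
    obtain ⟨d, hd0, h⟩ := hd s hs h0
    exact ⟨-d, by linarith, h.neg⟩)
  linarith

theorem exists_last_zero {g : ℝ → ℝ} {x y t : ℝ} (hc : ContinuousOn g (Icc x y))
    (ht : t ∈ Icc x y) (hgt : g t ≤ 0) (hgy : 0 < g y) :
    ∃ z ∈ Ico t y, g z = 0 ∧ ∀ s ∈ Ioc z y, 0 < g s := by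
  set S := {s ∈ Icc t y | g s ≤ 0} with hS
  have hcl : IsClosed S :=
    ((hc.mono (Icc_subset_Icc_left ht.1)).preimage_isClosed_of_isClosed isClosed_Icc isClosed_Iic)
  have hne : S.Nonempty := ⟨t, ⟨le_rfl, ht.2⟩, hgt⟩
  have hbdd : BddAbove S := ⟨y, fun s hs => hs.1.2⟩
  have hz := hcl.csSup_mem hne hbdd
  set z := sSup S with hzdef
  have hzy : z < y := lt_of_le_of_ne hz.1.2 (fun h => by
    have := hz.2; rw [h] at this; linarith)
  have hpos : ∀ s ∈ Ioc z y, 0 < g s := by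
    intro s hs
    by_contra h
    have : s ∈ S := ⟨⟨hz.1.1.trans hs.1.le, hs.2⟩, not_lt.1 h⟩
    exact absurd (le_csSup hbdd this) (not_le.2 hs.1)
  refine ⟨z, ⟨hz.1.1, hzy⟩, le_antisymm hz.2 ?_, hpos⟩
  have hcz : ContinuousWithinAt g (Ioc z y) z :=
    (hc z ⟨ht.1.trans hz.1.1, hzy.le⟩).mono (fun s hs =>
      ⟨(ht.1.trans hz.1.1).trans hs.1.le, hs.2⟩)
  have : (𝓝[Ioc z y] z).NeBot := by
    rw [nhdsWithin_Ioc_eq_nhdsGT hzy]; infer_instance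
  refine ge_of_tendsto hcz ?_
  filter_upwards [self_mem_nhdsWithin] with s hs using (hpos s hs).le

/-- A variant of `exists_last_zero` with the strict inequality on the left. -/
theorem exists_last_crossing {g : ℝ → ℝ} {x y t : ℝ} (hc : ContinuousOn g (Icc x y))
    (ht : t ∈ Icc x y) (hgt : g t < 0) (hgy : 0 ≤ g y) :
    ∃ z ∈ Icc t y, g z = 0 ∧ ∀ s ∈ Icc z y, 0 ≤ g s := by
  set S := {s ∈ Icc t y | g s < 0} with hS
  have hc' : ContinuousOn g (Icc t y) := hc.mono (Icc_subset_Icc_left ht.1)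
  have hne : S.Nonempty := ⟨t, ⟨le_rfl, ht.2⟩, hgt⟩
  have hbdd : BddAbove S := ⟨y, fun s hs => hs.1.2⟩
  have hcl : IsClosed {s ∈ Icc t y | g s ≤ 0} :=
    hc'.preimage_isClosed_of_isClosed isClosed_Icc isClosed_Iic
  have hz : sSup S ∈ {s ∈ Icc t y | g s ≤ 0} :=
    hcl.closure_subset_iff.2 (fun s hs => ⟨hs.1, hs.2.le⟩) (csSup_mem_closure hne hbdd)
  set z := sSup S with hzdef
  have hpos : ∀ s ∈ Ioc z y, 0 ≤ g s := by
    intro s hs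
    by_contra h
    exact absurd (le_csSup hbdd (⟨⟨hz.1.1.trans hs.1.le, hs.2⟩, not_le.1 h⟩ : s ∈ S))
      (not_le.2 hs.1)
  have hz0 : 0 ≤ g z := by
    rcases eq_or_lt_of_le hz.1.2 with h | h
    · rw [h]; exact hgy
    · have hcz : ContinuousWithinAt g (Ioc z y) z :=
        (hc' z hz.1).mono (fun s hs => ⟨hz.1.1.trans hs.1.le, hs.2⟩)
      have : (𝓝[Ioc z y] z).NeBot := by
        rw [nhdsWithin_Ioc_eq_nhdsGT h]; infer_instance
      refine ge_of_tendsto hcz ?_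
      filter_upwards [self_mem_nhdsWithin] with s hs using hpos s hs
  refine ⟨z, hz.1, le_antisymm hz.2 hz0, fun s hs => ?_⟩
  rcases eq_or_lt_of_le hs.1 with h | h
  · rw [← h]; exact hz0
  · exact hpos s ⟨h, hs.2⟩

theorem exists_first_zero {g : ℝ → ℝ} {x y t : ℝ} (hc : ContinuousOn g (Icc x y))
    (ht : t ∈ Icc x y) (hgt : g t ≤ 0) (hgx : 0 < g x) :
    ∃ z ∈ Ioc x t, g z = 0 ∧ ∀ s ∈ Ico x z, 0 < g s := by
  have hc' : ContinuousOn (fun s => g (-s)) (Icc (-y) (-x)) :=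
    hc.comp continuous_neg.continuousOn (fun s hs => ⟨by linarith [hs.2], by linarith [hs.1]⟩)
  obtain ⟨z, hz, hz0, hzp⟩ := exists_last_zero (t := -t) hc'
    ⟨by linarith [ht.2], by linarith [ht.1]⟩ (by simpa using hgt) (by simpa using hgx)
  refine ⟨-z, ⟨by linarith [hz.2], by linarith [hz.1]⟩, hz0, fun s hs => ?_⟩
  have := hzp (-s) ⟨by linarith [hs.2], by linarith [hs.1]⟩
  simpa using this

/-- A decreasing piece `v` of a solution, described by its level variable `s`: `r s` is the radius
at which `v` takes the value `s`, and `p s = -v'(r s)`. -/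
structure Branch (c : EReal) (f q : ℝ → ℝ) (lo hi : ℝ) (r p : ℝ → ℝ) : Prop where
  mem : ∀ s ∈ Ioo lo hi, InAbs c s
  rpos : ∀ s ∈ Ioo lo hi, 0 < r s
  ppos : ∀ s ∈ Ioo lo hi, 0 < p s
  rder : ∀ s ∈ Ioo lo hi, HasDerivAt r (-1 / p s) s
  pder : ∀ s ∈ Ioo lo hi, HasDerivAt p (logd q (r s) - f s / p s) s
  epos : ∀ s ∈ Ioo lo hi, 0 < p s ^ 2 + 2 * Fint f s

variable {c : EReal} {f q : ℝ → ℝ} {b β Hinf : ℝ}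

/-- The quantity `q(r) p`. -/
def yB (q r p : ℝ → ℝ) (s : ℝ) : ℝ := q (r s) * p s

/-- Twice the energy. -/
def eB (f p : ℝ → ℝ) (s : ℝ) : ℝ := p s ^ 2 + 2 * Fint f s

/-- The weighted energy. -/
def WB (f q r p : ℝ → ℝ) (s : ℝ) : ℝ := q (r s) ^ 2 * eB f p s

/-- The functional `(Q/q) √e`. -/
def YB (f q r p : ℝ → ℝ) (s : ℝ) : ℝ := Kq q (r s) * Real.sqrt (eB f p s)

/-- The Pohozaev-type functional `(Q/q) q e - 2 (F/f) q p`. -/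
def PB (f q r p : ℝ → ℝ) (s : ℝ) : ℝ :=
  Kq q (r s) * q (r s) * eB f p s - 2 * Lam f s * (q (r s) * p s)

namespace Coeff

variable (C : Coeff q Hinf)
include C

theorem logd_pos {r : ℝ} (hr : 0 < r) : 0 < logd q r := div_pos (C.dpos r hr) (C.pos r hr)

theorem dq_eq {r : ℝ} (hr : 0 < r) : deriv q r = logd q r * q r := by
  unfold logd; field_simp [(C.pos r hr).ne']

end Coeff

namespace Branch

variable {lo hi : ℝ} {r p : ℝ → ℝ} (C : Coeff q Hinf) (N : Nonlin c f b β Hinf)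
  (B : Branch c f q lo hi r p)
include B

theorem rcont {s : ℝ} (hs : s ∈ Ioo lo hi) : ContinuousAt r s := (B.rder s hs).continuousAt

theorem pcont {s : ℝ} (hs : s ∈ Ioo lo hi) : ContinuousAt p s := (B.pder s hs).continuousAt

theorem r_anti {s t : ℝ} (hs : s ∈ Ioo lo hi) (ht : t ∈ Ioo lo hi) (hst : s ≤ t) : r t ≤ r s := by
  refine le_of_deriv_nonpos hst (fun x hx => (B.rcont
    ⟨hs.1.trans_le hx.1, hx.2.trans_lt ht.2⟩).continuousWithinAt) (fun x hx _ => ?_)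
  have hx' : x ∈ Ioo lo hi := ⟨hs.1.trans hx.1, hx.2.trans ht.2⟩
  exact ⟨_, div_nonpos_of_nonpos_of_nonneg (by norm_num) (B.ppos x hx').le, B.rder x hx'⟩

include C

theorem qpos {s : ℝ} (hs : s ∈ Ioo lo hi) : 0 < q (r s) := C.pos _ (B.rpos s hs)

theorem ypos {s : ℝ} (hs : s ∈ Ioo lo hi) : 0 < yB q r p s := mul_pos (B.qpos C hs) (B.ppos s hs)

theorem qder {s : ℝ} (hs : s ∈ Ioo lo hi) :
    HasDerivAt (fun s => q (r s)) (-(logd q (r s) * q (r s) / p s)) s := by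
  refine ((C.der (r s) (B.rpos s hs)).comp s (B.rder s hs)).congr_deriv ?_
  rw [C.dq_eq (B.rpos s hs)]; ring

theorem Kder {s : ℝ} (hs : s ∈ Ioo lo hi) :
    HasDerivAt (fun s => Kq q (r s)) (-(Hfun q (r s) / p s)) s := by
  refine ((C.Kder (r s) (B.rpos s hs)).comp s (B.rder s hs)).congr_deriv ?_
  ring

theorem yder {s : ℝ} (hs : s ∈ Ioo lo hi) :
    HasDerivAt (yB q r p) (-(q (r s) * f s / p s)) s := by
  refine ((B.qder C hs).mul (B.pder s hs)).congr_deriv ?_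
  have := (B.ppos s hs).ne'
  field_simp; ring

theorem y2der {s : ℝ} (hs : s ∈ Ioo lo hi) :
    HasDerivAt (fun s => yB q r p s ^ 2) (-(2 * q (r s) ^ 2 * f s)) s := by
  refine ((B.yder C hs).pow 2).congr_deriv ?_
  have := (B.ppos s hs).ne'
  unfold yB
  field_simp; norm_num; ring

theorem ycont {s : ℝ} (hs : s ∈ Ioo lo hi) : ContinuousAt (yB q r p) s :=
  (B.yder C hs).continuousAt

include N

omit C in
theorem econt {s : ℝ} (hs : s ∈ Ioo lo hi) : ContinuousAt (eB f p) s :=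
  ((B.pcont hs).pow 2).add ((N.Fcont s (B.mem s hs)).const_mul 2)

theorem Wcont {s : ℝ} (hs : s ∈ Ioo lo hi) : ContinuousAt (WB f q r p) s :=
  ((B.qder C hs).continuousAt.pow 2).mul (B.econt N hs)

theorem Ycont {s : ℝ} (hs : s ∈ Ioo lo hi) : ContinuousAt (YB f q r p) s :=
  (B.Kder C hs).continuousAt.mul (Real.continuous_sqrt.continuousAt.comp (B.econt N hs))

omit C in
theorem eder {s : ℝ} (hs : s ∈ Ioo lo hi) (h0 : s ≠ 0) :
    HasDerivAt (eB f p) (2 * p s * logd q (r s)) s := by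
  refine (((B.pder s hs).pow 2).add ((N.Fder s h0 (B.mem s hs)).const_mul 2)).congr_deriv ?_
  have := (B.ppos s hs).ne'
  field_simp; norm_num; ring

theorem Wder {s : ℝ} (hs : s ∈ Ioo lo hi) (h0 : s ≠ 0) :
    HasDerivAt (WB f q r p) (-(4 * (deriv q (r s) * q (r s)) * Fint f s / p s)) s := by
  refine (((B.qder C hs).pow 2).mul (B.eder N hs h0)).congr_deriv ?_
  have := (B.ppos s hs).ne'
  rw [C.dq_eq (B.rpos s hs)]
  unfold eB
  simp only [Pi.pow_apply]
  field_simp; norm_num; ring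

theorem Yder {s : ℝ} (hs : s ∈ Ioo lo hi) (h0 : s ≠ 0) :
    HasDerivAt (YB f q r p) ((p s ^ 2 * (1 - 2 * Hfun q (r s)) - 2 * Hfun q (r s) * Fint f s) /
      (p s * Real.sqrt (eB f p s))) s := by
  have he : 0 < eB f p s := B.epos s hs
  refine ((B.Kder C hs).mul ((B.eder N hs h0).sqrt he.ne')).congr_deriv ?_
  have hp := (B.ppos s hs).ne'
  have hsq : 0 < Real.sqrt (eB f p s) := Real.sqrt_pos.2 he
  have hs2 : Real.sqrt (eB f p s) ^ 2 = p s ^ 2 + 2 * Fint f s := Real.sq_sqrt he.le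
  have hka : Kq q (r s) * logd q (r s) = 1 - Hfun q (r s) := by
    rw [C.Heq _ (B.rpos s hs)]; ring
  field_simp
  rw [hs2]
  linear_combination (p s ^ 2) * hka

theorem Pder {s : ℝ} (hs : s ∈ Ioo lo hi) (h0 : b < |s|) :
    HasDerivAt (PB f q r p)
      (-(yB q r p s * (2 * Hfun q (r s) - 1 + 2 * deriv (Lam f) |s|))) s := by
  have hs0 : s ≠ 0 := fun h => by
    rw [h, abs_zero] at h0; linarith [N.b_pos]
  have hL := N.Lder s h0 (B.mem s hs)
  refine ((((B.Kder C hs).mul (B.qder C hs)).mul (B.eder N hs hs0)).sub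
    ((hL.const_mul 2).mul (B.yder C hs))).congr_deriv ?_
  have hp := (B.ppos s hs).ne'
  have hka : Kq q (r s) * logd q (r s) = 1 - Hfun q (r s) := by
    rw [C.Heq _ (B.rpos s hs)]; ring
  have hf : f s ≠ 0 := by
    have h1 : f |s| ≠ 0 := (N.pos |s| h0 (by
      have := B.mem s hs; unfold InAbs at *; rwa [abs_abs])).ne'
    rcases abs_cases s with ⟨h2, _⟩ | ⟨h2, _⟩
    · rwa [h2] at h1
    · rw [h2, N.odd] at h1; exact neg_ne_zero.1 h1
  have hLf : Lam f s * f s = Fint f s := by unfold Lam; field_simp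
  simp only [Pi.mul_apply]
  unfold yB eB
  field_simp
  rw [← hLf]
  linear_combination (-q (r s) * (2 * Lam f s * f s - p s ^ 2)) * hka

end Branch

end

section

variable {c : EReal} {f q : ℝ → ℝ} {b β Hinf : ℝ}

section Pair

variable {lo₁ hi₁ lo₂ hi₂ : ℝ} {r₁ p₁ r₂ p₂ : ℝ → ℝ} (C : Coeff q Hinf)
  (B₁ : Branch c f q lo₁ hi₁ r₁ p₁) (B₂ : Branch c f q lo₂ hi₂ r₂ p₂) {s₀ s₁ : ℝ}
include B₁ B₂

theorem sub_r_anti (hle : s₀ ≤ s₁) (hI₁ : Icc s₀ s₁ ⊆ Ioo lo₁ hi₁) (hI₂ : Icc s₀ s₁ ⊆ Ioo lo₂ hi₂)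
    (hp : ∀ s ∈ Ioo s₀ s₁, p₁ s ≤ p₂ s) : r₁ s₁ - r₂ s₁ ≤ r₁ s₀ - r₂ s₀ := by
  refine le_of_deriv_nonpos (g := fun s => r₁ s - r₂ s) hle (fun s hs =>
    ((B₁.rcont (hI₁ hs)).sub (B₂.rcont (hI₂ hs))).continuousWithinAt) (fun s hs _ => ?_)
  have h1 := hI₁ (Ioo_subset_Icc_self hs)
  have h2 := hI₂ (Ioo_subset_Icc_self hs)
  refine ⟨_, ?_, (B₁.rder s h1).sub (B₂.rder s h2)⟩
  have := one_div_le_one_div_of_le (B₁.ppos s h1) (hp s hs)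
  simp only [neg_div]
  linarith

include C

/-- If `r₁ ≤ r₂`, then `(p₂² - p₁²) q(r₁)` is nonincreasing. -/
theorem psq_sub_anti (hle : s₀ ≤ s₁) (hI₁ : Icc s₀ s₁ ⊆ Ioo lo₁ hi₁)
    (hI₂ : Icc s₀ s₁ ⊆ Ioo lo₂ hi₂) (hr : ∀ s ∈ Ioo s₀ s₁, r₁ s ≤ r₂ s) :
    (p₂ s₁ ^ 2 - p₁ s₁ ^ 2) * q (r₁ s₁) ≤ (p₂ s₀ ^ 2 - p₁ s₀ ^ 2) * q (r₁ s₀) := by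
  refine le_of_deriv_nonpos (g := fun s => (p₂ s ^ 2 - p₁ s ^ 2) * q (r₁ s)) hle (fun s hs =>
    ((((B₂.pcont (hI₂ hs)).pow 2).sub ((B₁.pcont (hI₁ hs)).pow 2)).mul
      (B₁.qder C (hI₁ hs)).continuousAt).continuousWithinAt) (fun s hs _ => ?_)
  have h1 := hI₁ (Ioo_subset_Icc_self hs)
  have h2 := hI₂ (Ioo_subset_Icc_self hs)
  refine ⟨_, ?_, ((((B₂.pder s h2).pow 2).sub ((B₁.pder s h1).pow 2)).mul (B₁.qder C h1))⟩
  have hp1 := B₁.ppos s h1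
  have hp2 := B₂.ppos s h2
  have hq := B₁.qpos C h1
  have ha : logd q (r₂ s) ≤ logd q (r₁ s) := C.logd_anti _ _ (B₁.rpos s h1) (hr s hs)
  have ha1 := C.logd_pos (B₁.rpos s h1)
  have key : ∀ A1 A2 Q P1 P2 f : ℝ, 0 < P1 → 0 < P2 → 0 < Q → A2 ≤ A1 → 0 < A1 →
      ((2:ℕ) * P2 ^ (2 - 1) * (A2 - f / P2) - (2:ℕ) * P1 ^ (2 - 1) * (A1 - f / P1)) * Q +
        (P2 ^ 2 - P1 ^ 2) * -(A1 * Q / P1) ≤ 0 := by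
    intro A1 A2 Q P1 P2 f h1 h2 h3 h4 h5
    have : ((2:ℕ) * P2 ^ (2 - 1) * (A2 - f / P2) - (2:ℕ) * P1 ^ (2 - 1) * (A1 - f / P1)) * Q +
        (P2 ^ 2 - P1 ^ 2) * -(A1 * Q / P1) =
        -(2 * P2 * (A1 - A2) * Q + A1 * Q * (P2 - P1) ^ 2 / P1) := by
      norm_num; field_simp; ring
    rw [this]
    have : 0 ≤ 2 * P2 * (A1 - A2) * Q := by
      have := sub_nonneg.2 h4; positivity
    have : 0 ≤ A1 * Q * (P2 - P1) ^ 2 / P1 := by positivity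
    linarith
  exact key _ _ _ _ _ _ hp1 hp2 hq ha ha1

theorem p_le_of_r_le (hle : s₀ ≤ s₁) (hI₁ : Icc s₀ s₁ ⊆ Ioo lo₁ hi₁)
    (hI₂ : Icc s₀ s₁ ⊆ Ioo lo₂ hi₂) (hr : ∀ s ∈ Ioo s₀ s₁, r₁ s ≤ r₂ s) (hp : p₂ s₀ ≤ p₁ s₀) :
    p₂ s₁ ≤ p₁ s₁ := by
  have h := psq_sub_anti C B₁ B₂ hle hI₁ hI₂ hr
  have m0 : s₀ ∈ Icc s₀ s₁ := ⟨le_rfl, hle⟩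
  have m1 : s₁ ∈ Icc s₀ s₁ := ⟨hle, le_rfl⟩
  have h0 : (p₂ s₀ ^ 2 - p₁ s₀ ^ 2) * q (r₁ s₀) ≤ 0 := by
    refine mul_nonpos_of_nonpos_of_nonneg ?_ (B₁.qpos C (hI₁ m0)).le
    nlinarith [B₂.ppos _ (hI₂ m0)]
  have h1 : p₂ s₁ ^ 2 - p₁ s₁ ^ 2 ≤ 0 := by
    by_contra hh
    push Not at hh
    have := mul_pos hh (B₁.qpos C (hI₁ m1))
    linarith
  by_contra hh
  push Not at hh
  nlinarith [B₁.ppos _ (hI₁ m1)]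

omit C in
theorem p_lt_of_e_lt {s : ℝ} (h₁ : s ∈ Ioo lo₁ hi₁) (h₂ : s ∈ Ioo lo₂ hi₂)
    (h : eB f p₁ s < eB f p₂ s) : p₁ s < p₂ s := by
  unfold eB at h
  have := B₁.ppos s h₁
  have := B₂.ppos s h₂
  by_contra hh
  push Not at hh
  nlinarith

theorem p_lt_of_W_lt {s : ℝ} (h₁ : s ∈ Ioo lo₁ hi₁) (h₂ : s ∈ Ioo lo₂ hi₂)
    (hr : r₂ s ≤ r₁ s) (h : WB f q r₁ p₁ s < WB f q r₂ p₂ s) : p₁ s < p₂ s := by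
  refine p_lt_of_e_lt B₁ B₂ h₁ h₂ ?_
  unfold WB at h
  have hq := C.mono _ _ (B₂.rpos s h₂).le hr
  have hq2 := B₂.qpos C h₂
  have he1 : 0 < eB f p₁ s := B₁.epos s h₁
  have h3 : q (r₂ s) ^ 2 * eB f p₁ s ≤ q (r₁ s) ^ 2 * eB f p₁ s := by gcongr
  exact lt_of_mul_lt_mul_left (h3.trans_lt h) (by positivity)

variable (N : Nonlin c f b β Hinf)
include N

/-- Propagation towards smaller levels inside `[-β, β]`. -/
theorem propagate_core (hle : s₀ ≤ s₁) (hI₁ : Icc s₀ s₁ ⊆ Ioo lo₁ hi₁)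
    (hI₂ : Icc s₀ s₁ ⊆ Ioo lo₂ hi₂) (hβ : ∀ s ∈ Icc s₀ s₁, |s| ≤ β)
    (hr : r₂ s₁ ≤ r₁ s₁) (hW : WB f q r₁ p₁ s₁ < WB f q r₂ p₂ s₁)
    (hp : ∀ s ∈ Ioo s₀ s₁, p₁ s ≤ p₂ s) :
    r₂ s₀ ≤ r₁ s₀ ∧ WB f q r₁ p₁ s₀ < WB f q r₂ p₂ s₀ := by
  have hrr : ∀ s ∈ Icc s₀ s₁, r₂ s ≤ r₁ s := by
    intro s hs
    have := sub_r_anti B₁ B₂ hs.2 ((Icc_subset_Icc_left hs.1).trans hI₁)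
      ((Icc_subset_Icc_left hs.1).trans hI₂) (fun t ht => hp t ⟨hs.1.trans_lt ht.1, ht.2⟩)
    linarith
  refine ⟨hrr s₀ ⟨le_rfl, hle⟩, ?_⟩
  have := le_of_deriv_nonpos (g := fun s => WB f q r₂ p₂ s - WB f q r₁ p₁ s) hle (fun s hs =>
    ((B₂.Wcont C N (hI₂ hs)).sub (B₁.Wcont C N (hI₁ hs))).continuousWithinAt) (fun s hs h0 => by
      have h1 := hI₁ (Ioo_subset_Icc_self hs)
      have h2 := hI₂ (Ioo_subset_Icc_self hs)
      refine ⟨_, ?_, (B₂.Wder C N h2 h0).sub (B₁.Wder C N h1 h0)⟩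
      have hF := N.Fle s (hβ s (Ioo_subset_Icc_self hs))
      have hqq := C.qd_mono _ _ (B₂.rpos s h2) (hrr s (Ioo_subset_Icc_self hs))
      have hp1 := B₁.ppos s h1
      have hz : deriv q (r₂ s) * q (r₂ s) / p₂ s ≤ deriv q (r₁ s) * q (r₁ s) / p₁ s := by
        have := hp s hs
        have h5 := mul_pos (C.dpos _ (B₁.rpos s h1)) (B₁.qpos C h1)
        gcongr
      have e1 : -(4 * (deriv q (r₂ s) * q (r₂ s)) * Fint f s / p₂ s) -
          -(4 * (deriv q (r₁ s) * q (r₁ s)) * Fint f s / p₁ s) =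
          4 * Fint f s * (deriv q (r₁ s) * q (r₁ s) / p₁ s - deriv q (r₂ s) * q (r₂ s) / p₂ s) := by
        ring
      rw [e1]
      exact mul_nonpos_of_nonpos_of_nonneg (by linarith) (by linarith))
  linarith

theorem propagate (hle : s₀ ≤ s₁) (hI₁ : Icc s₀ s₁ ⊆ Ioo lo₁ hi₁)
    (hI₂ : Icc s₀ s₁ ⊆ Ioo lo₂ hi₂) (hβ : ∀ s ∈ Icc s₀ s₁, |s| ≤ β)
    (hr : r₂ s₁ ≤ r₁ s₁) (hW : WB f q r₁ p₁ s₁ < WB f q r₂ p₂ s₁) :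
    r₂ s₀ ≤ r₁ s₀ ∧ WB f q r₁ p₁ s₀ < WB f q r₂ p₂ s₀ ∧ p₁ s₀ < p₂ s₀ := by
  have m0 : s₀ ∈ Icc s₀ s₁ := ⟨le_rfl, hle⟩
  have m1 : s₁ ∈ Icc s₀ s₁ := ⟨hle, le_rfl⟩
  have hp : ∀ s ∈ Icc s₀ s₁, 0 < p₂ s - p₁ s := by
    by_contra hcon
    push Not at hcon
    obtain ⟨t, ht, hgt⟩ := hcon
    obtain ⟨z, hz, hz0, hzp⟩ := exists_last_zero (g := fun s => p₂ s - p₁ s) (fun s hs =>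
      ((B₂.pcont (hI₂ hs)).sub (B₁.pcont (hI₁ hs))).continuousWithinAt) ht hgt
      (sub_pos.2 (p_lt_of_W_lt C B₁ B₂ (hI₁ m1) (hI₂ m1) hr hW))
    have hsub : Icc z s₁ ⊆ Icc s₀ s₁ := Icc_subset_Icc_left (ht.1.trans hz.1)
    have h := propagate_core C B₁ B₂ N hz.2.le (hsub.trans hI₁) (hsub.trans hI₂)
      (fun s hs => hβ s (hsub hs)) hr hW (fun s hs => (sub_pos.1 (hzp s ⟨hs.1, hs.2.le⟩)).le)
    have mz : z ∈ Icc z s₁ := ⟨le_rfl, hz.2.le⟩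
    have := p_lt_of_W_lt C B₁ B₂ (hI₁ (hsub mz)) (hI₂ (hsub mz)) h.1 h.2
    linarith
  have h := propagate_core C B₁ B₂ N hle hI₁ hI₂ hβ hr hW
    (fun s hs => (sub_pos.1 (hp s (Ioo_subset_Icc_self hs))).le)
  exact ⟨h.1, h.2, sub_pos.1 (hp _ m0)⟩

end Pair

section Tail

variable {hi₁ hi₂ : ℝ} {r₁ p₁ r₂ p₂ : ℝ → ℝ} (C : Coeff q Hinf) (N : Nonlin c f b β Hinf)
  (B₁ : Branch c f q 0 hi₁ r₁ p₁) (B₂ : Branch c f q 0 hi₂ r₂ p₂) {s₀ : ℝ}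
include C N B₁ B₂

theorem tail_p_le (h0 : 0 < s₀) (h1 : s₀ < hi₁) (h2 : s₀ < hi₂)
    (hl : Tendsto p₂ (𝓝[>] 0) (𝓝 0)) (hr : ∀ s, 0 < s → s < s₀ → r₁ s ≤ r₂ s) :
    p₂ s₀ ≤ p₁ s₀ := by
  have hI1 : ∀ s, 0 < s → s ≤ s₀ → s ∈ Ioo 0 hi₁ := fun s hs hs0 => ⟨hs, hs0.trans_lt h1⟩
  have hI2 : ∀ s, 0 < s → s ≤ s₀ → s ∈ Ioo 0 hi₂ := fun s hs hs0 => ⟨hs, hs0.trans_lt h2⟩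
  by_contra hcon
  push Not at hcon
  set κ := (p₂ s₀ ^ 2 - p₁ s₀ ^ 2) * q (r₁ s₀) with hκ
  have hp1 := B₁.ppos s₀ (hI1 s₀ h0 le_rfl)
  have hκ0 : 0 < κ := mul_pos (by nlinarith) (B₁.qpos C (hI1 s₀ h0 le_rfl))
  have hκle : ∀ s, 0 < s → s ≤ s₀ → κ ≤ p₂ s ^ 2 * q (r₁ s) := by
    intro s hs hss
    have h := psq_sub_anti C B₁ B₂ hss (fun t ht => hI1 t (hs.trans_le ht.1) ht.2)
      (fun t ht => hI2 t (hs.trans_le ht.1) ht.2) (fun t ht => hr t (hs.trans ht.1) ht.2)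
    refine h.trans ?_
    have := B₁.qpos C (hI1 s hs hss)
    nlinarith [mul_nonneg (sq_nonneg (p₁ s)) this.le]
  set σ := min s₀ b with hσ
  have hσ0 : 0 < σ := lt_min h0 N.b_pos
  have hσs : σ ≤ s₀ := min_le_left _ _
  set M := yB q r₂ p₂ σ ^ 2 with hM
  have hM0 : 0 < M := by have := B₂.ypos C (hI2 σ hσ0 hσs); positivity
  have hMle : ∀ s, 0 < s → s ≤ σ → yB q r₂ p₂ s ^ 2 ≤ M := by
    intro s hs hss
    refine le_of_deriv_nonneg (g := fun s => yB q r₂ p₂ s ^ 2) hss (fun t ht =>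
      (B₂.y2der C (hI2 t (hs.trans_le ht.1) (ht.2.trans hσs))).continuousAt.continuousWithinAt)
      (fun t ht _ => ⟨_, ?_, B₂.y2der C (hI2 t (hs.trans ht.1) (ht.2.le.trans hσs))⟩)
    have hf := N.nonpos t (hs.trans ht.1).le (ht.2.le.trans (min_le_right _ _))
    have := mul_nonneg (sq_nonneg (q (r₂ t))) (neg_nonneg.2 hf)
    show 0 ≤ -(2 * q (r₂ t) ^ 2 * f t)
    linarith
  have hlow : ∀ s, 0 < s → s < σ → κ ^ 2 / M ≤ p₂ s ^ 2 := by
    intro s hs hss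
    have i1 := hI1 s hs (hss.le.trans hσs)
    have i2 := hI2 s hs (hss.le.trans hσs)
    have a1 := hκle s hs (hss.le.trans hσs)
    have a2 := hMle s hs hss.le
    have a3 := C.mono _ _ (B₁.rpos s i1).le (hr s hs (hss.trans_le hσs))
    have q1 := B₁.qpos C i1
    have hp2 := B₂.ppos s i2
    unfold yB at a2
    have a4 : (κ * q (r₂ s)) ≤ M := by
      refine le_trans ?_ a2
      have : κ ≤ p₂ s ^ 2 * q (r₂ s) := a1.trans (by gcongr)
      calc κ * q (r₂ s) ≤ p₂ s ^ 2 * q (r₂ s) * q (r₂ s) := by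
            have := q1.trans_le a3; gcongr
        _ = _ := by ring
    rw [div_le_iff₀ hM0]
    have a5 : κ * q (r₁ s) ≤ M := (by gcongr : κ * q (r₁ s) ≤ κ * q (r₂ s)).trans a4
    calc κ ^ 2 = κ * κ := by ring
      _ ≤ κ * (p₂ s ^ 2 * q (r₁ s)) := by gcongr
      _ = p₂ s ^ 2 * (κ * q (r₁ s)) := by ring
      _ ≤ p₂ s ^ 2 * M := by gcongr
  have hl2 : Tendsto (fun s => p₂ s ^ 2) (𝓝[>] 0) (𝓝 0) := by simpa using hl.pow 2
  have := ge_of_tendsto hl2 (b := κ ^ 2 / M) (by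
    filter_upwards [Ioo_mem_nhdsGT hσ0] with s hs using hlow s hs.1 hs.2)
  have h3 : 0 < κ ^ 2 / M := by positivity
  linarith

omit B₁ N in
theorem YB_eq {s : ℝ} (hs : s ∈ Ioo 0 hi₂) :
    YB f q r₂ p₂ s = Kq q (r₂ s) / q (r₂ s) * Real.sqrt (WB f q r₂ p₂ s) := by
  have hq := B₂.qpos C hs
  unfold YB WB
  rw [Real.sqrt_mul (sq_nonneg _), Real.sqrt_sq hq.le]
  field_simp

omit B₁ in
theorem tail_YB_tendsto (h0 : 0 < s₀) (h2 : s₀ < hi₂) (hβ : s₀ ≤ β)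
    (hl : Tendsto p₂ (𝓝[>] 0) (𝓝 0)) : Tendsto (YB f q r₂ p₂) (𝓝[>] 0) (𝓝 0) := by
  have hI2 : ∀ s, 0 < s → s ≤ s₀ → s ∈ Ioo 0 hi₂ := fun s hs hs0 => ⟨hs, hs0.trans_lt h2⟩
  have hF0 : Fint f 0 = 0 := by simp [Fint]
  have hnear : ∀ᶠ s in 𝓝[>] (0 : ℝ), s ∈ Ioo 0 s₀ := Ioo_mem_nhdsGT h0
  by_cases hb : ∃ R, ∀ s, 0 < s → s < s₀ → r₂ s ≤ R
  · obtain ⟨R, hR⟩ := hb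
    have he : Tendsto (fun s => eB f p₂ s) (𝓝[>] 0) (𝓝 0) := by
      have hF : Tendsto (Fint f) (𝓝[>] 0) (𝓝 0) := by
        have := (N.Fcont 0 (N.β_mem.of_le (by simp))).tendsto
        rw [hF0] at this
        exact this.mono_left nhdsWithin_le_nhds
      simpa [eB] using (hl.pow 2).add (hF.const_mul 2)
    have hs : Tendsto (fun s => Kq q R * Real.sqrt (eB f p₂ s)) (𝓝[>] 0) (𝓝 0) := by
      have := ((Real.continuous_sqrt.tendsto 0).comp he).const_mul (Kq q R)
      simpa using this
    refine squeeze_zero' ?_ ?_ hs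
    · filter_upwards [hnear] with s hs
      exact mul_nonneg (C.Kpos _ (B₂.rpos s (hI2 s hs.1 hs.2.le))).le (Real.sqrt_nonneg _)
    · filter_upwards [hnear] with s hs
      have := C.K_mono _ _ (B₂.rpos s (hI2 s hs.1 hs.2.le)) (hR s hs.1 hs.2)
      unfold YB
      gcongr
  · push Not at hb
    have hrt : Tendsto r₂ (𝓝[>] 0) atTop := by
      rw [tendsto_atTop]
      intro R
      obtain ⟨t, ht0, hts, hRt⟩ := hb R
      filter_upwards [Ioo_mem_nhdsGT ht0] with s hs
      exact hRt.le.trans (B₂.r_anti (hI2 s hs.1 (hs.2.le.trans hts.le)) (hI2 t ht0 hts.le) hs.2.le)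
    set M := WB f q r₂ p₂ s₀
    have hW : ∀ s, 0 < s → s < s₀ → WB f q r₂ p₂ s ≤ M := by
      intro s hs hss
      refine le_of_deriv_nonneg hss.le (fun t ht =>
        (B₂.Wcont C N (hI2 t (hs.trans_le ht.1) ht.2)).continuousWithinAt)
        (fun t ht h => ⟨_, ?_, B₂.Wder C N (hI2 t (hs.trans ht.1) ht.2.le) h⟩)
      have hm := hI2 t (hs.trans ht.1) ht.2.le
      have hF := N.Fle t (by rw [abs_of_pos (hs.trans ht.1)]; exact ht.2.le.trans hβ)
      have h5 := mul_pos (C.dpos _ (B₂.rpos t hm)) (B₂.qpos C hm)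
      have : 0 ≤ 4 * (deriv q (r₂ t) * q (r₂ t)) * (-Fint f t) / p₂ t :=
        div_nonneg (mul_nonneg (by positivity) (by linarith)) (B₂.ppos t hm).le
      have e : -(4 * (deriv q (r₂ t) * q (r₂ t)) * Fint f t / p₂ t) =
        4 * (deriv q (r₂ t) * q (r₂ t)) * (-Fint f t) / p₂ t := by ring
      rw [e]; exact this
    have hs : Tendsto (fun s => Kq q (r₂ s) / q (r₂ s) * Real.sqrt M) (𝓝[>] 0) (𝓝 0) := by
      have := (C.Kq_lim.comp hrt).mul_const (Real.sqrt M)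
      simpa using this
    refine squeeze_zero' ?_ ?_ hs
    · filter_upwards [hnear] with s hs
      exact mul_nonneg (C.Kpos _ (B₂.rpos s (hI2 s hs.1 hs.2.le))).le (Real.sqrt_nonneg _)
    · filter_upwards [hnear] with s hs
      have hm := hI2 s hs.1 hs.2.le
      rw [YB_eq C B₂ hm]
      have h1 := C.Kpos _ (B₂.rpos s hm)
      have h2 := B₂.qpos C hm
      have := hW s hs.1 hs.2
      gcongr

omit C N B₁ B₂ in
theorem phi_le {H₁ H₂ P₁ P₂ F : ℝ} (hH : H₁ ≤ H₂) (hH₂ : H₂ < 1 / 2)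
    (hP1 : 0 < P₁) (hP : P₁ ≤ P₂) (hF : F ≤ 0) (he1 : 0 < P₁ ^ 2 + 2 * F)
    (he2 : 0 < P₂ ^ 2 + 2 * F) :
    (P₂ ^ 2 * (1 - 2 * H₂) - 2 * H₂ * F) / (P₂ * Real.sqrt (P₂ ^ 2 + 2 * F)) ≤
      (P₁ ^ 2 * (1 - 2 * H₁) - 2 * H₁ * F) / (P₁ * Real.sqrt (P₁ ^ 2 + 2 * F)) := by
  have hP2 := hP1.trans_le hP
  have hs1 := Real.sqrt_pos.2 he1
  have hs2 := Real.sqrt_pos.2 he2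
  have hx1 : P₂ ^ 2 * (1 - 2 * H₂) - 2 * H₂ * F = (1 - 2 * H₂) * (P₂ ^ 2 + F) + (-F) := by ring
  have hx2 : (1 - 2 * H₂) * (P₁ ^ 2 + F) + (-F) ≤ P₁ ^ 2 * (1 - 2 * H₁) - 2 * H₁ * F := by
    have : 0 ≤ (H₂ - H₁) * (2 * P₁ ^ 2 + 2 * F) :=
      mul_nonneg (by linarith) (by nlinarith)
    linarith
  refine le_trans ?_ (div_le_div_of_nonneg_right hx2 (by positivity))
  rw [hx1, div_le_div_iff₀ (by positivity) (by positivity)]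
  set k := 1 - 2 * H₂
  have hk : 0 < k := by simp only [k]; linarith
  set z₁ := P₁ ^ 2 + F
  set z₂ := P₂ ^ 2 + F
  have hz1 : 0 < z₁ := by simp only [z₁]; linarith
  have hz : z₁ ≤ z₂ := by simp only [z₁, z₂]; gcongr
  have hA : 0 ≤ -F := by linarith
  have e1 : (P₁ * Real.sqrt (P₁ ^ 2 + 2 * F)) ^ 2 = z₁ ^ 2 - F ^ 2 := by
    rw [mul_pow, Real.sq_sqrt he1.le]; ring
  have e2 : (P₂ * Real.sqrt (P₂ ^ 2 + 2 * F)) ^ 2 = z₂ ^ 2 - F ^ 2 := by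
    rw [mul_pow, Real.sq_sqrt he2.le]; ring
  refine le_of_pow_le_pow_left₀ two_ne_zero (by positivity) ?_
  rw [mul_pow _ (P₁ * _), mul_pow _ (P₂ * _), e1, e2]
  set A := -F
  have hFA : F ^ 2 = A ^ 2 := by simp only [A]; ring
  rw [hFA]
  have hd : 0 ≤ z₂ - z₁ := by linarith
  have : (k * z₁ + A) ^ 2 * (z₂ ^ 2 - A ^ 2) - (k * z₂ + A) ^ 2 * (z₁ ^ 2 - A ^ 2) =
      k ^ 2 * A ^ 2 * ((z₂ - z₁) * (z₁ + z₂)) + 2 * k * A * ((z₂ - z₁) * (z₁ * z₂ + A ^ 2)) +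
      A ^ 2 * ((z₂ - z₁) * (z₁ + z₂)) := by ring
  have hz2 := hz1.trans_le hz
  have : 0 ≤ k ^ 2 * A ^ 2 * ((z₂ - z₁) * (z₁ + z₂)) +
    2 * k * A * ((z₂ - z₁) * (z₁ * z₂ + A ^ 2)) + A ^ 2 * ((z₂ - z₁) * (z₁ + z₂)) := by positivity
  linarith

theorem tail_YB_le (h0 : 0 < s₀) (h1 : s₀ < hi₁) (h2 : s₀ < hi₂) (hβ : s₀ ≤ β)
    (hl : Tendsto p₂ (𝓝[>] 0) (𝓝 0)) (hr : ∀ s, 0 < s → s < s₀ → r₂ s ≤ r₁ s)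
    (hp : ∀ s, 0 < s → s < s₀ → p₁ s ≤ p₂ s) : YB f q r₂ p₂ s₀ ≤ YB f q r₁ p₁ s₀ := by
  have hI1 : ∀ s, 0 < s → s ≤ s₀ → s ∈ Ioo 0 hi₁ := fun s hs hs0 => ⟨hs, hs0.trans_lt h1⟩
  have hI2 : ∀ s, 0 < s → s ≤ s₀ → s ∈ Ioo 0 hi₂ := fun s hs hs0 => ⟨hs, hs0.trans_lt h2⟩
  have hmono : ∀ s, 0 < s → s < s₀ → YB f q r₂ p₂ s₀ - YB f q r₁ p₁ s₀ ≤ YB f q r₂ p₂ s := by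
    intro s hs hss
    have := le_of_deriv_nonpos (g := fun s => YB f q r₂ p₂ s - YB f q r₁ p₁ s) hss.le (fun t ht =>
      ((B₂.Ycont C N (hI2 t (hs.trans_le ht.1) ht.2)).sub
        (B₁.Ycont C N (hI1 t (hs.trans_le ht.1) ht.2))).continuousWithinAt) (fun t ht h => by
        have i1 := hI1 t (hs.trans ht.1) ht.2.le
        have i2 := hI2 t (hs.trans ht.1) ht.2.le
        refine ⟨_, ?_, (B₂.Yder C N i2 h).sub (B₁.Yder C N i1 h)⟩
        have hrt := hr t (hs.trans ht.1) ht.2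
        have := phi_le (C.Hanti _ _ (B₂.rpos t i2) hrt) (C.Hlt _ (B₂.rpos t i2)) (B₁.ppos t i1)
          (hp t (hs.trans ht.1) ht.2)
          (N.Fle t (by rw [abs_of_pos (hs.trans ht.1)]; exact ht.2.le.trans hβ))
          (B₁.epos t i1) (B₂.epos t i2)
        unfold eB
        linarith)
    have h3 : 0 ≤ YB f q r₁ p₁ s :=
      mul_nonneg (C.Kpos _ (B₁.rpos s (hI1 s hs hss.le))).le (Real.sqrt_nonneg _)
    linarith
  have := ge_of_tendsto (tail_YB_tendsto C N B₂ h0 h2 hβ hl)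
    (b := YB f q r₂ p₂ s₀ - YB f q r₁ p₁ s₀) (by
      filter_upwards [Ioo_mem_nhdsGT h0] with s hs using hmono s hs.1 hs.2)
  linarith

theorem tail_W_le (h0 : 0 < s₀) (h1 : s₀ < hi₁) (h2 : s₀ < hi₂) (hβ : s₀ ≤ β)
    (hl : Tendsto p₂ (𝓝[>] 0) (𝓝 0)) (hr : r₂ s₀ ≤ r₁ s₀) :
    WB f q r₂ p₂ s₀ ≤ WB f q r₁ p₁ s₀ := by
  have hI1 : ∀ s, 0 < s → s ≤ s₀ → s ∈ Ioo 0 hi₁ := fun s hs hs0 => ⟨hs, hs0.trans_lt h1⟩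
  have hI2 : ∀ s, 0 < s → s ≤ s₀ → s ∈ Ioo 0 hi₂ := fun s hs hs0 => ⟨hs, hs0.trans_lt h2⟩
  by_contra hW
  push Not at hW
  have hprop : ∀ s, 0 < s → s < s₀ → r₂ s ≤ r₁ s ∧ p₁ s ≤ p₂ s := by
    intro s hs hss
    have := propagate C B₁ B₂ N hss.le (fun t ht => hI1 t (hs.trans_le ht.1) ht.2)
      (fun t ht => hI2 t (hs.trans_le ht.1) ht.2) (fun t ht => by
        rw [abs_of_pos (hs.trans_le ht.1)]; exact ht.2.trans hβ) hr hW
    exact ⟨this.1, this.2.2.le⟩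
  have hY := tail_YB_le C N B₁ B₂ h0 h1 h2 hβ hl (fun s hs hss => (hprop s hs hss).1)
    (fun s hs hss => (hprop s hs hss).2)
  have i1 := hI1 s₀ h0 le_rfl
  have i2 := hI2 s₀ h0 le_rfl
  rw [YB_eq C B₂ i2, YB_eq C B₁ i1] at hY
  have hK := C.Kq_anti _ _ (B₂.rpos _ i2) hr
  have hK1 := div_pos (C.Kpos _ (B₁.rpos _ i1)) (B₁.qpos C i1)
  have hW1 : 0 ≤ WB f q r₁ p₁ s₀ := mul_nonneg (sq_nonneg _) (B₁.epos _ i1).le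
  have hs := Real.sqrt_lt_sqrt hW1 hW
  have hs0 := Real.sqrt_nonneg (WB f q r₁ p₁ s₀)
  have : Kq q (r₁ s₀) / q (r₁ s₀) * Real.sqrt (WB f q r₁ p₁ s₀) <
      Kq q (r₂ s₀) / q (r₂ s₀) * Real.sqrt (WB f q r₂ p₂ s₀) :=
    (mul_lt_mul_of_pos_left hs hK1).trans_le (by gcongr)
  linarith

end Tail

end

section

variable {c : EReal} {f q : ℝ → ℝ} {b β Hinf : ℝ}

theorem eq_zero_of_abs_deriv_le {g : ℝ → ℝ} {x y A : ℝ} (hxy : x ≤ y)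
    (hc : ContinuousOn g (Icc x y)) (hg : ∀ s ∈ Icc x y, 0 ≤ g s)
    (hd : ∀ s ∈ Ioo x y, ∃ d, |d| ≤ A * g s ∧ HasDerivAt g d s) : g x = 0 ↔ g y = 0 := by
  have hexp : ∀ k s : ℝ, HasDerivAt (fun s => Real.exp (k * s)) (Real.exp (k * s) * k) s := by
    intro k s
    simpa using ((hasDerivAt_id s).const_mul k).exp
  have hce : ∀ k : ℝ, ContinuousOn (fun s => g s * Real.exp (k * s)) (Icc x y) := fun k =>
    hc.mul (by fun_prop)
  have h1 : g y * Real.exp (-A * y) ≤ g x * Real.exp (-A * x) := by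
    refine le_of_deriv_nonpos (g := fun s => g s * Real.exp (-A * s)) hxy (hce _) ?_
    intro s hs _
    obtain ⟨d, hdA, h⟩ := hd s hs
    refine ⟨_, ?_, h.mul (hexp (-A) s)⟩
    have : d * Real.exp (-A * s) + g s * (Real.exp (-A * s) * -A) =
      (d - A * g s) * Real.exp (-A * s) := by ring
    rw [this]
    exact mul_nonpos_of_nonpos_of_nonneg (by linarith [le_abs_self d]) (Real.exp_pos _).le
  have h2 : g x * Real.exp (A * x) ≤ g y * Real.exp (A * y) := by
    refine le_of_deriv_nonneg (g := fun s => g s * Real.exp (A * s)) hxy (hce _) ?_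
    intro s hs _
    obtain ⟨d, hdA, h⟩ := hd s hs
    refine ⟨_, ?_, h.mul (hexp A s)⟩
    have : d * Real.exp (A * s) + g s * (Real.exp (A * s) * A) =
      (d + A * g s) * Real.exp (A * s) := by ring
    rw [this]
    exact mul_nonneg (by linarith [neg_abs_le d]) (Real.exp_pos _).le
  constructor
  · intro h
    rw [h, zero_mul] at h1
    exact le_antisymm (nonpos_of_mul_nonpos_left h1 (Real.exp_pos _)) (hg y ⟨hxy, le_rfl⟩)
  · intro h
    rw [h, zero_mul] at h2
    exact le_antisymm (nonpos_of_mul_nonpos_left h2 (Real.exp_pos _)) (hg x ⟨le_rfl, hxy⟩)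

theorem Coeff.lip (C : Coeff q Hinf) {ρ₀ ρ₁ : ℝ} (h0 : 0 < ρ₀) : ∀ x ∈ Icc ρ₀ ρ₁, ∀ y ∈ Icc ρ₀ ρ₁,
    |q x - q y| ≤ logd q ρ₀ * q ρ₁ * |x - y| := by
  intro x hx y hy
  have := (convex_Icc ρ₀ ρ₁).norm_image_sub_le_of_norm_hasDerivWithin_le (f := q)
    (C := logd q ρ₀ * q ρ₁)
    (fun z hz => (C.der z (h0.trans_le hz.1)).hasDerivWithinAt) (fun z hz => by
      have hz0 := h0.trans_le hz.1
      rw [Real.norm_eq_abs, abs_of_pos (C.dpos z hz0), C.dq_eq hz0]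
      have h1 := C.logd_anti _ _ h0 hz.1
      have h2 := C.mono _ _ hz0.le hz.2
      have h3 := C.logd_pos h0
      have h4 := C.pos z hz0
      gcongr) hy hx
  simpa [Real.norm_eq_abs] using this

section Pair

variable {lo₁ hi₁ lo₂ hi₂ : ℝ} {r₁ p₁ r₂ p₂ : ℝ → ℝ} (C : Coeff q Hinf)
  (N : Nonlin c f b β Hinf)
  (B₁ : Branch c f q lo₁ hi₁ r₁ p₁) (B₂ : Branch c f q lo₂ hi₂ r₂ p₂) {s₀ s₁ : ℝ}
include B₁ B₂ C N

omit C N B₁ B₂ in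
theorem level_deriv_bound {q₁ q₂ y₁ y₂ φ M L m Z δ : ℝ} (hm : 0 < m) (hy1 : m ≤ y₁) (hy2 : m ≤ y₂)
    (hq1 : 0 < q₁) (hq2 : 0 < q₂) (hZ1 : q₁ ≤ Z) (hZ2 : q₂ ≤ Z) (hφ : |φ| ≤ M) (hL : 0 ≤ L)
    (hδ : 0 ≤ δ) (hd : |q₁ - q₂| ≤ L * δ) :
    |q₁ / y₁ - q₂ / y₂| ≤ (L / m + Z / m ^ 2) * (δ + |y₁ - y₂|) ∧
    |q₁ * φ * (q₁ / y₁) - q₂ * φ * (q₂ / y₂)| ≤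
      M * (L * (Z / m) + Z * (L / m + Z / m ^ 2)) * (δ + |y₁ - y₂|) := by
  have hy1' := hm.trans_le hy1
  have hy2' := hm.trans_le hy2
  have hZ : 0 < Z := hq1.trans_le hZ1
  have hM : 0 ≤ M := (abs_nonneg _).trans hφ
  have h1 : |q₁ / y₁ - q₂ / y₂| ≤ (L / m + Z / m ^ 2) * (δ + |y₁ - y₂|) := by
    have e : q₁ / y₁ - q₂ / y₂ = (q₁ - q₂) / y₁ - q₂ * (y₁ - y₂) / (y₁ * y₂) := by
      field_simp; ring
    rw [e]
    refine (abs_sub _ _).trans ?_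
    have a1 : |(q₁ - q₂) / y₁| ≤ L / m * δ := by
      rw [abs_div, abs_of_pos hy1']
      calc |q₁ - q₂| / y₁ ≤ L * δ / m := by gcongr
        _ = _ := by ring
    have a2 : |q₂ * (y₁ - y₂) / (y₁ * y₂)| ≤ Z / m ^ 2 * |y₁ - y₂| := by
      rw [abs_div, abs_mul, abs_of_pos hq2, abs_of_pos (mul_pos hy1' hy2')]
      calc q₂ * |y₁ - y₂| / (y₁ * y₂) ≤ Z * |y₁ - y₂| / (m * m) := by gcongr
        _ = _ := by ring
    have a3 : 0 ≤ L / m * |y₁ - y₂| := by positivity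
    have a4 : 0 ≤ Z / m ^ 2 * δ := by positivity
    nlinarith
  refine ⟨h1, ?_⟩
  have e : q₁ * φ * (q₁ / y₁) - q₂ * φ * (q₂ / y₂) =
      φ * ((q₁ - q₂) * (q₁ / y₁) + q₂ * (q₁ / y₁ - q₂ / y₂)) := by ring
  rw [e, abs_mul, mul_assoc]
  refine mul_le_mul hφ ?_ (abs_nonneg _) hM
  refine (abs_add_le _ _).trans ?_
  rw [abs_mul, abs_mul, abs_of_pos hq2, abs_of_pos (div_pos hq1 hy1')]
  have b1 : |q₁ - q₂| * (q₁ / y₁) ≤ L * (Z / m) * (δ + |y₁ - y₂|) := by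
    calc |q₁ - q₂| * (q₁ / y₁) ≤ L * δ * (Z / m) := by gcongr
      _ = L * (Z / m) * δ := by ring
      _ ≤ _ := by gcongr; linarith [abs_nonneg (y₁ - y₂)]
  have b2 : q₂ * |q₁ / y₁ - q₂ / y₂| ≤ Z * ((L / m + Z / m ^ 2) * (δ + |y₁ - y₂|)) := by
    gcongr
  linarith

theorem branch_unique (hle : s₀ ≤ s₁) (hI₁ : Icc s₀ s₁ ⊆ Ioo lo₁ hi₁)
    (hI₂ : Icc s₀ s₁ ⊆ Ioo lo₂ hi₂) :
    (r₁ s₀ = r₂ s₀ ∧ p₁ s₀ = p₂ s₀) ↔ (r₁ s₁ = r₂ s₁ ∧ p₁ s₁ = p₂ s₁) := by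
  set g : ℝ → ℝ := fun s => (r₁ s - r₂ s) ^ 2 + (yB q r₁ p₁ s - yB q r₂ p₂ s) ^ 2 with hg
  have m0 : s₀ ∈ Icc s₀ s₁ := ⟨le_rfl, hle⟩
  have m1 : s₁ ∈ Icc s₀ s₁ := ⟨hle, le_rfl⟩
  have hgz : ∀ s ∈ Icc s₀ s₁, (r₁ s = r₂ s ∧ p₁ s = p₂ s) ↔ g s = 0 := by
    intro s hs
    constructor
    · rintro ⟨h1, h2⟩; simp [hg, yB, h1, h2]
    · intro h
      have h1 : r₁ s - r₂ s = 0 := by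
        have := sq_nonneg (r₁ s - r₂ s); have := sq_nonneg (yB q r₁ p₁ s - yB q r₂ p₂ s)
        exact pow_eq_zero_iff two_ne_zero |>.1 (by simp only [hg] at h; linarith)
      have h2 : yB q r₁ p₁ s - yB q r₂ p₂ s = 0 := by
        have := sq_nonneg (r₁ s - r₂ s); have := sq_nonneg (yB q r₁ p₁ s - yB q r₂ p₂ s)
        exact pow_eq_zero_iff two_ne_zero |>.1 (by simp only [hg] at h; linarith)
      have h1' : r₁ s = r₂ s := sub_eq_zero.1 h1
      refine ⟨h1', ?_⟩
      have h3 := sub_eq_zero.1 h2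
      unfold yB at h3
      rw [h1'] at h3
      exact mul_left_cancel₀ (B₂.qpos C (hI₂ hs)).ne' h3
  rw [hgz s₀ m0, hgz s₁ m1]
  obtain ⟨M, hM0, hM⟩ : ∃ M, 0 < M ∧ ∀ s ∈ Icc s₀ s₁, |f s| ≤ M := by
    rcases le_total |s₀| |s₁| with h | h
    · obtain ⟨M, h1, h2⟩ := N.bdd s₁ (B₁.mem _ (hI₁ m1))
      exact ⟨M, h1, fun s hs => h2 s ((abs_le_max_abs_abs hs.1 hs.2).trans (by rw [max_eq_right h]))⟩
    · obtain ⟨M, h1, h2⟩ := N.bdd s₀ (B₁.mem _ (hI₁ m0))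
      exact ⟨M, h1, fun s hs => h2 s ((abs_le_max_abs_abs hs.1 hs.2).trans (by rw [max_eq_left h]))⟩
  obtain ⟨x₁, hx1, hx1'⟩ := isCompact_Icc.exists_isMinOn ⟨s₀, m0⟩
    (fun s hs => (B₁.ycont C (hI₁ hs)).continuousWithinAt)
  obtain ⟨x₂, hx2, hx2'⟩ := isCompact_Icc.exists_isMinOn ⟨s₀, m0⟩
    (fun s hs => (B₂.ycont C (hI₂ hs)).continuousWithinAt)
  set m := min (yB q r₁ p₁ x₁) (yB q r₂ p₂ x₂) with hm
  have hm0 : 0 < m := lt_min (B₁.ypos C (hI₁ hx1)) (B₂.ypos C (hI₂ hx2))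
  set ρ₀ := min (r₁ s₁) (r₂ s₁) with hρ₀
  set ρ₁ := max (r₁ s₀) (r₂ s₀) with hρ₁
  have hρ0 : 0 < ρ₀ := lt_min (B₁.rpos _ (hI₁ m1)) (B₂.rpos _ (hI₂ m1))
  have hr1 : ∀ s ∈ Icc s₀ s₁, r₁ s ∈ Icc ρ₀ ρ₁ := fun s hs =>
    ⟨(min_le_left _ _).trans (B₁.r_anti (hI₁ hs) (hI₁ m1) hs.2),
      (B₁.r_anti (hI₁ m0) (hI₁ hs) hs.1).trans (le_max_left _ _)⟩
  have hr2 : ∀ s ∈ Icc s₀ s₁, r₂ s ∈ Icc ρ₀ ρ₁ := fun s hs =>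
    ⟨(min_le_right _ _).trans (B₂.r_anti (hI₂ hs) (hI₂ m1) hs.2),
      (B₂.r_anti (hI₂ m0) (hI₂ hs) hs.1).trans (le_max_right _ _)⟩
  have hρ : ρ₀ ≤ ρ₁ := (hr1 s₀ m0).1.trans (hr1 s₀ m0).2
  set L := logd q ρ₀ * q ρ₁ with hL
  have hL0 : 0 ≤ L := mul_nonneg (C.logd_pos hρ0).le (C.pos _ (hρ0.trans_le hρ)).le
  set Z := q ρ₁ with hZ
  set A₁ := L / m + Z / m ^ 2 with hA₁
  set A₂ := M * (L * (Z / m) + Z * (L / m + Z / m ^ 2)) with hA₂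
  have hZ0 : 0 < Z := C.pos _ (hρ0.trans_le hρ)
  have hA10 : 0 ≤ A₁ := by positivity
  have hA20 : 0 ≤ A₂ := by positivity
  have hgd : ∀ s ∈ Icc s₀ s₁, HasDerivAt g ((2 : ℕ) * (r₁ s - r₂ s) ^ (2 - 1) *
      (-1 / p₁ s - -1 / p₂ s) + (2 : ℕ) * (yB q r₁ p₁ s - yB q r₂ p₂ s) ^ (2 - 1) *
      (-(q (r₁ s) * f s / p₁ s) - -(q (r₂ s) * f s / p₂ s))) s := fun s hs =>
    (((B₁.rder s (hI₁ hs)).sub (B₂.rder s (hI₂ hs))).pow 2).add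
      (((B₁.yder C (hI₁ hs)).sub (B₂.yder C (hI₂ hs))).pow 2)
  refine eq_zero_of_abs_deriv_le (A := 4 * (A₁ + A₂)) hle
    (fun s hs => (hgd s hs).continuousAt.continuousWithinAt) (fun s _ => by positivity)
    (fun s hs => ⟨_, ?_, hgd s (Ioo_subset_Icc_self hs)⟩)
  have hs' := Ioo_subset_Icc_self hs
  have hq1 := B₁.qpos C (hI₁ hs')
  have hq2 := B₂.qpos C (hI₂ hs')
  have hp1 := (B₁.ppos s (hI₁ hs')).ne'
  have hp2 := (B₂.ppos s (hI₂ hs')).ne'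
  obtain ⟨k1, k2⟩ := level_deriv_bound (φ := f s) (M := M) hm0
    (show m ≤ yB q r₁ p₁ s from (min_le_left _ _).trans (hx1' hs'))
    (show m ≤ yB q r₂ p₂ s from (min_le_right _ _).trans (hx2' hs')) hq1 hq2
    (C.mono _ _ (B₁.rpos s (hI₁ hs')).le (hr1 s hs').2)
    (C.mono _ _ (B₂.rpos s (hI₂ hs')).le (hr2 s hs').2) (hM s hs') hL0 (abs_nonneg _)
    (C.lip hρ0 _ (hr1 s hs') _ (hr2 s hs'))
  have e1 : q (r₁ s) / yB q r₁ p₁ s = 1 / p₁ s := by unfold yB; field_simp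
  have e2 : q (r₂ s) / yB q r₂ p₂ s = 1 / p₂ s := by unfold yB; field_simp
  rw [e1, e2] at k1 k2
  have f1 : -1 / p₁ s - -1 / p₂ s = -(1 / p₁ s - 1 / p₂ s) := by ring
  have f2 : -(q (r₁ s) * f s / p₁ s) - -(q (r₂ s) * f s / p₂ s) =
    -(q (r₁ s) * f s * (1 / p₁ s) - q (r₂ s) * f s * (1 / p₂ s)) := by ring
  rw [f1, f2]
  simp only [hg]
  set x := r₁ s - r₂ s
  set y := yB q r₁ p₁ s - yB q r₂ p₂ s
  generalize (1 / p₁ s - 1 / p₂ s) = d1 at *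
  generalize (q (r₁ s) * f s * (1 / p₁ s) - q (r₂ s) * f s * (1 / p₂ s)) = d2 at *
  have g1 : |((2 : ℕ) : ℝ) * x ^ (2 - 1) * -d1| ≤ 2 * (|x| * (A₁ * (|x| + |y|))) := by
    norm_num [abs_mul]
    rw [mul_assoc]; gcongr
  have g2 : |((2 : ℕ) : ℝ) * y ^ (2 - 1) * -d2| ≤ 2 * (|y| * (A₂ * (|x| + |y|))) := by
    norm_num [abs_mul]
    rw [mul_assoc]; gcongr
  refine (abs_add_le _ _).trans ((add_le_add g1 g2).trans ?_)
  rw [← sq_abs x, ← sq_abs y]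
  have hx := abs_nonneg x
  have hy := abs_nonneg y
  nlinarith [mul_nonneg hA10 (sq_nonneg (|x| - |y|)), mul_nonneg hA20 (sq_nonneg (|x| - |y|)),
    mul_nonneg hA10 (sq_nonneg (|x|)), mul_nonneg hA10 (sq_nonneg (|y|)),
    mul_nonneg hA20 (sq_nonneg (|x|)), mul_nonneg hA20 (sq_nonneg (|y|))]

omit N in
/-- The ratio `y₁/y₂` is monotone according to the sign of `f`. -/
theorem y_ratio_mono (hle : s₀ ≤ s₁) (hI₁ : Icc s₀ s₁ ⊆ Ioo lo₁ hi₁)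
    (hI₂ : Icc s₀ s₁ ⊆ Ioo lo₂ hi₂) (hp : ∀ s ∈ Ioo s₀ s₁, p₁ s ≤ p₂ s)
    (hf : ∀ s ∈ Ioo s₀ s₁, f s ≤ 0) :
    yB q r₁ p₁ s₀ / yB q r₂ p₂ s₀ ≤ yB q r₁ p₁ s₁ / yB q r₂ p₂ s₁ := by
  refine le_of_deriv_nonneg (g := fun s => yB q r₁ p₁ s / yB q r₂ p₂ s) hle (fun s hs =>
    ((B₁.ycont C (hI₁ hs)).div (B₂.ycont C (hI₂ hs))
      (B₂.ypos C (hI₂ hs)).ne').continuousWithinAt) (fun s hs _ => ?_)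
  have h1 := hI₁ (Ioo_subset_Icc_self hs)
  have h2 := hI₂ (Ioo_subset_Icc_self hs)
  refine ⟨_, ?_, (B₁.yder C h1).div (B₂.yder C h2) (B₂.ypos C h2).ne'⟩
  refine div_nonneg ?_ (sq_nonneg _)
  have q1 := B₁.qpos C h1
  have q2 := B₂.qpos C h2
  have P1 := B₁.ppos s h1
  have P2 := B₂.ppos s h2
  have e : -(q (r₁ s) * f s / p₁ s) * yB q r₂ p₂ s - yB q r₁ p₁ s * -(q (r₂ s) * f s / p₂ s) =
      q (r₁ s) * q (r₂ s) * (-f s) * (p₂ s - p₁ s) * (p₁ s + p₂ s) / (p₁ s * p₂ s) := by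
    unfold yB; field_simp; ring
  rw [e]
  have := hp s hs
  have := hf s hs
  exact div_nonneg (mul_nonneg (mul_nonneg (mul_nonneg (mul_pos q1 q2).le (by linarith))
    (by linarith)) (by linarith)) (mul_pos P1 P2).le

omit N in
theorem y_ratio_anti (hle : s₀ ≤ s₁) (hI₁ : Icc s₀ s₁ ⊆ Ioo lo₁ hi₁)
    (hI₂ : Icc s₀ s₁ ⊆ Ioo lo₂ hi₂) (hp : ∀ s ∈ Ioo s₀ s₁, p₁ s ≤ p₂ s)
    (hf : ∀ s ∈ Ioo s₀ s₁, 0 ≤ f s) :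
    yB q r₁ p₁ s₁ / yB q r₂ p₂ s₁ ≤ yB q r₁ p₁ s₀ / yB q r₂ p₂ s₀ := by
  refine le_of_deriv_nonpos (g := fun s => yB q r₁ p₁ s / yB q r₂ p₂ s) hle (fun s hs =>
    ((B₁.ycont C (hI₁ hs)).div (B₂.ycont C (hI₂ hs))
      (B₂.ypos C (hI₂ hs)).ne').continuousWithinAt) (fun s hs _ => ?_)
  have h1 := hI₁ (Ioo_subset_Icc_self hs)
  have h2 := hI₂ (Ioo_subset_Icc_self hs)
  refine ⟨_, ?_, (B₁.yder C h1).div (B₂.yder C h2) (B₂.ypos C h2).ne'⟩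
  refine div_nonpos_of_nonpos_of_nonneg ?_ (sq_nonneg _)
  have q1 := B₁.qpos C h1
  have q2 := B₂.qpos C h2
  have P1 := B₁.ppos s h1
  have P2 := B₂.ppos s h2
  have e : -(q (r₁ s) * f s / p₁ s) * yB q r₂ p₂ s - yB q r₁ p₁ s * -(q (r₂ s) * f s / p₂ s) =
      -(q (r₁ s) * q (r₂ s) * f s * (p₂ s - p₁ s) * (p₁ s + p₂ s) / (p₁ s * p₂ s)) := by
    unfold yB; field_simp; ring
  rw [e]
  have := hp s hs
  have := hf s hs
  exact neg_nonpos.2 (div_nonneg (mul_nonneg (mul_nonneg (mul_nonneg (mul_pos q1 q2).le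
    (by linarith)) (by linarith)) (by linarith)) (mul_pos P1 P2).le)

theorem PB_sub_mono {τ : ℝ} (hτ : 1 ≤ τ) (hle : s₀ ≤ s₁) (hI₁ : Icc s₀ s₁ ⊆ Ioo lo₁ hi₁)
    (hI₂ : Icc s₀ s₁ ⊆ Ioo lo₂ hi₂) (hb : ∀ s ∈ Icc s₀ s₁, b < |s|)
    (hβ : ∀ s ∈ Ioo s₀ s₁, β < |s|)
    (hp : ∀ s ∈ Ioo s₀ s₁, p₁ s ≤ p₂ s)
    (hy : ∀ s ∈ Ioo s₀ s₁, yB q r₁ p₁ s ≤ τ * yB q r₂ p₂ s) :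
    PB f q r₁ p₁ s₀ - τ * PB f q r₂ p₂ s₀ ≤ PB f q r₁ p₁ s₁ - τ * PB f q r₂ p₂ s₁ := by
  refine le_of_deriv_nonneg (g := fun s => PB f q r₁ p₁ s - τ * PB f q r₂ p₂ s) hle (fun s hs =>
    ((B₁.Pder C N (hI₁ hs) (hb s hs)).continuousAt.sub
      ((B₂.Pder C N (hI₂ hs) (hb s hs)).continuousAt.const_mul τ)).continuousWithinAt)
    (fun s hs _ => ?_)
  have hs' := Ioo_subset_Icc_self hs
  have h1 := hI₁ hs'
  have h2 := hI₂ hs'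
  refine ⟨_, ?_, (B₁.Pder C N h1 (hb s hs')).sub ((B₂.Pder C N h2 (hb s hs')).const_mul τ)⟩
  have hg := N.Lge s (hβ s hs) (B₁.mem s h1)
  set Λ := deriv (Lam f) |s|
  have hyy := hy s hs
  have hpp := hp s hs
  have y1 := B₁.ypos C h1
  have y2 := B₂.ypos C h2
  have H1 := C.Hge _ (B₁.rpos s h1)
  have H2 := C.Hge _ (B₂.rpos s h2)
  have key : yB q r₁ p₁ s * (Hfun q (r₁ s) - Hinf) ≤
      τ * (yB q r₂ p₂ s * (Hfun q (r₂ s) - Hinf)) := by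
    rcases le_total (r₂ s) (r₁ s) with h | h
    · have := C.Hanti _ _ (B₂.rpos s h2) h
      rw [← mul_assoc]
      exact mul_le_mul hyy (by linarith) (by linarith) (by positivity)
    · have h3 := C.qH_mono _ _ (B₁.rpos s h1) h
      have q1 := B₁.qpos C h1
      have h4 : 0 ≤ q (r₁ s) * (Hfun q (r₁ s) - Hinf) := mul_nonneg q1.le (by linarith)
      have P2 := B₂.ppos s h2
      have P1 := B₁.ppos s h1
      have h5 : yB q r₁ p₁ s * (Hfun q (r₁ s) - Hinf) ≤
          yB q r₂ p₂ s * (Hfun q (r₂ s) - Hinf) := by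
        have := mul_le_mul h3 hpp P1.le (h4.trans h3)
        unfold yB; linarith
      have h6 : 0 ≤ yB q r₂ p₂ s * (Hfun q (r₂ s) - Hinf) := mul_nonneg y2.le (by linarith)
      nlinarith
  have hgg : 0 ≤ 2 * Hinf - 1 + 2 * Λ := by linarith
  have := mul_le_mul_of_nonneg_right hyy hgg
  show 0 ≤ _
  nlinarith

end Pair

end

section

variable {c : EReal} {f q : ℝ → ℝ} {b β Hinf : ℝ}

/-- At the top of the lower branch its slope vanishes, while that of the higher one does not. -/
theorem not_p_le_near_top {lo₂ m₁ m₂ s : ℝ} {r₂ p₁ p₂ : ℝ → ℝ}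
    (B₂ : Branch c f q lo₂ m₂ r₂ p₂) (hlo : lo₂ < m₁) (hm : m₁ < m₂) (hsm : s < m₁)
    (ht : Tendsto p₁ (𝓝[<] m₁) (𝓝 0)) (h : ∀ t ∈ Ioo s m₁, p₂ t ≤ p₁ t) : False := by
  have h2 : Tendsto p₂ (𝓝[<] m₁) (𝓝 (p₂ m₁)) :=
    (B₂.pcont ⟨hlo, hm⟩).tendsto.mono_left nhdsWithin_le_nhds
  have := le_of_tendsto_of_tendsto h2 ht (by
    filter_upwards [Ioo_mem_nhdsLT hsm] with t ht using h t ht)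
  linarith [B₂.ppos m₁ ⟨hlo, hm⟩]

section Tail

variable {m₁ m₂ : ℝ} {r₁ p₁ r₂ p₂ : ℝ → ℝ} (C : Coeff q Hinf) (N : Nonlin c f b β Hinf)
  (B₁ : Branch c f q 0 m₁ r₁ p₁) (B₂ : Branch c f q 0 m₂ r₂ p₂)
include C N B₁ B₂

theorem tail_p_eq {s : ℝ} (h0 : 0 < s) (h1 : s < m₁) (h2 : s < m₂) (hβ : s ≤ β)
    (hl₁ : Tendsto p₁ (𝓝[>] 0) (𝓝 0)) (hl₂ : Tendsto p₂ (𝓝[>] 0) (𝓝 0)) (hr : r₁ s = r₂ s) :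
    p₁ s = p₂ s := by
  have hW1 := tail_W_le C N B₁ B₂ h0 h1 h2 hβ hl₂ hr.ge
  have hW2 := tail_W_le C N B₂ B₁ h0 h2 h1 hβ hl₁ hr.le
  have hW := le_antisymm hW1 hW2
  have hq := B₁.qpos C ⟨h0, h1⟩
  have hp1 := B₁.ppos s ⟨h0, h1⟩
  have hp2 := B₂.ppos s ⟨h0, h2⟩
  unfold WB eB at hW
  rw [← hr] at hW
  have := mul_left_cancel₀ (pow_pos hq 2).ne' hW
  nlinarith

/-- Comparison of two decaying decreasing branches starting at the heights `m₁ < m₂`. -/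
theorem tail_compare (hm1 : β < m₁) (hm : m₁ < m₂)
    (hl₁ : Tendsto p₁ (𝓝[>] 0) (𝓝 0)) (hl₂ : Tendsto p₂ (𝓝[>] 0) (𝓝 0))
    (ht : Tendsto p₁ (𝓝[<] m₁) (𝓝 0))
    (hno : ∀ s' σ, b < s' → s' ≤ σ → σ < m₁ → r₂ σ < r₁ σ → r₂ s' < r₁ s') :
    (∀ s, 0 < s → s ≤ β → r₂ s < r₁ s) ∧ (∀ s, 0 < s → s < m₁ → p₁ s ≤ p₂ s) := by
  have hb := N.b_pos
  have hbβ := N.b_lt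
  have hβ0 : 0 < β := hb.trans hbβ
  have hI1 : ∀ s t, 0 < s → t < m₁ → Icc s t ⊆ Ioo 0 m₁ := fun s t hs ht x hx =>
    ⟨hs.trans_le hx.1, hx.2.trans_lt ht⟩
  have hI2 : ∀ s t, 0 < s → t < m₁ → Icc s t ⊆ Ioo 0 m₂ := fun s t hs ht x hx =>
    ⟨hs.trans_le hx.1, hx.2.trans_lt (ht.trans hm)⟩
  have htop : ∀ s, 0 < s → s < m₁ → ¬ ∀ t ∈ Ioo s m₁, p₂ t ≤ p₁ t := fun s hs hsm h =>
    not_p_le_near_top B₂ (hs.trans hsm) hm hsm ht h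
  have hne : ∀ s, 0 < s → s ≤ β → r₁ s ≠ r₂ s := by
    intro s hs hsβ hr
    have hp := tail_p_eq C N B₁ B₂ hs (by linarith) (by linarith) hsβ hl₁ hl₂ hr
    refine htop s hs (by linarith) (fun t ht => ?_)
    exact ((branch_unique C N B₁ B₂ ht.1.le (hI1 s t hs ht.2) (hI2 s t hs ht.2)).1
      ⟨hr, hp⟩).2.ge
  have hsign : ∀ (ρ₁ ρ₂ : ℝ → ℝ), (∀ s, 0 < s → s ≤ β → ContinuousAt ρ₁ s) →
      (∀ s, 0 < s → s ≤ β → ContinuousAt ρ₂ s) → (∀ s, 0 < s → s ≤ β → ρ₁ s ≠ ρ₂ s) →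
      ρ₁ β < ρ₂ β → ∀ s, 0 < s → s ≤ β → ρ₁ s < ρ₂ s := by
    intro ρ₁ ρ₂ h1 h2 hne hlt s hs hsβ
    by_contra hcon
    push Not at hcon
    obtain ⟨z, hz, hz0, -⟩ := exists_last_zero (g := fun s => ρ₂ s - ρ₁ s) (x := s) (y := β)
      (t := s) (fun x hx => ((h2 x (hs.trans_le hx.1) hx.2).sub
        (h1 x (hs.trans_le hx.1) hx.2)).continuousWithinAt) ⟨le_rfl, hsβ⟩
      (by linarith) (by linarith)
    exact hne z (hs.trans_le hz.1) hz.2.le (by linarith)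
  have hc1 : ∀ s, 0 < s → s ≤ β → ContinuousAt r₁ s := fun s hs h =>
    B₁.rcont ⟨hs, by linarith⟩
  have hc2 : ∀ s, 0 < s → s ≤ β → ContinuousAt r₂ s := fun s hs h =>
    B₂.rcont ⟨hs, by linarith⟩
  have hrβ : r₂ β < r₁ β := by
    refine (lt_or_gt_of_ne (hne β hβ0 le_rfl)).resolve_left (fun hlt => ?_)
    have hall : ∀ s, 0 < s → s < m₁ → r₁ s ≤ r₂ s := by
      intro s hs hsm
      rcases le_or_gt s β with h | h
      · exact (hsign r₁ r₂ hc1 hc2 hne hlt s hs h).le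
      · by_contra hcon
        push Not at hcon
        exact absurd (hno β s hbβ h.le hsm hcon) (not_lt.2 hlt.le)
    exact htop β hβ0 hm1 (fun t ht => tail_p_le C N B₁ B₂ (hβ0.trans ht.1) ht.2 (ht.2.trans hm) hl₂
      (fun s hs hst => hall s hs (hst.trans ht.2)))
  have hlow := hsign r₂ r₁ hc2 hc1 (fun s h1 h2 => (hne s h1 h2).symm) hrβ
  refine ⟨hlow, fun s₁ hs hsm => ?_⟩
  by_contra hp
  push Not at hp
  have hsw : ¬ ∀ s, 0 < s → s < s₁ → r₂ s ≤ r₁ s := fun h =>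
    absurd (tail_p_le C N B₂ B₁ hs (hsm.trans hm) hsm hl₁ h) (not_le.2 hp)
  by_cases hσ : ∃ σ, s₁ ≤ σ ∧ σ < m₁ ∧ r₂ σ < r₁ σ
  · obtain ⟨σ, h1, h2, h3⟩ := hσ
    refine hsw (fun s hs0 hs1 => ?_)
    rcases le_or_gt s β with h | h
    · exact (hlow s hs0 h).le
    · exact (hno s σ (hbβ.trans h) (hs1.le.trans h1) h2 h3).le
  · push Not at hσ
    exact htop s₁ hs hsm (fun t ht => p_le_of_r_le C B₁ B₂ ht.1.le (hI1 s₁ t hs ht.2)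
      (hI2 s₁ t hs ht.2) (fun x hx => hσ x hx.1.le (hx.2.trans ht.2)) hp.le)

end Tail

theorem PB_of_abs_eq_β (N : Nonlin c f b β Hinf) {s : ℝ} (hs : |s| = β) (r p : ℝ → ℝ) :
    PB f q r p s = Kq q (r s) * q (r s) * p s ^ 2 := by
  have hF : Fint f s = 0 := by
    rcases abs_choice s with h | h
    · rw [← h, hs]; exact N.Fβ
    · rw [← N.Feven, ← h, hs]; exact N.Fβ
  simp [PB, Lam, eB, hF]

theorem WB_of_abs_eq_β (N : Nonlin c f b β Hinf) {s : ℝ} (hs : |s| = β) (r p : ℝ → ℝ) :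
    WB f q r p s = yB q r p s ^ 2 := by
  have hF : Fint f s = 0 := by
    rcases abs_choice s with h | h
    · rw [← h, hs]; exact N.Fβ
    · rw [← N.Feven, ← h, hs]; exact N.Fβ
  simp only [WB, eB, hF, yB]; ring

section First

variable {m₁ m₂ α₁ α₂ : ℝ} {r₁ p₁ r₂ p₂ : ℝ → ℝ} (C : Coeff q Hinf) (N : Nonlin c f b β Hinf)
  (B₁ : Branch c f q (-m₁) α₁ r₁ p₁) (B₂ : Branch c f q (-m₂) α₂ r₂ p₂)
include C N B₁ B₂

/-- Comparison of two first branches starting at the heights `α₁ < α₂`, down to the level `-β`. -/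
theorem first_compare (hm1 : β < m₁) (hm2 : β < m₂) (hα1 : β < α₁) (hα : α₁ < α₂)
    (ht : Tendsto p₁ (𝓝[<] α₁) (𝓝 0)) (hr : ∀ s, b < s → s < α₁ → r₁ s ≤ r₂ s) :
    p₁ (-β) < p₂ (-β) ∧ yB q r₁ p₁ (-β) < yB q r₂ p₂ (-β) ∧
      PB f q r₁ p₁ (-β) < PB f q r₂ p₂ (-β) := by
  have hb := N.b_pos
  have hbβ := N.b_lt
  have hβ0 : 0 < β := hb.trans hbβ
  have hI1 : ∀ s t, -β ≤ s → t < α₁ → Icc s t ⊆ Ioo (-m₁) α₁ := fun s t hs ht x hx =>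
    ⟨by linarith [hx.1], hx.2.trans_lt ht⟩
  have hI2 : ∀ s t, -β ≤ s → t < α₁ → Icc s t ⊆ Ioo (-m₂) α₂ := fun s t hs ht x hx =>
    ⟨by linarith [hx.1], hx.2.trans_lt (ht.trans hα)⟩
  have hlt : ∀ z, -β ≤ z → z ≤ β → (∀ s, z ≤ s → s < α₁ → r₁ s ≤ r₂ s) → p₁ z < p₂ z := by
    intro z hz hzβ h
    by_contra hp
    push Not at hp
    exact not_p_le_near_top B₂ (by linarith) hα (hzβ.trans_lt hα1) ht (fun t ht =>
      p_le_of_r_le C B₁ B₂ ht.1.le (hI1 z t hz ht.2) (hI2 z t hz ht.2)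
        (fun x hx => h x hx.1.le (hx.2.trans ht.2)) hp)
  have i1 : -β ∈ Ioo (-m₁) α₁ := ⟨by linarith, by linarith⟩
  have i2 : -β ∈ Ioo (-m₂) α₂ := ⟨by linarith, by linarith⟩
  have hab : |(-β : ℝ)| = β := by rw [abs_neg, abs_of_pos hβ0]
  have hp1 := B₁.ppos _ i1
  have hp2 := B₂.ppos _ i2
  have hq1 := B₁.qpos C i1
  have hq2 := B₂.qpos C i2
  have hK1 := C.Kpos _ (B₁.rpos _ i1)
  have hK2 := C.Kpos _ (B₂.rpos _ i2)
  rw [PB_of_abs_eq_β N hab, PB_of_abs_eq_β N hab]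
  by_cases hcr : ∃ t ∈ Icc (-β) β, r₂ t - r₁ t < 0
  · obtain ⟨t, ht', hneg⟩ := hcr
    obtain ⟨z, hz, hz0, hzp⟩ := exists_last_crossing (g := fun s => r₂ s - r₁ s) (x := -β)
      (y := β) (fun x hx => ((B₂.rcont ⟨by linarith [hx.1], by linarith [hx.2]⟩).sub
        (B₁.rcont ⟨by linarith [hx.1], by linarith [hx.2]⟩)).continuousWithinAt) ht' hneg
        (by linarith [hr β hbβ hα1])
    have hzβ : -β ≤ z := ht'.1.trans hz.1
    have hrz : r₁ z = r₂ z := by linarith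
    have hpz : p₁ z < p₂ z := hlt z hzβ hz.2 (fun s h1 h2 => by
      rcases le_or_gt s β with h | h
      · linarith [hzp s ⟨h1, h⟩]
      · exact hr s (hbβ.trans h) h2)
    have iz1 : z ∈ Ioo (-m₁) α₁ := ⟨by linarith, by linarith [hz.2]⟩
    have iz2 : z ∈ Ioo (-m₂) α₂ := ⟨by linarith, by linarith [hz.2]⟩
    have hWz : WB f q r₁ p₁ z < WB f q r₂ p₂ z := by
      unfold WB eB
      rw [hrz]
      have := B₁.ppos z iz1
      have hq := B₂.qpos C iz2
      have : p₁ z ^ 2 < p₂ z ^ 2 := by gcongr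
      gcongr
    obtain ⟨h1, h2, h3⟩ := propagate C B₁ B₂ N hzβ (hI1 _ _ le_rfl (hz.2.trans_lt hα1))
      (hI2 _ _ le_rfl (hz.2.trans_lt hα1))
      (fun s hs => abs_le.2 ⟨hs.1, hs.2.trans hz.2⟩) hrz.ge hWz
    rw [WB_of_abs_eq_β N hab, WB_of_abs_eq_β N hab] at h2
    have hy2 := B₂.ypos C i2
    refine ⟨h3, lt_of_pow_lt_pow_left₀ 2 hy2.le h2, ?_⟩
    have hk := C.Kq_anti _ _ (B₂.rpos _ i2) h1
    have e1 : Kq q (r₁ (-β)) * q (r₁ (-β)) * p₁ (-β) ^ 2 =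
        Kq q (r₁ (-β)) / q (r₁ (-β)) * yB q r₁ p₁ (-β) ^ 2 := by
      unfold yB; field_simp
    have e2 : Kq q (r₂ (-β)) * q (r₂ (-β)) * p₂ (-β) ^ 2 =
        Kq q (r₂ (-β)) / q (r₂ (-β)) * yB q r₂ p₂ (-β) ^ 2 := by
      unfold yB; field_simp
    rw [e1, e2]
    exact (mul_lt_mul_of_pos_left h2 (by positivity)).trans_le (by gcongr)
  · push Not at hcr
    have hall : ∀ s, -β ≤ s → s < α₁ → r₁ s ≤ r₂ s := by
      intro s h1 h2
      rcases le_or_gt s β with h | h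
      · linarith [hcr s ⟨h1, h⟩]
      · exact hr s (hbβ.trans h) h2
    have hpz := hlt (-β) le_rfl (by linarith) hall
    have hrz := hall (-β) le_rfl (by linarith)
    have hqm := C.mono _ _ (B₁.rpos _ i1).le hrz
    have hKm := C.K_mono _ _ (B₁.rpos _ i1) hrz
    refine ⟨hpz, ?_, ?_⟩
    · unfold yB
      exact (mul_lt_mul_of_pos_left hpz hq1).trans_le (by gcongr)
    · have : p₁ (-β) ^ 2 < p₂ (-β) ^ 2 := by gcongr
      exact (mul_lt_mul_of_pos_left this (by positivity)).trans_le (by gcongr)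

omit C B₂ in
theorem f_nonpos_of_le_neg_β {s : ℝ} (hs : s ≤ -β) (hm : s ∈ Ioo (-m₁) α₁) : f s ≤ 0 := by
  have h := N.pos (-s) (by linarith [N.b_lt]) (B₁.mem s hm).neg
  rw [N.odd] at h
  linarith

theorem first_compare_below (hα1 : β < α₁) (hα2 : β < α₂)
    (hp : p₁ (-β) < p₂ (-β)) (hy : yB q r₁ p₁ (-β) < yB q r₂ p₂ (-β)) {s₀ : ℝ}
    (hs : s₀ ≤ -β) (hs1 : -m₁ < s₀) (hs2 : -m₂ < s₀) :
    p₁ s₀ < p₂ s₀ ∧ yB q r₁ p₁ s₀ < yB q r₂ p₂ s₀ := by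
  have hβ0 : 0 < β := N.b_pos.trans N.b_lt
  have hI1 : Icc s₀ (-β) ⊆ Ioo (-m₁) α₁ := fun x hx =>
    ⟨by linarith [hx.1], by linarith [hx.2]⟩
  have hI2 : Icc s₀ (-β) ⊆ Ioo (-m₂) α₂ := fun x hx =>
    ⟨by linarith [hx.1], by linarith [hx.2]⟩
  have mβ : -β ∈ Icc s₀ (-β) := ⟨hs, le_rfl⟩
  have hyr : ∀ z ∈ Icc s₀ (-β), (∀ s ∈ Ioo z (-β), p₁ s ≤ p₂ s) →
      yB q r₁ p₁ z < yB q r₂ p₂ z := by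
    intro z hz h
    have hsub : Icc z (-β) ⊆ Icc s₀ (-β) := Icc_subset_Icc_left hz.1
    have := y_ratio_mono C B₁ B₂ hz.2 (hsub.trans hI1) (hsub.trans hI2) h (fun s hs' =>
      f_nonpos_of_le_neg_β N B₁ hs'.2.le (hI1 (hsub (Ioo_subset_Icc_self hs'))))
    have h1 := (div_lt_one (B₂.ypos C (hI2 mβ))).2 hy
    exact (div_lt_one (B₂.ypos C (hI2 hz))).1 (this.trans_lt h1)
  have hpp : ∀ t ∈ Icc s₀ (-β), 0 < p₂ t - p₁ t := by
    by_contra hcon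
    push Not at hcon
    obtain ⟨t, ht, hgt⟩ := hcon
    obtain ⟨z, hz, hz0, hzp⟩ := exists_last_zero (g := fun s => p₂ s - p₁ s) (fun s hs =>
      ((B₂.pcont (hI2 hs)).sub (B₁.pcont (hI1 hs))).continuousWithinAt) ht hgt (by linarith)
    have hz' : z ∈ Icc s₀ (-β) := ⟨ht.1.trans hz.1, hz.2.le⟩
    have hle : ∀ s ∈ Ioo z (-β), p₁ s ≤ p₂ s := fun s hs' => by
      linarith [hzp s ⟨hs'.1, hs'.2.le⟩]
    have hyz := hyr z hz' hle
    have hpz : p₁ z = p₂ z := by linarith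
    unfold yB at hyz
    rw [hpz] at hyz
    have hqz := lt_of_mul_lt_mul_right hyz (B₂.ppos z (hI2 hz')).le
    have hrz : r₁ z < r₂ z := by
      by_contra h
      push Not at h
      exact absurd (C.mono _ _ (B₂.rpos z (hI2 hz')).le h) (not_le.2 hqz)
    have hsub : Icc z (-β) ⊆ Icc s₀ (-β) := Icc_subset_Icc_left hz'.1
    have := p_le_of_r_le C B₁ B₂ hz.2.le (hsub.trans hI1) (hsub.trans hI2) (fun s hs' => by
      have hsub' : Icc z s ⊆ Icc s₀ (-β) := Icc_subset_Icc hz'.1 hs'.2.le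
      have := sub_r_anti B₁ B₂ hs'.1.le (hsub'.trans hI1) (hsub'.trans hI2)
        (fun x hx => hle x ⟨hx.1, hx.2.trans hs'.2⟩)
      linarith) hpz.ge
    linarith
  have m0 : s₀ ∈ Icc s₀ (-β) := ⟨le_rfl, hs⟩
  exact ⟨by linarith [hpp s₀ m0], hyr s₀ m0 (fun s hs' => by
    linarith [hpp s (Ioo_subset_Icc_self hs')])⟩

theorem first_min_lt {R₁ R₂ : ℝ} (hR₁ : 0 < R₁) (hR₂ : 0 < R₂) (hm1 : β < m₁) (hm2 : β < m₂)
    (hα1 : β < α₁) (hα2 : β < α₂)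
    (hp : p₁ (-β) < p₂ (-β)) (hy : yB q r₁ p₁ (-β) < yB q r₂ p₂ (-β))
    (hpl₁ : Tendsto p₁ (𝓝[>] (-m₁)) (𝓝 0)) (hpl₂ : Tendsto p₂ (𝓝[>] (-m₂)) (𝓝 0))
    (hrl₁ : Tendsto r₁ (𝓝[>] (-m₁)) (𝓝 R₁)) (hrl₂ : Tendsto r₂ (𝓝[>] (-m₂)) (𝓝 R₂)) :
    m₁ < m₂ := by
  have hβ0 : 0 < β := N.b_pos.trans N.b_lt
  have hcmp := fun s h0 h1 h2 => first_compare_below C N B₁ B₂ hα1 hα2 hp hy (s₀ := s) h0 h1 h2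
  by_contra hmm
  push Not at hmm
  have hnear : ∀ m, β < m → ∀ᶠ s in 𝓝[>] (-m), s ∈ Ioo (-m) (-β) := fun m hm =>
    Ioo_mem_nhdsGT (by linarith)
  rcases eq_or_lt_of_le hmm with h | h
  · subst h
    have hql : ∀ r R, 0 < R → Tendsto r (𝓝[>] (-m₂)) (𝓝 R) →
        Tendsto (fun s => q (r s)) (𝓝[>] (-m₂)) (𝓝 (q R)) := fun r R hR hr =>
      (C.der R hR).continuousAt.tendsto.comp hr
    have hI1 : ∀ s t, -m₂ < s → t ≤ -β → Icc s t ⊆ Ioo (-m₂) α₁ := fun s t h1 h2 x hx =>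
      ⟨by linarith [hx.1], by linarith [hx.2]⟩
    have hI2 : ∀ s t, -m₂ < s → t ≤ -β → Icc s t ⊆ Ioo (-m₂) α₂ := fun s t h1 h2 x hx =>
      ⟨by linarith [hx.1], by linarith [hx.2]⟩
    by_cases hr : ∃ s₁, -m₂ < s₁ ∧ s₁ ≤ -β ∧ r₂ s₁ < r₁ s₁
    · obtain ⟨s₁, h1, h2, h3⟩ := hr
      have hrr : ∀ s, -m₂ < s → s ≤ s₁ → r₂ s ≤ r₁ s := fun s hs hss => by
        have := sub_r_anti B₁ B₂ hss (hI1 s s₁ hs h2) (hI2 s s₁ hs h2) (fun x hx =>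
          (hcmp x (hx.2.le.trans h2) (hs.trans hx.1) (hs.trans hx.1)).1.le)
        linarith
      have key : ∀ s, -m₂ < s → s ≤ s₁ →
          yB q r₂ p₂ s₁ ^ 2 - yB q r₁ p₁ s₁ ^ 2 ≤ yB q r₂ p₂ s ^ 2 - yB q r₁ p₁ s ^ 2 := by
        intro s hs hss
        refine le_of_deriv_nonpos (g := fun s => yB q r₂ p₂ s ^ 2 - yB q r₁ p₁ s ^ 2) hss
          (fun x hx => (((B₂.ycont C (hI2 s s₁ hs h2 hx)).pow 2).sub
            ((B₁.ycont C (hI1 s s₁ hs h2 hx)).pow 2)).continuousWithinAt) (fun x hx _ => ?_)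
        have x1 := hI1 s s₁ hs h2 (Ioo_subset_Icc_self hx)
        have x2 := hI2 s s₁ hs h2 (Ioo_subset_Icc_self hx)
        refine ⟨_, ?_, (B₂.y2der C x2).sub (B₁.y2der C x1)⟩
        have hf : f x ≤ 0 := f_nonpos_of_le_neg_β N B₁ (hx.2.le.trans h2) x1
        have hq := C.mono _ _ (B₂.rpos x x2).le (hrr x (hs.trans hx.1) hx.2.le)
        have hq2 := B₂.qpos C x2
        have : q (r₂ x) ^ 2 ≤ q (r₁ x) ^ 2 := by gcongr
        nlinarith
      have hlim := (((hql r₂ R₂ hR₂ hrl₂).mul hpl₂).pow 2).sub (((hql r₁ R₁ hR₁ hrl₁).mul hpl₁).pow 2)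
      simp only [mul_zero, ne_eq, OfNat.ofNat_ne_zero, not_false_eq_true, zero_pow, sub_zero] at hlim
      have := ge_of_tendsto hlim (b := yB q r₂ p₂ s₁ ^ 2 - yB q r₁ p₁ s₁ ^ 2) (by
        filter_upwards [Ioo_mem_nhdsGT h1] with s hs using key s hs.1 hs.2.le)
      have hy1 := B₁.ypos C (hI1 s₁ s₁ h1 h2 ⟨le_rfl, le_rfl⟩)
      have hyl := (hcmp s₁ h2 h1 h1).2
      nlinarith
    · push Not at hr
      have hκ := fun s (hs : s ∈ Ioo (-m₂) (-β)) => psq_sub_anti C B₁ B₂ hs.2.le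
        (hI1 s (-β) hs.1 le_rfl) (hI2 s (-β) hs.1 le_rfl)
        (fun x hx => hr x (hs.1.trans hx.1) hx.2.le)
      have hlim := ((hpl₂.pow 2).sub (hpl₁.pow 2)).mul (hql r₁ R₁ hR₁ hrl₁)
      simp only [ne_eq, OfNat.ofNat_ne_zero, not_false_eq_true, zero_pow, sub_zero, zero_mul]
        at hlim
      have := ge_of_tendsto hlim (by
        filter_upwards [hnear m₂ hm2] with s hs using hκ s hs)
      have i1 := hI1 (-β) (-β) (by linarith) le_rfl ⟨le_rfl, le_rfl⟩
      have hp1 := B₁.ppos _ i1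
      have := mul_pos (show 0 < p₂ (-β) ^ 2 - p₁ (-β) ^ 2 by nlinarith) (B₁.qpos C i1)
      linarith
  · have hi : -m₂ ∈ Ioo (-m₁) α₁ := ⟨by linarith, by linarith⟩
    have h1 : Tendsto p₁ (𝓝[>] (-m₂)) (𝓝 (p₁ (-m₂))) :=
      (B₁.pcont hi).tendsto.mono_left nhdsWithin_le_nhds
    have := le_of_tendsto_of_tendsto h1 hpl₂ (by
      filter_upwards [hnear m₂ hm2] with s hs using
        (hcmp s hs.2.le (by linarith [hs.1]) hs.1).1.le)
    linarith [B₁.ppos _ hi]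

end First

theorem PB_tendsto (C : Coeff q Hinf) (N : Nonlin c f b β Hinf) {l : Filter ℝ} {r p : ℝ → ℝ}
    {R s : ℝ} (hR : 0 < R) (hs : InAbs c s) (hb : b < |s|) (hl : l ≤ 𝓝 s)
    (hr : Tendsto r l (𝓝 R)) (hp : Tendsto p l (𝓝 0)) :
    Tendsto (PB f q r p) l (𝓝 (Kq q R * q R * (2 * Fint f s))) := by
  have hq := (C.der R hR).continuousAt.tendsto.comp hr
  have hK := (C.Kder R hR).continuousAt.tendsto.comp hr
  have hF := (N.Fcont s hs).tendsto.mono_left hl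
  have hL := (N.Lder s hb hs).continuousAt.tendsto.mono_left hl
  have := ((hK.mul hq).mul ((hp.pow 2).add (hF.const_mul 2))).sub
    ((hL.const_mul 2).mul (hq.mul hp))
  rw [show Kq q R * q R * (2 * Fint f s) =
    Kq q R * q R * (0 ^ 2 + 2 * Fint f s) - 2 * Lam f s * (q R * 0) by ring]
  exact this

theorem Branch.PB_anti {lo hi : ℝ} {r p : ℝ → ℝ} (C : Coeff q Hinf) (N : Nonlin c f b β Hinf)
    (B : Branch c f q lo hi r p) {s t : ℝ} (hst : s ≤ t) (hI : Icc s t ⊆ Ioo lo hi)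
    (hβ : ∀ x ∈ Icc s t, β < |x|) : PB f q r p t ≤ PB f q r p s := by
  refine le_of_deriv_nonpos hst (fun x hx =>
    (B.Pder C N (hI hx) (N.b_lt.trans (hβ x hx))).continuousAt.continuousWithinAt)
    (fun x hx _ => ?_)
  have hx' := Ioo_subset_Icc_self hx
  refine ⟨_, ?_, B.Pder C N (hI hx') (N.b_lt.trans (hβ x hx'))⟩
  have h1 := N.Lge x (hβ x hx') (B.mem x (hI hx'))
  have h2 := C.Hge _ (B.rpos x (hI hx'))
  have := mul_nonneg (B.ypos C (hI hx')).le
    (show 0 ≤ 2 * Hfun q (r x) - 1 + 2 * deriv (Lam f) |x| by linarith)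
  linarith

/-- The two loops cannot be ordered: the Pohozaev functional, transported along the negative part
of the first branch and back along the second one, contradicts the ordering of the tails. -/
theorem loop_contradiction (C : Coeff q Hinf) (N : Nonlin c f b β Hinf)
    {m₁ m₂ α₁ α₂ R₁ R₂ : ℝ} {ρ₁ π₁ ρ₂ π₂ r₁ p₁ r₂ p₂ : ℝ → ℝ}
    (A₁ : Branch c f q (-m₁) α₁ ρ₁ π₁) (A₂ : Branch c f q (-m₂) α₂ ρ₂ π₂)
    (B₁ : Branch c f q 0 m₁ r₁ p₁) (B₂ : Branch c f q 0 m₂ r₂ p₂)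
    (hm₁ : InAbs c m₁) (hm₂ : InAbs c m₂) (hR₁ : 0 < R₁) (hR₂ : 0 < R₂)
    (hα1 : β < α₁) (hα2 : β < α₂) (hm1 : β < m₁) (hm : m₁ < m₂)
    (hρ₁ : Tendsto ρ₁ (𝓝[>] (-m₁)) (𝓝 R₁)) (hπ₁ : Tendsto π₁ (𝓝[>] (-m₁)) (𝓝 0))
    (hρ₂ : Tendsto ρ₂ (𝓝[>] (-m₂)) (𝓝 R₂)) (hπ₂ : Tendsto π₂ (𝓝[>] (-m₂)) (𝓝 0))
    (hr₁ : Tendsto r₁ (𝓝[<] m₁) (𝓝 R₁)) (hp₁ : Tendsto p₁ (𝓝[<] m₁) (𝓝 0))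
    (hr₂ : Tendsto r₂ (𝓝[<] m₂) (𝓝 R₂)) (hp₂ : Tendsto p₂ (𝓝[<] m₂) (𝓝 0))
    (hl₂ : Tendsto p₂ (𝓝[>] 0) (𝓝 0))
    (hπ : ∀ s, -m₁ < s → s ≤ -β → π₁ s < π₂ s ∧ yB q ρ₁ π₁ s < yB q ρ₂ π₂ s)
    (hP : PB f q ρ₁ π₁ (-β) < PB f q ρ₂ π₂ (-β))
    (hr : ∀ s, 0 < s → s ≤ β → r₂ s < r₁ s) (hp : ∀ s, 0 < s → s < m₁ → p₁ s ≤ p₂ s) :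
    False := by
  have hb := N.b_pos
  have hbβ := N.b_lt
  have hβ0 : 0 < β := hb.trans hbβ
  have hab : |β| = β := abs_of_pos hβ0
  have hab' : |(-β : ℝ)| = β := by rw [abs_neg, hab]
  have iβ1 : β ∈ Ioo 0 m₁ := ⟨hβ0, hm1⟩
  have iβ2 : β ∈ Ioo 0 m₂ := ⟨hβ0, hm1.trans hm⟩
  have hI1 : ∀ t, t < m₁ → Icc β t ⊆ Ioo 0 m₁ := fun t ht x hx =>
    ⟨hβ0.trans_le hx.1, hx.2.trans_lt ht⟩
  have hI2 : ∀ t, t < m₂ → Icc β t ⊆ Ioo 0 m₂ := fun t ht x hx =>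
    ⟨hβ0.trans_le hx.1, hx.2.trans_lt ht⟩
  have hJ1 : ∀ t, -m₁ < t → Icc t (-β) ⊆ Ioo (-m₁) α₁ := fun t ht x hx =>
    ⟨ht.trans_le hx.1, by linarith [hx.2]⟩
  have hJ2 : ∀ t, -m₂ < t → Icc t (-β) ⊆ Ioo (-m₂) α₂ := fun t ht x hx =>
    ⟨ht.trans_le hx.1, by linarith [hx.2]⟩
  have hy1 := B₁.ypos C iβ1
  have hy2 := B₂.ypos C iβ2
  set τ := yB q r₁ p₁ β / yB q r₂ p₂ β with hτ
  have hτ1 : 1 ≤ τ := by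
    rw [hτ, one_le_div hy2]
    have := tail_W_le C N B₁ B₂ hβ0 hm1 (hm1.trans hm) le_rfl hl₂ (hr β hβ0 le_rfl).le
    rw [WB_of_abs_eq_β N hab, WB_of_abs_eq_β N hab] at this
    exact le_of_sq_le_sq this hy1.le
  have hyτ : ∀ s, β ≤ s → s < m₁ → yB q r₁ p₁ s ≤ τ * yB q r₂ p₂ s := by
    intro s h1 h2
    have i2 := hI2 s (h2.trans hm) ⟨h1, le_rfl⟩
    have := y_ratio_anti C B₁ B₂ h1 (hI1 s h2) (hI2 s (h2.trans hm))
      (fun x hx => hp x (hβ0.trans hx.1) (hx.2.trans h2))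
      (fun x hx => (N.pos x (hbβ.trans hx.1)
        (B₁.mem x (hI1 s h2 (Ioo_subset_Icc_self hx)))).le)
    exact (div_le_iff₀ (B₂.ypos C i2)).1 this
  set P₁ := Kq q R₁ * q R₁ * (2 * Fint f m₁) with hP₁
  set P₂ := Kq q R₂ * q R₂ * (2 * Fint f m₂) with hP₂
  have hm10 : |m₁| = m₁ := abs_of_pos (hβ0.trans hm1)
  have hm20 : |m₂| = m₂ := abs_of_pos (hβ0.trans (hm1.trans hm))
  have hA1 : Tendsto (PB f q ρ₁ π₁) (𝓝[>] (-m₁)) (𝓝 P₁) := by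
    have := PB_tendsto C N hR₁ hm₁.neg (by rw [abs_neg, hm10]; linarith) nhdsWithin_le_nhds hρ₁ hπ₁
    rwa [N.Feven] at this
  have hA2 : Tendsto (PB f q ρ₂ π₂) (𝓝[>] (-m₂)) (𝓝 P₂) := by
    have := PB_tendsto C N hR₂ hm₂.neg (by rw [abs_neg, hm20]; linarith) nhdsWithin_le_nhds hρ₂ hπ₂
    rwa [N.Feven] at this
  have hB1 : Tendsto (PB f q r₁ p₁) (𝓝[<] m₁) (𝓝 P₁) :=
    PB_tendsto C N hR₁ hm₁ (by rw [hm10]; linarith) nhdsWithin_le_nhds hr₁ hp₁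
  have hB2 : Tendsto (PB f q r₂ p₂) (𝓝[<] m₂) (𝓝 P₂) :=
    PB_tendsto C N hR₂ hm₂ (by rw [hm20]; linarith) nhdsWithin_le_nhds hr₂ hp₂
  have hin : PB f q r₁ p₁ β - τ * PB f q r₂ p₂ β ≤ P₁ - τ * PB f q r₂ p₂ m₁ := by
    have hc : Tendsto (PB f q r₂ p₂) (𝓝[<] m₁) (𝓝 (PB f q r₂ p₂ m₁)) :=
      (B₂.Pder C N ⟨hβ0.trans hm1, hm⟩ (by rw [hm10]; linarith)).continuousAt.tendsto.mono_left
        nhdsWithin_le_nhds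
    refine ge_of_tendsto (hB1.sub (hc.const_mul τ)) ?_
    filter_upwards [Ioo_mem_nhdsLT hm1] with s hs
    have habs : ∀ x, β ≤ x → |x| = x := fun x hx => abs_of_pos (hβ0.trans_le hx)
    exact PB_sub_mono C N B₁ B₂ hτ1 hs.1.le (hI1 s hs.2) (hI2 s (hs.2.trans hm))
      (fun x hx => by rw [habs x hx.1]; linarith [hx.1])
      (fun x hx => by rw [habs x hx.1.le]; exact hx.1)
      (fun x hx => hp x (hβ0.trans hx.1) (hx.2.trans hs.2))
      (fun x hx => hyτ x hx.1.le (hx.2.trans hs.2))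
  have hnabs : ∀ x, x ≤ -β → |x| = -x := fun x hx => abs_of_neg (by linarith)
  have hout : P₁ - τ * PB f q ρ₂ π₂ (-m₁) ≤ PB f q ρ₁ π₁ (-β) - τ * PB f q ρ₂ π₂ (-β) := by
    have hc : Tendsto (PB f q ρ₂ π₂) (𝓝[>] (-m₁)) (𝓝 (PB f q ρ₂ π₂ (-m₁))) :=
      (A₂.Pder C N ⟨by linarith, by linarith⟩
        (by rw [abs_neg, hm10]; linarith)).continuousAt.tendsto.mono_left nhdsWithin_le_nhds
    refine le_of_tendsto (hA1.sub (hc.const_mul τ)) ?_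
    filter_upwards [Ioo_mem_nhdsGT (show -m₁ < -β by linarith)] with s hs
    refine PB_sub_mono C N A₁ A₂ hτ1 hs.2.le (hJ1 s hs.1) (hJ2 s (by linarith [hs.1]))
      (fun x hx => by rw [hnabs x hx.2]; linarith [hx.2])
      (fun x hx => by rw [hnabs x hx.2.le]; linarith [hx.2])
      (fun x hx => (hπ x (hs.1.trans hx.1) hx.2.le).1.le)
      (fun x hx => ?_)
    have h1 := (hπ x (hs.1.trans hx.1) hx.2.le).2
    have h2 := A₂.ypos C (hJ2 s (by linarith [hs.1]) (Ioo_subset_Icc_self hx))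
    nlinarith
  have hturn1 : PB f q ρ₂ π₂ (-m₁) ≤ P₂ := by
    refine ge_of_tendsto hA2 ?_
    filter_upwards [Ioo_mem_nhdsGT (show -m₂ < -m₁ by linarith)] with s hs
    exact A₂.PB_anti C N hs.2.le (fun x hx => ⟨hs.1.trans_le hx.1, by linarith [hx.2]⟩)
      (fun x hx => by rw [hnabs x (by linarith [hx.2])]; linarith [hx.2])
  have hturn2 : P₂ ≤ PB f q r₂ p₂ m₁ := by
    refine le_of_tendsto hB2 ?_
    filter_upwards [Ioo_mem_nhdsLT hm] with s hs
    exact B₂.PB_anti C N hs.1.le (fun x hx => ⟨by linarith [hx.1], hx.2.trans_lt hs.2⟩)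
      (fun x hx => by rw [abs_of_pos (by linarith [hx.1])]; linarith [hx.1])
  have i2' : -β ∈ Ioo (-m₂) α₂ := ⟨by linarith, by linarith⟩
  have hPpos : 0 ≤ PB f q ρ₂ π₂ (-β) := by
    rw [PB_of_abs_eq_β N hab']
    have := C.Kpos _ (A₂.rpos _ i2')
    have := A₂.qpos C i2'
    positivity
  have hfin : PB f q r₁ p₁ β < τ * PB f q r₂ p₂ β := by nlinarith
  rw [PB_of_abs_eq_β N hab, PB_of_abs_eq_β N hab] at hfin
  have hYB := tail_YB_le C N B₁ B₂ hβ0 hm1 (hm1.trans hm) le_rfl hl₂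
    (fun s h1 h2 => (hr s h1 h2.le).le) (fun s h1 h2 => hp s h1 (h2.trans hm1))
  unfold YB eB at hYB
  rw [N.Fβ, mul_zero, add_zero, add_zero, Real.sqrt_sq (B₁.ppos β iβ1).le,
    Real.sqrt_sq (B₂.ppos β iβ2).le] at hYB
  have e : τ * yB q r₂ p₂ β = yB q r₁ p₁ β := by rw [hτ]; field_simp
  have e1 : Kq q (r₁ β) * q (r₁ β) * p₁ β ^ 2 = yB q r₁ p₁ β * (Kq q (r₁ β) * p₁ β) := by
    unfold yB; ring
  have e2 : τ * (Kq q (r₂ β) * q (r₂ β) * p₂ β ^ 2) =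
      (τ * yB q r₂ p₂ β) * (Kq q (r₂ β) * p₂ β) := by
    unfold yB; ring
  rw [e1, e2, e] at hfin
  exact absurd hYB (not_le.2 (lt_of_mul_lt_mul_left hfin hy1.le))

end

section

variable {c : EReal} {f q : ℝ → ℝ} {b β Hinf : ℝ}

/-- A solution `v` of (E) together with its derivative `dv`. -/
structure FlowSol (c : EReal) (f q v dv : ℝ → ℝ) : Prop where
  cont : ContinuousOn v (Ici 0)
  dcont : ContinuousOn dv (Ici 0)
  d0 : dv 0 = 0
  vder : ∀ r, 0 < r → HasDerivAt v (dv r) r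
  dder : ∀ r, 0 < r → HasDerivAt dv (-(logd q r * dv r) - f (v r)) r
  mem : ∀ r, 0 ≤ r → InAbs c (v r)

theorem exists_bound_comp (N : Nonlin c f b β Hinf) {v : ℝ → ℝ} {x y : ℝ}
    (hc : ContinuousOn v (Icc x y)) (hm : ∀ r ∈ Icc x y, InAbs c (v r)) :
    ∃ M, 0 < M ∧ ∀ r ∈ Icc x y, |f (v r)| ≤ M := by
  rcases (Icc x y).eq_empty_or_nonempty with h | h
  · exact ⟨1, one_pos, by simp [h]⟩
  · obtain ⟨t, ht, hmax⟩ := isCompact_Icc.exists_isMaxOn h hc.abs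
    obtain ⟨M, hM, hb⟩ := N.bdd (v t) (hm t ht)
    exact ⟨M, hM, fun r hr => hb _ (hmax hr)⟩

theorem flow_of_solution (C : Coeff q Hinf) (N : Nonlin c f b β Hinf) {u : ℝ → ℝ}
    (hu : IsSolutionE c f q u) : FlowSol c f q u (derivWithin u (Ici 0)) := by
  have hcont := hu.c1.continuousOn
  have hdc : ContinuousOn (derivWithin u (Ici 0)) (Ici 0) :=
    hu.c1.continuousOn_derivWithin (uniqueDiffOn_Ici 0) le_rfl
  have hnh : ∀ r : ℝ, 0 < r → Ici (0 : ℝ) ∈ 𝓝 r := fun r hr => Ici_mem_nhds hr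
  have hder : ∀ r : ℝ, 0 < r → HasDerivAt u (derivWithin u (Ici 0) r) r := fun r hr => by
    rw [derivWithin_of_mem_nhds (hnh r hr)]
    exact ((hu.c1.differentiableOn one_ne_zero).differentiableAt (hnh r hr)).hasDerivAt
  have hdder : ∀ r : ℝ, 0 < r → HasDerivAt (derivWithin u (Ici 0))
      (-(logd q r * derivWithin u (Ici 0) r) - f (u r)) r := fun r hr => by
    have h1 := (hu.diff2 r hr).hasDerivAt
    have h2 : derivWithin u (Ici 0) =ᶠ[𝓝 r] deriv u := by
      filter_upwards [Ioi_mem_nhds hr] with t ht using derivWithin_of_mem_nhds (hnh t ht)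
    refine (h1.congr_of_eventuallyEq h2).congr_deriv ?_
    have := hu.ode r hr
    rw [derivWithin_of_mem_nhds (hnh r hr)]
    unfold logd
    linarith
  have hmem : ∀ r, 0 ≤ r → InAbs c (u r) := fun r hr => InCC.inAbs (hu.mem r hr)
  refine ⟨hcont, hdc, ?_, hder, hdder, hmem⟩
  obtain ⟨M, hM, hb⟩ := exists_bound_comp N (x := 0) (y := 1)
    (hcont.mono Icc_subset_Ici_self) (fun r hr => hmem r hr.1)
  set dv := derivWithin u (Ici 0) with hdv
  have key : ∀ r ∈ Ioo (0 : ℝ) 1, |dv r| ≤ M * r := by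
    intro r hr
    have hqr := C.pos r hr.1
    have hg : ContinuousOn (fun s => q s * dv s) (Icc 0 r) :=
      (C.cont.mul hdc).mono Icc_subset_Ici_self
    have hgd : ∀ s ∈ Ioo 0 r, HasDerivAt (fun s => q s * dv s) (-(q s * f (u s))) s := by
      intro s hs
      refine ((C.der s hs.1).mul (hdder s hs.1)).congr_deriv ?_
      rw [C.dq_eq hs.1]; ring
    have hbd : ∀ s ∈ Ioo 0 r, |q s * f (u s)| ≤ M * q r := by
      intro s hs
      rw [abs_mul, abs_of_pos (C.pos s hs.1), mul_comm]
      have h1 := hb s ⟨hs.1.le, by linarith [hs.2, hr.2]⟩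
      have h2 := C.mono s r hs.1.le hs.2.le
      have h3 := C.pos s hs.1
      gcongr
    have hlin : ∀ s : ℝ, HasDerivAt (fun s => M * q r * s) (M * q r) s := fun s => by
      simpa using (hasDerivAt_id s).const_mul (M * q r)
    have h1 := le_of_deriv_nonneg (g := fun s => M * q r * s - q s * dv s) hr.1.le
      (ContinuousOn.sub (by fun_prop) hg) (fun s hs _ =>
        ⟨_, by have := (abs_le.1 (hbd s hs)).1; simp only [ge_iff_le]; linarith,
          (hlin s).sub (hgd s hs)⟩)
    have h2 := le_of_deriv_nonneg (g := fun s => M * q r * s + q s * dv s) hr.1.le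
      (ContinuousOn.add (by fun_prop) hg) (fun s hs _ =>
        ⟨_, by have := (abs_le.1 (hbd s hs)).2; simp only [ge_iff_le]; linarith,
          (hlin s).add (hgd s hs)⟩)
    simp only [C.zero, zero_mul, mul_zero, sub_zero, add_zero] at h1 h2
    rw [abs_le]
    constructor
    · have : 0 ≤ q r * (M * r + dv r) := by linarith
      linarith [nonneg_of_mul_nonneg_right this hqr]
    · have : 0 ≤ q r * (M * r - dv r) := by linarith
      linarith [nonneg_of_mul_nonneg_right this hqr]
  have hl : Tendsto dv (𝓝[>] 0) (𝓝 (dv 0)) :=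
    (hdc 0 self_mem_Ici).tendsto.mono_left (nhdsWithin_mono _ Ioi_subset_Ici_self)
  have hz : Tendsto dv (𝓝[>] 0) (𝓝 0) := by
    refine squeeze_zero_norm' (a := fun r => M * r) ?_ ?_
    · filter_upwards [Ioo_mem_nhdsGT one_pos] with r hr using key r hr
    · have : Tendsto (fun r : ℝ => M * r) (𝓝 0) (𝓝 (M * 0)) := tendsto_id.const_mul M
      rw [mul_zero] at this
      exact this.mono_left nhdsWithin_le_nhds
  exact tendsto_nhds_unique hl hz

/-- The energy. -/
def en (f v dv : ℝ → ℝ) (r : ℝ) : ℝ := dv r ^ 2 / 2 + Fint f (v r)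

namespace FlowSol

variable {v dv : ℝ → ℝ} (S : FlowSol c f q v dv)
include S

theorem neg (N : Nonlin c f b β Hinf) : FlowSol c f q (fun r => -v r) (fun r => -dv r) where
  cont := S.cont.neg
  dcont := S.dcont.neg
  d0 := by simp [S.d0]
  vder r hr := (S.vder r hr).neg
  dder r hr := (S.dder r hr).neg.congr_deriv (by rw [N.odd]; ring)
  mem r hr := (S.mem r hr).neg

variable (C : Coeff q Hinf) (N : Nonlin c f b β Hinf)

theorem qdv_der (C : Coeff q Hinf) {r : ℝ} (hr : 0 < r) :
    HasDerivAt (fun r => q r * dv r) (-(q r * f (v r))) r := by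
  refine ((C.der r hr).mul (S.dder r hr)).congr_deriv ?_
  rw [C.dq_eq hr]; ring

theorem qdv_cont (C : Coeff q Hinf) : ContinuousOn (fun r => q r * dv r) (Ici 0) :=
  C.cont.mul S.dcont

include N

theorem en_cont : ContinuousOn (en f v dv) (Ici 0) := fun r hr =>
  ((S.dcont.pow 2).div_const 2 r hr).add ((N.Fcont (v r) (S.mem r hr)).comp_continuousWithinAt
    (S.cont r hr))

include C

theorem en_slope {r ε : ℝ} (hr : 0 < r) (hε : 0 < ε) :
    ∀ᶠ z in 𝓝[>] r, slope (en f v dv) r z < ε := by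
  have hlog := C.logd_pos hr
  have hnn : -(logd q r * dv r ^ 2) < ε := by nlinarith [mul_nonneg hlog.le (sq_nonneg (dv r))]
  by_cases h0 : v r = 0
  · have hf0 : f 0 = 0 := by
      have := N.odd 0
      rw [neg_zero] at this; linarith
    have hG : HasDerivAt (fun z => dv z ^ 2 / 2) (-(logd q r * dv r ^ 2)) r := by
      refine (((S.dder r hr).pow 2).div_const 2).congr_deriv ?_
      rw [h0, hf0]; norm_num; ring
    have h1 := hG.hasDerivWithinAt.limsup_slope_le' (s := Ioi r) (lt_irrefl r) hnn
    have h2 : ∀ᶠ z in 𝓝[>] r, |v z| ≤ β := by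
      have : Tendsto (fun z => |v z|) (𝓝 r) (𝓝 |v r|) := (S.vder r hr).continuousAt.abs
      rw [h0, abs_zero] at this
      exact (this.eventually_le_const (N.b_pos.trans N.b_lt)).filter_mono nhdsWithin_le_nhds
    filter_upwards [h1, h2, self_mem_nhdsWithin] with z hz1 hz2 hz3
    refine lt_of_le_of_lt ?_ hz1
    rw [slope_def_field, slope_def_field]
    have hz3' : 0 < z - r := sub_pos.2 hz3
    have hF := N.Fle _ hz2
    have hF0 : Fint f (v r) = 0 := by rw [h0]; simp [Fint]
    refine div_le_div_of_nonneg_right ?_ hz3'.le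
    unfold en
    linarith
  · have hE : HasDerivAt (en f v dv) (-(logd q r * dv r ^ 2)) r := by
      refine ((((S.dder r hr).pow 2).div_const 2).add
        ((N.Fder (v r) h0 (S.mem r hr.le)).comp r (S.vder r hr))).congr_deriv ?_
      norm_num; ring
    exact hE.hasDerivWithinAt.limsup_slope_le' (s := Ioi r) (lt_irrefl r) hnn

theorem en_anti {x y : ℝ} (hx : 0 ≤ x) (hxy : x ≤ y) : en f v dv y ≤ en f v dv x := by
  have key : ∀ x, 0 < x → x ≤ y → en f v dv y ≤ en f v dv x := by
    intro x hx hxy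
    refine image_le_of_liminf_slope_right_le_deriv_boundary (a := x) (b := y)
      (B := fun _ => en f v dv x) (B' := fun _ => 0)
      ((S.en_cont N).mono (fun t ht => hx.le.trans ht.1)) le_rfl continuousOn_const
      (fun t _ => hasDerivWithinAt_const _ _ _) (fun t ht ε hε => ?_) ⟨hxy, le_rfl⟩
    exact (S.en_slope C N (hx.trans_le ht.1) hε).frequently
  rcases hx.eq_or_lt with h | h
  · subst h
    rcases hxy.eq_or_lt with h' | h'
    · rw [h']
    · have := (S.en_cont N 0 self_mem_Ici).tendsto.mono_left
        (nhdsWithin_mono _ Ioi_subset_Ici_self)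
      refine ge_of_tendsto this ?_
      filter_upwards [Ioo_mem_nhdsGT h'] with t ht using key t ht.1 ht.2.le
  · exact key x h hxy

variable (hv : Tendsto v atTop (𝓝 0))
include hv

omit C S in
theorem F_tendsto : Tendsto (fun r => Fint f (v r)) atTop (𝓝 0) := by
  have := (N.Fcont 0 (N.β_mem.of_le (by simp))).tendsto.comp hv
  have h0 : Fint f 0 = 0 := by simp [Fint]
  rwa [h0] at this

theorem en_nonneg {r : ℝ} (hr : 0 ≤ r) : 0 ≤ en f v dv r := by
  refine le_of_tendsto (F_tendsto N hv) ?_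
  filter_upwards [eventually_ge_atTop r] with t ht
  have := S.en_anti C N hr ht
  unfold en at this ⊢
  nlinarith [sq_nonneg (dv t)]

omit C N in
theorem eq_zero_of_dv_eq_zero {Z : ℝ} (hZ : 0 ≤ Z) (h : ∀ r, Z < r → v r ≠ 0 → dv r = 0) :
    ∀ r, Z < r → v r = 0 := by
  intro r hr
  by_contra hne
  have hr0 : 0 < r := hZ.trans_lt hr
  have hc : ∀ y, ContinuousOn (fun t => |v t|) (Icc r y) := fun y =>
    S.cont.abs.mono (fun t ht => hr0.le.trans ht.1)
  have hconst : ∀ z, r ≤ z → (∀ t, r < t → t < z → v t ≠ 0) → v z = v r := by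
    intro z hz hn
    have hcv : ContinuousOn v (Icc r z) := S.cont.mono (fun t ht => hr0.le.trans ht.1)
    have hd : ∀ t ∈ Ioo r z, HasDerivAt v 0 t := fun t ht => by
      have := S.vder t (hr0.trans ht.1)
      rwa [h t (hr.trans ht.1) (hn t ht.1 ht.2)] at this
    exact le_antisymm (le_of_deriv_nonpos hz hcv (fun t ht _ => ⟨0, le_rfl, hd t ht⟩))
      (le_of_deriv_nonneg hz hcv (fun t ht _ => ⟨0, le_rfl, hd t ht⟩))
  have hnz : ∀ t, r ≤ t → v t ≠ 0 := by
    intro t ht h0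
    obtain ⟨z, hz, hz0, hzp⟩ := exists_first_zero (g := fun t => |v t|) (t := t) (hc t)
      ⟨ht, le_rfl⟩ (by simp [h0]) (abs_pos.2 hne)
    have := hconst z hz.1.le (fun s h1 h2 => abs_pos.1 (hzp s ⟨h1.le, h2⟩))
    exact hne (this ▸ abs_eq_zero.1 hz0)
  have hlim : Tendsto v atTop (𝓝 (v r)) := by
    refine tendsto_const_nhds.congr' ?_
    filter_upwards [eventually_ge_atTop r] with z hz
    exact (hconst z hz (fun t h1 _ => hnz t h1.le)).symm
  exact hne (tendsto_nhds_unique hlim hv)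

/-- Once the energy vanishes, the solution is identically zero. -/
theorem eq_zero_of_en_le {Z : ℝ} (hZ : 0 ≤ Z) (hE : en f v dv Z ≤ 0) :
    ∀ r, Z < r → v r = 0 := by
  refine S.eq_zero_of_dv_eq_zero hv hZ (fun r hr hne => ?_)
  have hr0 : 0 < r := hZ.trans_lt hr
  have hz : ∀ t, Z < t → en f v dv t = 0 := fun t ht =>
    le_antisymm ((S.en_anti C N hZ ht.le).trans hE) (S.en_nonneg C N hv (hZ.trans ht.le))
  have hE' : HasDerivAt (en f v dv) (-(logd q r * dv r ^ 2)) r := by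
    refine ((((S.dder r hr0).pow 2).div_const 2).add
      ((N.Fder (v r) hne (S.mem r hr0.le)).comp r (S.vder r hr0))).congr_deriv ?_
    norm_num; ring
  have h0 : HasDerivAt (en f v dv) 0 r := by
    refine (hasDerivAt_const r (0 : ℝ)).congr_of_eventuallyEq ?_
    filter_upwards [Ioi_mem_nhds hr] with t ht using hz t ht
  have := hE'.unique h0
  have hlog := C.logd_pos hr0
  have h2 : logd q r * dv r ^ 2 = 0 := by linarith
  simpa [hlog.ne'] using h2

theorem en_pos {r : ℝ} (hr : 0 ≤ r) (h : v r ≠ 0) : 0 < en f v dv r := by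
  by_contra hcon
  have hz := S.eq_zero_of_en_le C N hv hr (not_lt.1 hcon)
  have h1 : Tendsto v (𝓝[>] r) (𝓝 (v r)) :=
    (S.cont r hr).tendsto.mono_left (nhdsWithin_mono _ (fun t ht => hr.trans (le_of_lt ht)))
  have h2 : Tendsto v (𝓝[>] r) (𝓝 0) := by
    refine tendsto_const_nhds.congr' ?_
    filter_upwards [self_mem_nhdsWithin] with t ht using (hz t ht).symm
  exact h (tendsto_nhds_unique h1 h2)

/-- At a critical point with `v ≠ 0` one has `|v| > β`. -/
theorem beta_lt_of_dv_eq_zero {r : ℝ} (hr : 0 ≤ r) (h : v r ≠ 0) (hd : dv r = 0) : β < |v r| := by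
  by_contra hcon
  have h1 := S.en_pos C N hv hr h
  have h2 := N.Fle _ (not_lt.1 hcon)
  unfold en at h1
  rw [hd] at h1
  norm_num at h1
  linarith

end FlowSol

end

section

variable {c : EReal} {f q : ℝ → ℝ} {b β Hinf : ℝ}

theorem exists_neg_left {g : ℝ → ℝ} {x g' : ℝ} (hg : HasDerivAt g g' x) (h0 : g x = 0)
    (hpos : 0 < g') {a : ℝ} (ha : a < x) : ∃ y ∈ Ioo a x, g y < 0 := by
  have h1 := (hasDerivAt_iff_tendsto_slope.1 hg).eventually (lt_mem_nhds hpos)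
  have h2 : ∀ᶠ y in 𝓝[<] x, 0 < slope g x y :=
    h1.filter_mono (nhdsWithin_mono _ (fun y hy => ne_of_lt hy))
  obtain ⟨y, hy1, hy2⟩ := (h2.and (Ioo_mem_nhdsLT ha)).exists
  refine ⟨y, hy2, ?_⟩
  rw [slope_def_field, h0, sub_zero] at hy1
  by_contra hcon
  exact absurd hy1 (not_lt.2 (div_nonpos_of_nonneg_of_nonpos (not_lt.1 hcon)
    (by linarith [hy2.2])))

namespace FlowSol

variable {v dv : ℝ → ℝ} (S : FlowSol c f q v dv)
include S

theorem strictAnti {R X : ℝ} (hR : 0 ≤ R) (hd : ∀ t ∈ Ioo R X, dv t < 0) :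
    StrictAntiOn v (Icc R X) := by
  refine strictAntiOn_of_deriv_neg (convex_Icc _ _) (S.cont.mono fun t ht => hR.trans ht.1) ?_
  intro t ht
  rw [interior_Icc] at ht
  rw [(S.vder t (hR.trans_lt ht.1)).deriv]
  exact hd t ht

variable (C : Coeff q Hinf) (N : Nonlin c f b β Hinf)
include C N

theorem dv_neg_near {R : ℝ} (hR : 0 ≤ R) (hd : dv R = 0) (hb : b < v R) :
    ∃ ε > 0, ∀ t ∈ Ioc R (R + ε), dv t < 0 := by
  have h1 : ∀ᶠ t in 𝓝[≥] R, b < v t :=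
    ((S.cont R hR).mono (Ici_subset_Ici.2 hR)).eventually (lt_mem_nhds hb)
  obtain ⟨y, hy, hsub⟩ := mem_nhdsGE_iff_exists_Ico_subset.1 h1
  have hy' : R < y := hy
  refine ⟨(y - R) / 2, by linarith, fun t ht => ?_⟩
  have ht0 : 0 < t := hR.trans_lt ht.1
  have hanti : StrictAntiOn (fun r => q r * dv r) (Icc R t) := by
    refine strictAntiOn_of_deriv_neg (convex_Icc _ _)
      ((S.qdv_cont C).mono fun t ht => hR.trans ht.1) ?_
    intro s hs
    rw [interior_Icc] at hs
    have hs0 := hR.trans_lt hs.1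
    rw [(S.qdv_der C hs0).deriv]
    have := N.pos (v s) (hsub ⟨hs.1.le, by linarith [hs.2, ht.2]⟩) (S.mem s hs0.le)
    have := mul_pos (C.pos s hs0) this
    linarith
  have := hanti ⟨le_rfl, ht.1.le⟩ ⟨ht.1.le, le_rfl⟩ ht.1
  simp only [hd, mul_zero] at this
  exact (pos_iff_neg_of_mul_neg this).1 (C.pos t ht0)

theorem exists_next_crit {R t : ℝ} (hR : 0 ≤ R) (hd : dv R = 0) (hb : b < v R)
    (ht : R < t) (hdt : 0 ≤ dv t) :
    ∃ z, R < z ∧ dv z = 0 ∧ (∀ s ∈ Ioo R z, dv s < 0) ∧ v z ≤ b := by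
  obtain ⟨ε, hε, hn⟩ := S.dv_neg_near C N hR hd hb
  have hεt : R + ε < t := by
    by_contra h
    exact absurd hdt (not_le.2 (hn t ⟨ht, not_lt.1 h⟩))
  obtain ⟨z, hz, hz0, hzn⟩ := exists_first_zero (g := fun s => -dv s) (x := R + ε) (y := t) (t := t)
    (S.dcont.neg.mono fun s hs => by
      have := hs.1
      exact mem_Ici.2 (by linarith)) ⟨hεt.le, le_rfl⟩ (by simpa using hdt)
      (by simpa using hn (R + ε) ⟨by linarith, le_rfl⟩)
  have hRz : R < z := by linarith [hz.1]
  have hzn' : ∀ s ∈ Ioo R z, dv s < 0 := by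
    intro s hs
    rcases le_or_gt s (R + ε) with h | h
    · exact hn s ⟨hs.1, h⟩
    · have := hzn s ⟨h.le, hs.2⟩
      linarith
  have hz0' : dv z = 0 := by simpa using hz0
  refine ⟨z, hRz, hz0', hzn', ?_⟩
  by_contra hcon
  have hz00 := hR.trans_lt hRz
  have hfp := N.pos (v z) (not_le.1 hcon) (S.mem z hz00.le)
  obtain ⟨y, hy, hyn⟩ := exists_neg_left (S.dder z hz00).neg (by simpa using hz0)
    (by rw [hz0']; linarith) hRz
  have := hzn' y hy
  simp only [Pi.neg_apply] at hyn
  linarith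

end FlowSol

/-- A decreasing piece of the solution `v` starting at the critical point `R`, with
inverse function `r` on the range of levels `(lo, hi)`. -/
structure Piece (v dv : ℝ → ℝ) (R lo hi : ℝ) (r : ℝ → ℝ) : Prop where
  nonneg : 0 ≤ R
  lt : lo < hi
  top : v R = hi
  crit : dv R = 0
  gt : ∀ s ∈ Ioo lo hi, R < r s
  val : ∀ s ∈ Ioo lo hi, v (r s) = s
  neg : ∀ s ∈ Ioo lo hi, ∀ t ∈ Ioc R (r s), dv t < 0

namespace Piece

variable {v dv r : ℝ → ℝ} {R lo hi : ℝ} (S : FlowSol c f q v dv) (K : Piece v dv R lo hi r)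
include S K

theorem anti {s : ℝ} (hs : s ∈ Ioo lo hi) : StrictAntiOn v (Icc R (r s)) :=
  S.strictAnti K.nonneg fun t ht => K.neg s hs t ⟨ht.1, ht.2.le⟩

theorem val_mem {s t : ℝ} (hs : s ∈ Ioo lo hi) (ht : t ∈ Ioo R (r s)) : v t ∈ Ioo s hi := by
  have hA := K.anti S hs
  constructor
  · have := hA ⟨ht.1.le, ht.2.le⟩ ⟨(K.gt s hs).le, le_rfl⟩ ht.2
    rwa [K.val s hs] at this
  · have := hA ⟨le_rfl, (K.gt s hs).le⟩ ⟨ht.1.le, ht.2.le⟩ ht.1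
    rwa [K.top] at this

theorem left_inv {t : ℝ} (ht : R < t) (hv : v t ∈ Ioo lo hi) (hd : ∀ s ∈ Ioo R t, dv s < 0) :
    r (v t) = t := by
  rcases le_total t (r (v t)) with h | h
  · exact (K.anti S hv).injOn ⟨(K.gt _ hv).le, le_rfl⟩ ⟨ht.le, h⟩ (K.val _ hv)
  · exact (S.strictAnti K.nonneg hd).injOn ⟨(K.gt _ hv).le, h⟩ ⟨ht.le, le_rfl⟩ (K.val _ hv)

theorem left_inv' {s t : ℝ} (hs : s ∈ Ioo lo hi) (ht : t ∈ Ioo R (r s)) : r (v t) = t :=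
  have hm := K.val_mem S hs ht
  K.left_inv S ht.1 ⟨hs.1.trans hm.1, hm.2⟩
    (fun x hx => K.neg s hs x ⟨hx.1, hx.2.le.trans ht.2.le⟩)

theorem r_anti {s s' : ℝ} (hs : s ∈ Ioo lo hi) (hs' : s' ∈ Ioo lo hi) (h : s < s') :
    r s' < r s := by
  by_contra hcon
  have := (K.anti S hs').antitoneOn ⟨(K.gt s hs).le, not_lt.1 hcon⟩ ⟨(K.gt s' hs').le, le_rfl⟩
    (not_lt.1 hcon)
  rw [K.val s hs, K.val s' hs'] at this
  linarith

theorem r_cont {s : ℝ} (hs : s ∈ Ioo lo hi) : ContinuousAt r s := by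
  have hmem : ∀ᶠ y in 𝓝 s, y ∈ Ioo lo hi := Ioo_mem_nhds hs.1 hs.2
  refine tendsto_order.2 ⟨fun a ha => ?_, fun a ha => ?_⟩
  · obtain ⟨t, ht1, ht2⟩ := exists_between (max_lt ha (K.gt s hs))
    have htm : t ∈ Ioo R (r s) := ⟨(le_max_right _ _).trans_lt ht1, ht2⟩
    have hv := K.val_mem S hs htm
    filter_upwards [hmem, gt_mem_nhds hv.1] with y hy hyt
    have := K.r_anti S hy ⟨hs.1.trans hv.1, hv.2⟩ hyt
    rw [K.left_inv' S hs htm] at this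
    exact ((le_max_left _ _).trans_lt ht1).trans this
  · obtain ⟨s', hs1, hs2⟩ := exists_between hs.1
    have hs' : s' ∈ Ioo lo hi := ⟨hs1, hs2.trans hs.2⟩
    obtain ⟨t, ht1, ht2⟩ := exists_between (lt_min ha (K.r_anti S hs' hs hs2))
    have htm : t ∈ Ioo R (r s') := ⟨(K.gt s hs).trans ht1, ht2.trans_le (min_le_right _ _)⟩
    have hv := K.val_mem S hs' htm
    have hvs : v t < s := by
      have := K.anti S hs' ⟨(K.gt s hs).le, (ht1.trans htm.2).le⟩ ⟨htm.1.le, htm.2.le⟩ ht1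
      rwa [K.val s hs] at this
    filter_upwards [hmem, lt_mem_nhds hvs] with y hy hyt
    have := K.r_anti S ⟨hs1.trans hv.1, hv.2⟩ hy hyt
    rw [K.left_inv' S hs' htm] at this
    exact this.trans (ht2.trans_le (min_le_left _ _))

theorem r_der {s : ℝ} (hs : s ∈ Ioo lo hi) : HasDerivAt r (-1 / (-dv (r s))) s := by
  have hg := K.gt s hs
  have hd := K.neg s hs (r s) ⟨hg, le_rfl⟩
  have := HasDerivAt.of_local_left_inverse (K.r_cont S hs) (S.vder (r s) (K.nonneg.trans_lt hg))
    hd.ne (by filter_upwards [Ioo_mem_nhds hs.1 hs.2] with y hy using K.val y hy)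
  refine this.congr_deriv ?_
  have := hd.ne
  field_simp

theorem branch (C : Coeff q Hinf) (N : Nonlin c f b β Hinf) (hv : Tendsto v atTop (𝓝 0)) :
    Branch c f q lo hi r (fun s => -dv (r s)) where
  mem s hs := by
    have := S.mem (r s) (K.nonneg.trans (K.gt s hs).le)
    rwa [K.val s hs] at this
  rpos s hs := K.nonneg.trans_lt (K.gt s hs)
  ppos s hs := neg_pos.2 (K.neg s hs (r s) ⟨K.gt s hs, le_rfl⟩)
  rder s hs := K.r_der S hs
  pder s hs := by
    have hg := K.gt s hs
    have hd := K.neg s hs (r s) ⟨hg, le_rfl⟩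
    refine (((S.dder (r s) (K.nonneg.trans_lt hg)).comp s (K.r_der S hs)).neg).congr_deriv ?_
    rw [K.val s hs]
    have := hd.ne
    field_simp
    ring
  epos s hs := by
    have hg := K.gt s hs
    have hd := K.neg s hs (r s) ⟨hg, le_rfl⟩
    by_cases h0 : s = 0
    · subst h0
      have hF : Fint f 0 = 0 := by simp [Fint]
      rw [hF]
      have := sq_pos_of_pos (neg_pos.2 hd)
      linarith
    · have := S.en_pos C N hv (K.nonneg.trans hg.le) (by rwa [K.val s hs])
      unfold en at this
      rw [K.val s hs] at this
      linarith [neg_sq (dv (r s))]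

theorem r_top : Tendsto r (𝓝[<] hi) (𝓝 R) := by
  obtain ⟨s, hs1, hs2⟩ := exists_between K.lt
  have hs : s ∈ Ioo lo hi := ⟨hs1, hs2⟩
  have hm : ∀ᶠ y in 𝓝[<] hi, y ∈ Ioo lo hi := Ioo_mem_nhdsLT K.lt
  refine tendsto_order.2 ⟨fun a ha => ?_, fun a ha => ?_⟩
  · filter_upwards [hm] with y hy using ha.trans (K.gt y hy)
  · obtain ⟨t, ht1, ht2⟩ := exists_between (lt_min ha (K.gt s hs))
    have htm : t ∈ Ioo R (r s) := ⟨ht1, ht2.trans_le (min_le_right _ _)⟩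
    have hv := K.val_mem S hs htm
    filter_upwards [hm, Ioo_mem_nhdsLT hv.2] with y hy hyt
    have := K.r_anti S ⟨hs.1.trans hv.1, hv.2⟩ hy hyt.1
    rw [K.left_inv' S hs htm] at this
    exact this.trans (ht2.trans_le (min_le_left _ _))

theorem p_top : Tendsto (fun s => -dv (r s)) (𝓝[<] hi) (𝓝 0) := by
  have h2 : Tendsto dv (𝓝[Ici 0] R) (𝓝 (dv R)) := S.dcont R K.nonneg
  have h3 : Tendsto r (𝓝[<] hi) (𝓝[Ici 0] R) := by
    refine tendsto_nhdsWithin_iff.2 ⟨(K.r_top S), ?_⟩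
    filter_upwards [Ioo_mem_nhdsLT K.lt] with y hy using K.nonneg.trans (K.gt y hy).le
  have := (h2.comp h3).neg
  rw [K.crit, neg_zero] at this
  exact this

/-- Behaviour at the bottom of a piece that ends at a critical point. -/
theorem r_bot {X : ℝ} (hX : R < X) (hvX : v X = lo) (hdX : dv X = 0)
    (hd : ∀ t ∈ Ioo R X, dv t < 0) :
    (∀ t ∈ Ioo R X, v t ∈ Ioo lo hi ∧ r (v t) = t) ∧ Tendsto r (𝓝[>] lo) (𝓝 X) ∧
      Tendsto (fun s => -dv (r s)) (𝓝[>] lo) (𝓝 0) := by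
  have hA := S.strictAnti K.nonneg hd
  have hle : ∀ s ∈ Ioo lo hi, r s ≤ X := fun s hs => by
    by_contra hcon
    exact absurd hdX (K.neg s hs X ⟨hX, (not_le.1 hcon).le⟩).ne
  have hcov : ∀ t ∈ Ioo R X, v t ∈ Ioo lo hi ∧ r (v t) = t := by
    intro t ht
    have h1 := hA ⟨ht.1.le, ht.2.le⟩ ⟨hX.le, le_rfl⟩ ht.2
    have h2 := hA ⟨le_rfl, hX.le⟩ ⟨ht.1.le, ht.2.le⟩ ht.1
    rw [hvX] at h1
    rw [K.top] at h2
    exact ⟨⟨h1, h2⟩, K.left_inv S ht.1 ⟨h1, h2⟩ fun x hx => hd x ⟨hx.1, hx.2.trans ht.2⟩⟩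
  have hm : ∀ᶠ y in 𝓝[>] lo, y ∈ Ioo lo hi := Ioo_mem_nhdsGT K.lt
  have hr : Tendsto r (𝓝[>] lo) (𝓝 X) := by
    refine tendsto_order.2 ⟨fun a ha => ?_, fun a ha => ?_⟩
    · obtain ⟨t, ht1, ht2⟩ := exists_between (max_lt ha hX)
      have hc := hcov t ⟨(le_max_right _ _).trans_lt ht1, ht2⟩
      filter_upwards [hm, Ioo_mem_nhdsGT hc.1.1] with y hy hyt
      have := K.r_anti S hy hc.1 hyt.2
      rw [hc.2] at this
      exact ((le_max_left _ _).trans_lt ht1).trans this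
    · filter_upwards [hm] with y hy using (hle y hy).trans_lt ha
  refine ⟨hcov, hr, ?_⟩
  have := (((S.dder X (K.nonneg.trans_lt hX)).continuousAt.tendsto).comp hr).neg
  rw [hdX, neg_zero] at this
  exact this

end Piece

theorem exists_piece {v dv : ℝ → ℝ} {R lo hi : ℝ} (hR : 0 ≤ R) (hlt : lo < hi) (htop : v R = hi)
    (hcrit : dv R = 0)
    (h : ∀ s ∈ Ioo lo hi, ∃ t, R < t ∧ v t = s ∧ ∀ x ∈ Ioc R t, dv x < 0) :
    ∃ r, Piece v dv R lo hi r := by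
  choose! r h1 h2 h3 using h
  exact ⟨r, hR, hlt, htop, hcrit, h1, h2, h3⟩

theorem FlowSol.exists_piece_to {v dv : ℝ → ℝ} (S : FlowSol c f q v dv) {R X : ℝ} (hR : 0 ≤ R)
    (hX : R < X) (hcrit : dv R = 0) (hd : ∀ t ∈ Ioo R X, dv t < 0) :
    ∃ r, Piece v dv R (v X) (v R) r := by
  have hA := S.strictAnti hR hd
  refine exists_piece hR (hA ⟨le_rfl, hX.le⟩ ⟨hX.le, le_rfl⟩ hX) rfl hcrit fun s hs => ?_
  obtain ⟨t, ht, hts⟩ := intermediate_value_Ioo' hX.le (S.cont.mono fun t ht => hR.trans ht.1) hs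
  exact ⟨t, ht.1, hts, fun x hx => hd x ⟨hx.1, hx.2.trans_lt ht.2⟩⟩

end

section

variable {c : EReal} {f q : ℝ → ℝ} {b β Hinf : ℝ}

/-- A nonnegative decaying solution on `[R, ∞)`, starting at the critical point `R` with
value `m`. -/
structure Tail (v dv : ℝ → ℝ) (R m : ℝ) (r : ℝ → ℝ) : Prop where
  piece : Piece v dv R 0 m r
  lim : Tendsto (fun s => -dv (r s)) (𝓝[>] 0) (𝓝 0)
  cover : ∀ t, R < t → v t = 0 ∨ (v t ∈ Ioo 0 m ∧ r (v t) = t)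

/-- The part of a solution between the origin and its first critical point `R`, where it takes
the value `-m`. -/
structure Descent (v dv : ℝ → ℝ) (R m α : ℝ) (r : ℝ → ℝ) : Prop where
  piece : Piece v dv 0 (-m) α r
  pos : 0 < R
  bot : v R = -m
  crit : dv R = 0
  rlim : Tendsto r (𝓝[>] (-m)) (𝓝 R)
  plim : Tendsto (fun s => -dv (r s)) (𝓝[>] (-m)) (𝓝 0)
  cover : ∀ t ∈ Ioo 0 R, v t ∈ Ioo (-m) α ∧ r (v t) = t

namespace FlowSol

variable {v dv : ℝ → ℝ} (S : FlowSol c f q v dv) (C : Coeff q Hinf) (N : Nonlin c f b β Hinf)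
  (hv : Tendsto v atTop (𝓝 0))
include S C N hv

/-- If `v` stays nonnegative and decreasing on `[R, ∞)`, then `v'` vanishes at infinity. -/
theorem dv_tendsto {R : ℝ} (hR : 0 ≤ R) (hd : ∀ t, R < t → dv t < 0)
    (hnn : ∀ t, R ≤ t → 0 ≤ v t) : Tendsto dv atTop (𝓝 0) := by
  have hF := F_tendsto N hv
  have hen : Tendsto (en f v dv) atTop (𝓝 0) := by
    refine tendsto_order.2 ⟨fun a ha => ?_, fun ε hε => ?_⟩
    · filter_upwards [eventually_ge_atTop 0] with t ht using ha.trans_le (S.en_nonneg C N hv ht)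
    · have key : ∃ T, 0 ≤ T ∧ en f v dv T < ε := by
        by_contra! hcon
        obtain ⟨T₀, hT₀⟩ := ((hF.eventually (gt_mem_nhds (half_pos hε))).and
          (eventually_gt_atTop R)).exists_forall_of_atTop
        have hRT : R < T₀ := (hT₀ T₀ le_rfl).2
        have hslope : ∀ t, T₀ ≤ t → dv t ≤ -√ε := by
          intro t ht
          have h1 := (hT₀ t ht).1
          have h2 := hcon t (by linarith)
          have h3 := hd t (hRT.trans_le ht)
          unfold en at h2
          have h4 := Real.abs_le_sqrt (x := √ε) (y := dv t ^ 2) (by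
            rw [Real.sq_sqrt hε.le]; linarith)
          rw [Real.sqrt_sq_eq_abs, abs_of_neg h3] at h4
          linarith [le_abs_self (√ε)]
        have hs : 0 < √ε := Real.sqrt_pos.2 hε
        set T₁ := T₀ + (v T₀ / √ε + 1) with hT₁
        have hv0 := hnn T₀ hRT.le
        have hle : T₀ ≤ T₁ := by
          have : 0 ≤ v T₀ / √ε := by positivity
          linarith
        have := le_of_deriv_nonpos (g := fun t => v t + √ε * t) hle
          (ContinuousOn.add (S.cont.mono fun t ht => hR.trans (hRT.le.trans ht.1)) (by fun_prop))
          (fun t ht _ => ⟨dv t + √ε, by linarith [hslope t ht.1.le], by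
            have ht0 : 0 < t := by linarith [ht.1]
            exact ((S.vder t ht0).add ((hasDerivAt_id t).const_mul (√ε))).congr_deriv
              (by rw [mul_one])⟩)
        have h5 := hnn T₁ (hRT.le.trans hle)
        have h6 : √ε * T₁ = √ε * T₀ + v T₀ + √ε := by
          rw [hT₁]; field_simp; ring
        linarith
      obtain ⟨T, hT, hTe⟩ := key
      filter_upwards [eventually_ge_atTop T] with t ht using (S.en_anti C N hT ht).trans_lt hTe
  have h1 : Tendsto (fun t => √(2 * en f v dv t - 2 * Fint f (v t))) atTop (𝓝 0) := by
    have := ((hen.const_mul 2).sub (hF.const_mul 2)).sqrt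
    rw [show √((2 : ℝ) * 0 - 2 * 0) = 0 by norm_num] at this
    exact this
  rw [tendsto_zero_iff_abs_tendsto_zero]
  refine h1.congr fun t => ?_
  simp only [Function.comp]
  rw [← Real.sqrt_sq_eq_abs]
  congr 1
  unfold en; ring

theorem exists_tail {R : ℝ} (hR : 0 ≤ R) (hcrit : dv R = 0) (hpos : 0 < v R)
    (hnn : ∀ t, R ≤ t → 0 ≤ v t) : β < v R ∧ ∃ r, Tail v dv R (v R) r := by
  have hβ : β < v R := by
    have := S.beta_lt_of_dv_eq_zero C N hv hR hpos.ne' hcrit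
    rwa [abs_of_pos hpos] at this
  refine ⟨hβ, ?_⟩
  by_cases h : ∃ t, R < t ∧ 0 ≤ dv t
  · obtain ⟨t, ht, hdt⟩ := h
    obtain ⟨z, hRz, hz, hd, hvz⟩ := S.exists_next_crit C N hR hcrit (N.b_lt.trans hβ) ht hdt
    have hz0 : v z = 0 := by
      by_contra hne
      have := S.beta_lt_of_dv_eq_zero C N hv (hR.trans hRz.le) hne hz
      rw [abs_of_nonneg (hnn z hRz.le)] at this
      linarith [N.b_lt]
    obtain ⟨r, K⟩ := S.exists_piece_to hR hRz hcrit hd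
    rw [hz0] at K
    obtain ⟨hcov, -, hp⟩ := K.r_bot S hRz hz0 hz hd
    refine ⟨r, K, hp, fun t ht => ?_⟩
    rcases lt_trichotomy t z with h | h | h
    · exact Or.inr (hcov t ⟨ht, h⟩)
    · exact Or.inl (h ▸ hz0)
    · refine Or.inl (S.eq_zero_of_en_le C N hv (hR.trans hRz.le) ?_ t h)
      simp [en, hz, hz0, Fint]
  · push Not at h
    have hA : ∀ X, StrictAntiOn v (Icc R X) := fun X => S.strictAnti hR fun t ht => h t ht.1
    have hvpos : ∀ t, R < t → 0 < v t := fun t ht =>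
      (hnn (t + 1) (by linarith)).trans_lt
        (hA (t + 1) ⟨ht.le, by linarith⟩ ⟨by linarith, le_rfl⟩ (by linarith))
    have hvlt : ∀ t, R < t → v t < v R := fun t ht =>
      hA t ⟨le_rfl, ht.le⟩ ⟨ht.le, le_rfl⟩ ht
    obtain ⟨r, K⟩ : ∃ r, Piece v dv R 0 (v R) r := by
      refine exists_piece hR hpos rfl hcrit fun s hs => ?_
      obtain ⟨X, hXs, hX⟩ := ((hv.eventually (gt_mem_nhds hs.1)).and (eventually_gt_atTop R)).exists
      obtain ⟨t, ht, hts⟩ := intermediate_value_Ioo' (le_of_lt hX)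
        (S.cont.mono fun t ht => hR.trans ht.1) ⟨hXs, hs.2⟩
      exact ⟨t, ht.1, hts, fun x hx => h x hx.1⟩
    have hcov : ∀ t, R < t → v t ∈ Ioo 0 (v R) ∧ r (v t) = t := fun t ht =>
      have hm : v t ∈ Ioo 0 (v R) := ⟨hvpos t ht, hvlt t ht⟩
      ⟨hm, K.left_inv S ht hm fun s hs => h s hs.1⟩
    have hr : Tendsto r (𝓝[>] 0) atTop := by
      refine tendsto_atTop.2 fun T => ?_
      have hc := hcov (max T (R + 1)) (lt_of_lt_of_le (by linarith) (le_max_right _ _))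
      filter_upwards [Ioo_mem_nhdsGT hpos, Ioo_mem_nhdsGT hc.1.1] with y hy hyt
      have := K.r_anti S hy hc.1 hyt.2
      rw [hc.2] at this
      exact ((le_max_left _ _).trans_lt this).le
    refine ⟨r, K, ?_, fun t ht => Or.inr (hcov t ht)⟩
    have := ((S.dv_tendsto C N hv hR h hnn).comp hr).neg
    rw [neg_zero] at this
    exact this

/-- The initial descent of a solution with exactly one sign change. -/
theorem exists_descent (hpos : 0 < v 0) {z : ℝ} (hz : 0 < z)
    (hpz : ∀ t, 0 ≤ t → t ≤ z → 0 ≤ v t) (hnz : ∀ t, z ≤ t → v t ≤ 0) {t₀ : ℝ}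
    (ht₀ : z ≤ t₀) (hlt : v t₀ < 0) :
    β < v 0 ∧ ∃ R m r, Descent v dv R m (v 0) r ∧ β < m ∧ ∀ t, R ≤ t → v t ≤ 0 := by
  have hβ : β < v 0 := by
    have := S.beta_lt_of_dv_eq_zero C N hv le_rfl hpos.ne' S.d0
    rwa [abs_of_pos hpos] at this
  refine ⟨hβ, ?_⟩
  have h : ∃ t, 0 < t ∧ 0 ≤ dv t := by
    by_contra! hcon
    have hle : ∀ t, t₀ ≤ t → v t ≤ v t₀ := fun t ht =>
      (S.strictAnti le_rfl (X := t) fun s hs => hcon s hs.1).antitoneOn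
        ⟨(hz.trans_le ht₀).le, ht⟩ ⟨((hz.trans_le ht₀).le).trans ht, le_rfl⟩ ht
    have := le_of_tendsto hv ((eventually_ge_atTop t₀).mono hle)
    linarith
  obtain ⟨t, ht, hdt⟩ := h
  obtain ⟨R, hR, hcR, hd, hvR⟩ := S.exists_next_crit C N le_rfl S.d0 (N.b_lt.trans hβ) ht hdt
  have hne : v R ≠ 0 := by
    intro h0
    have h1 := S.eq_zero_of_en_le C N hv hR.le (by simp [en, hcR, h0, Fint])
    rcases le_or_gt t₀ R with h | h
    · have := (S.strictAnti le_rfl hd).antitoneOn ⟨(hz.trans_le ht₀).le, h⟩ ⟨hR.le, le_rfl⟩ h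
      linarith
    · linarith [h1 t₀ h]
  have hm := S.beta_lt_of_dv_eq_zero C N hv hR.le hne hcR
  have hzR : z < R := by
    by_contra hcon
    rw [abs_of_nonneg (hpz R hR.le (not_lt.1 hcon))] at hm
    linarith [N.b_lt]
  rw [abs_of_nonpos (hnz R hzR.le)] at hm
  obtain ⟨r, K⟩ := S.exists_piece_to le_rfl hR S.d0 hd
  obtain ⟨hcov, hr, hp⟩ := K.r_bot S hR rfl hcR hd
  refine ⟨R, -v R, r, ?_, hm, fun t ht => hnz t (hzR.le.trans ht)⟩
  have e : - -v R = v R := neg_neg _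
  exact ⟨e.symm ▸ K, hR, e.symm, hcR, e.symm ▸ hr, e.symm ▸ hp, e.symm ▸ hcov⟩

end FlowSol

end

section

variable {c : EReal} {f q : ℝ → ℝ} {b β Hinf : ℝ}

theorem deriv_nonneg_of_right {g : ℝ → ℝ} {x y g' : ℝ} (hg : HasDerivAt g g' x) (h0 : g x = 0)
    (hxy : x < y) (hnn : ∀ s ∈ Icc x y, 0 ≤ g s) : 0 ≤ g' := by
  have h1 : Tendsto (slope g x) (𝓝[>] x) (𝓝 g') :=
    (hasDerivAt_iff_tendsto_slope.1 hg).mono_left (nhdsWithin_mono _ fun y hy => ne_of_gt hy)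
  refine ge_of_tendsto h1 ?_
  filter_upwards [Ioo_mem_nhdsGT hxy] with s hs
  rw [slope_def_field, h0, sub_zero]
  exact div_nonneg (hnn s ⟨hs.1.le, hs.2.le⟩) (by linarith [hs.1])

variable {v₁ dv₁ v₂ dv₂ : ℝ → ℝ} (S₁ : FlowSol c f q v₁ dv₁) (S₂ : FlowSol c f q v₂ dv₂)
  (C : Coeff q Hinf) (N : Nonlin c f b β Hinf)
include S₁ S₂ C N

/-- A Sturm type comparison for solutions above the level `b`. -/
theorem sturm_le {A B : ℝ} (hA : 0 ≤ A) (hb : ∀ t ∈ Icc A B, b < v₂ t)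
    (hle : ∀ t ∈ Ioo A B, v₂ t ≤ v₁ t)
    (hZ : q A * dv₂ A * (v₁ A - b) - q A * dv₁ A * (v₂ A - b) ≤ 0) (hB : v₁ B = v₂ B) :
    ∀ t ∈ Icc A B, v₁ t ≤ v₂ t := by
  set Z : ℝ → ℝ := fun t => q t * dv₂ t * (v₁ t - b) - q t * dv₁ t * (v₂ t - b) with hZdef
  have hsub : Icc A B ⊆ Ici 0 := fun t ht => hA.trans ht.1
  have hZc : ContinuousOn Z (Ici 0) :=
    ((S₂.qdv_cont C).mul (S₁.cont.sub continuousOn_const)).sub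
      ((S₁.qdv_cont C).mul (S₂.cont.sub continuousOn_const))
  have hZle : ∀ t ∈ Icc A B, Z t ≤ 0 := by
    intro t ht
    refine le_trans (le_of_deriv_nonpos ht.1
      (hZc.mono fun s hs => hA.trans hs.1) fun s hs _ => ?_) hZ
    have hs0 : 0 < s := hA.trans_lt hs.1
    have hsm : s ∈ Ioo A B := ⟨hs.1, hs.2.trans_le ht.2⟩
    refine ⟨-(q s * (f (v₂ s) * (v₁ s - b) - f (v₁ s) * (v₂ s - b))), ?_,
      ((((S₂.qdv_der C hs0).mul ((S₁.vder s hs0).sub_const b)).sub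
        ((S₁.qdv_der C hs0).mul ((S₂.vder s hs0).sub_const b)))).congr_deriv (by ring)⟩
    have h1 := N.ratio (v₂ s) (v₁ s) (hb s ⟨hsm.1.le, hsm.2.le⟩) (hle s hsm) (S₁.mem s hs0.le)
    have := mul_nonneg (C.pos s hs0).le (sub_nonneg.2 h1)
    linarith
  intro t ht
  have hw : ∀ s ∈ Icc t B, v₂ s - b ≠ 0 := fun s hs =>
    (sub_pos.2 (hb s ⟨ht.1.trans hs.1, hs.2⟩)).ne'
  have := le_of_deriv_nonneg (g := fun s => (v₁ s - b) / (v₂ s - b)) ht.2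
    (((S₁.cont.sub continuousOn_const).mono fun s hs => hsub ⟨ht.1.trans hs.1, hs.2⟩).div
      ((S₂.cont.sub continuousOn_const).mono fun s hs => hsub ⟨ht.1.trans hs.1, hs.2⟩) hw)
    (fun s hs _ => by
      have hs0 : 0 < s := (hA.trans ht.1).trans_lt hs.1
      refine ⟨_, ?_, ((S₁.vder s hs0).sub_const b).div ((S₂.vder s hs0).sub_const b)
        (hw s ⟨hs.1.le, hs.2.le⟩)⟩
      have h1 := hZle s ⟨ht.1.trans hs.1.le, hs.2.le⟩
      have h2 : q s * (dv₁ s * (v₂ s - b) - (v₁ s - b) * dv₂ s) = -Z s := by rw [hZdef]; ring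
      have h3 : 0 ≤ dv₁ s * (v₂ s - b) - (v₁ s - b) * dv₂ s :=
        nonneg_of_mul_nonneg_right (h2 ▸ neg_nonneg.2 h1) (C.pos s hs0)
      exact div_nonneg h3 (sq_nonneg _))
  simp only [hB] at this
  rw [div_self (hw B ⟨ht.2, le_rfl⟩), div_le_one (sub_pos.2 (hb t ht))] at this
  linarith

variable {R₁ R₂ lo₁ lo₂ m₁ m₂ : ℝ} {r₁ r₂ : ℝ → ℝ} (K₁ : Piece v₁ dv₁ R₁ lo₁ m₁ r₁)
  (K₂ : Piece v₂ dv₂ R₂ lo₂ m₂ r₂) (hlo₁ : lo₁ ≤ b) (hlo₂ : lo₂ ≤ b) (hm : m₁ < m₂)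
include K₁ K₂ hlo₁ hlo₂ hm

theorem no_crossing_up {s' σ : ℝ} (hs' : b < s') (hsσ : s' ≤ σ) (hσ : σ < m₁)
    (hlt : r₂ σ < r₁ σ) : r₂ s' < r₁ s' := by
  by_contra hcon
  have hI₁ : ∀ s ∈ Icc s' σ, s ∈ Ioo lo₁ m₁ := fun s hs =>
    ⟨by linarith [hs.1], by linarith [hs.2]⟩
  have hI₂ : ∀ s ∈ Icc s' σ, s ∈ Ioo lo₂ m₂ := fun s hs =>
    ⟨by linarith [hs.1], by linarith [hs.2]⟩
  obtain ⟨z, hz, hz0, hzp⟩ := exists_last_zero (g := fun s => r₁ s - r₂ s) (t := s')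
    (fun s hs => ((K₁.r_cont S₁ (hI₁ s hs)).sub (K₂.r_cont S₂ (hI₂ s hs))).continuousWithinAt)
    ⟨le_rfl, hsσ⟩ (sub_nonpos.2 (not_lt.1 hcon)) (sub_pos.2 hlt)
  have hzm : z ∈ Icc s' σ := ⟨hz.1, hz.2.le⟩
  have hσm : σ ∈ Icc s' σ := ⟨hsσ, le_rfl⟩
  have hrz : r₂ z = r₁ z := by linarith
  have hρB : r₁ σ < r₁ z := K₁.r_anti S₁ (hI₁ z hzm) (hI₁ σ hσm) hz.2
  have hR₁ : R₁ < r₁ σ := K₁.gt σ (hI₁ σ hσm)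
  have hR₂ : R₂ < r₁ σ := (K₂.gt σ (hI₂ σ hσm)).trans hlt
  have hv₁z := K₁.val z (hI₁ z hzm)
  have hv₂z := K₂.val z (hI₂ z hzm)
  rw [hrz] at hv₂z
  have hanti₁ := K₁.anti S₁ (hI₁ z hzm)
  have hanti₂ := K₂.anti S₂ (hI₂ z hzm)
  rw [hrz] at hanti₂
  have hb₂ : ∀ t, R₂ ≤ t → t ≤ r₁ z → b < v₂ t := fun t h1 h2 => by
    have := hanti₂.antitoneOn ⟨h1, h2⟩ ⟨h1.trans h2, le_rfl⟩ h2
    rw [hv₂z] at this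
    linarith [hz.1]
  have hb₁ : ∀ t, R₁ ≤ t → t ≤ r₁ z → b < v₁ t := fun t h1 h2 => by
    have := hanti₁.antitoneOn ⟨h1, h2⟩ ⟨h1.trans h2, le_rfl⟩ h2
    rw [hv₁z] at this
    linarith [hz.1]
  have hgt : ∀ t, r₁ σ ≤ t → t < r₁ z → v₂ t < v₁ t := by
    intro t h1 h2
    have htm : t ∈ Ioo R₁ (r₁ z) := ⟨hR₁.trans_le h1, h2⟩
    have hm1 := K₁.val_mem S₁ (hI₁ z hzm) htm
    have hle : v₁ t ≤ σ := by
      have := hanti₁.antitoneOn ⟨hR₁.le, hρB.le⟩ ⟨htm.1.le, h2.le⟩ h1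
      rwa [K₁.val σ (hI₁ σ hσm)] at this
    have hmem : v₁ t ∈ Icc s' σ := ⟨hz.1.trans hm1.1.le, hle⟩
    have hr := hzp (v₁ t) ⟨hm1.1, hle⟩
    have hinv := K₁.left_inv' S₁ (hI₁ z hzm) htm
    rw [hinv] at hr
    have hr2 := K₂.gt _ (hI₂ _ hmem)
    have := hanti₂ ⟨hr2.le, by linarith⟩ ⟨by linarith, h2.le⟩ (by linarith : r₂ (v₁ t) < t)
    rwa [K₂.val _ (hI₂ _ hmem)] at this
  have fin : ∀ A, 0 ≤ A → R₁ ≤ A → R₂ ≤ A → A ≤ r₁ σ →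
      (∀ t ∈ Icc A (r₁ σ), v₂ t ≤ v₁ t) →
      q A * dv₂ A * (v₁ A - b) - q A * dv₁ A * (v₂ A - b) ≤ 0 → False := by
    intro A hA h1 h2 h3 h4 h5
    have := sturm_le S₁ S₂ C N hA (fun t ht => hb₂ t (h2.trans ht.1) ht.2)
      (fun t ht => (le_total t (r₁ σ)).elim (fun h => h4 t ⟨ht.1.le, h⟩)
        (fun h => (hgt t h ht.2).le)) h5 (hv₁z.trans hv₂z.symm) (r₁ σ) ⟨h3, hρB.le⟩
    exact absurd this (not_le.2 (hgt _ le_rfl hρB))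
  by_cases hex : ∃ t ∈ Icc (max R₁ R₂) (r₁ σ), v₁ t < v₂ t
  · obtain ⟨t, ht, hvt⟩ := hex
    have hA0 : 0 ≤ max R₁ R₂ := K₁.nonneg.trans (le_max_left _ _)
    obtain ⟨A, hA, hA0', hAp⟩ := exists_last_crossing (g := fun t => v₁ t - v₂ t)
      ((S₁.cont.sub S₂.cont).mono fun t ht => hA0.trans ht.1) ht (sub_neg.2 hvt)
      (sub_nonneg.2 (hgt _ le_rfl hρB).le)
    have hMA := ht.1.trans hA.1
    have hAρ : A < r₁ σ := lt_of_le_of_ne hA.2 fun h => by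
      have := hgt _ le_rfl hρB
      rw [← h] at this
      linarith
    have hR₂A : R₂ ≤ A := (le_max_right _ _).trans hMA
    refine fin A (hA0.trans hMA) ((le_max_left _ _).trans hMA) hR₂A hA.2
      (fun t ht => sub_nonneg.1 (hAp t ht)) ?_
    rcases (hA0.trans hMA).eq_or_lt with h | h
    · rw [← h, C.zero]; simp
    · have hd := deriv_nonneg_of_right ((S₁.vder A h).sub (S₂.vder A h)) hA0' hAρ hAp
      have hv : v₁ A = v₂ A := by linarith
      have h1 := mul_nonneg (mul_nonneg (C.pos A h).le
        (sub_pos.2 (hb₂ A hR₂A (hAρ.trans hρB).le)).le) hd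
      rw [hv]
      linarith
  · push Not at hex
    have hR : R₂ ≤ R₁ := by
      by_contra! h
      have h1 := hex R₂ ⟨max_le h.le le_rfl, hR₂.le⟩
      rw [K₂.top] at h1
      have h2 := hanti₁ ⟨le_rfl, (hR₁.trans hρB).le⟩ ⟨h.le, (hR₂.trans hρB).le⟩ h
      rw [K₁.top] at h2
      linarith
    rw [max_eq_left hR] at hex
    refine fin R₁ K₁.nonneg le_rfl hR hR₁.le hex ?_
    have hd : dv₂ R₁ ≤ 0 := by
      rcases hR.eq_or_lt with h | h
      · rw [← h, K₂.crit]
      · exact (K₂.neg z (hI₂ z hzm) R₁ ⟨h, hrz ▸ (hR₁.trans hρB).le⟩).le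
    have hq : 0 ≤ q R₁ := by
      rcases K₁.nonneg.eq_or_lt with h | h
      · rw [← h, C.zero]
      · exact (C.pos R₁ h).le
    rw [K₁.crit]
    have := mul_nonneg (mul_nonneg hq (neg_nonneg.2 hd))
      (sub_pos.2 (hb₁ R₁ le_rfl (hR₁.trans hρB).le)).le
    linarith

omit K₁ K₂ in
theorem first_order (K₁ : Piece v₁ dv₁ 0 lo₁ m₁ r₁) (K₂ : Piece v₂ dv₂ 0 lo₂ m₂ r₂) {σ : ℝ}
    (hσb : b < σ) (hσ : σ < m₁) : r₁ σ ≤ r₂ σ := by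
  by_contra! hlt
  have h₁ : σ ∈ Ioo lo₁ m₁ := ⟨by linarith, hσ⟩
  have h₂ : σ ∈ Ioo lo₂ m₂ := ⟨by linarith, by linarith⟩
  have hg := K₂.gt σ h₂
  have hv := (K₁.val_mem S₁ h₁ ⟨hg, hlt⟩).1
  obtain ⟨B, hB, hB0, hBp⟩ := exists_first_zero (g := fun t => v₂ t - v₁ t) (x := 0) (y := r₂ σ)
    (t := r₂ σ) ((S₂.cont.sub S₁.cont).mono fun t ht => ht.1) ⟨hg.le, le_rfl⟩
    (by simp only [K₂.val σ h₂]; linarith) (by simp only [K₁.top, K₂.top]; linarith)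
  have hBr : B < r₁ σ := hB.2.trans_lt hlt
  have := sturm_le S₂ S₁ C N le_rfl (fun t ht => by
      have := (K₁.anti S₁ h₁).antitoneOn ⟨ht.1, ht.2.trans hBr.le⟩ ⟨hg.le.trans hlt.le, le_rfl⟩
        (ht.2.trans hBr.le)
      rw [K₁.val σ h₁] at this
      linarith) (fun t ht => by linarith [hBp t ⟨ht.1.le, ht.2⟩]) (by rw [C.zero]; simp)
    (by linarith) 0 ⟨le_rfl, hB.1.le⟩
  rw [K₁.top, K₂.top] at this
  linarith

end

section

variable {c : EReal} {f q : ℝ → ℝ} {b β Hinf : ℝ}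

theorem abs_le_of_abs_deriv_le {g g' : ℝ → ℝ} {x y K : ℝ} (hxy : x ≤ y)
    (hc : ContinuousOn g (Icc x y)) (hd : ∀ s ∈ Ioo x y, HasDerivAt g (g' s) s)
    (hK : ∀ s ∈ Ioo x y, |g' s| ≤ K) (h0 : g x = 0) : |g y| ≤ K * (y - x) := by
  have hlin : ∀ s : ℝ, HasDerivAt (fun s => K * s) K s := fun s => by
    simpa using (hasDerivAt_id s).const_mul K
  have h1 := le_of_deriv_nonneg (g := fun s => K * s - g s) hxy
    (ContinuousOn.sub (by fun_prop) hc) (fun s hs _ =>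
      ⟨_, sub_nonneg.2 (le_of_abs_le (hK s hs)), (hlin s).sub (hd s hs)⟩)
  have h2 := le_of_deriv_nonneg (g := fun s => K * s + g s) hxy
    (ContinuousOn.add (by fun_prop) hc) (fun s hs _ =>
      ⟨_, by linarith [neg_le_of_abs_le (hK s hs)], (hlin s).add (hd s hs)⟩)
  rw [abs_le]
  constructor <;> linarith

variable {v₁ dv₁ v₂ dv₂ : ℝ → ℝ} (S₁ : FlowSol c f q v₁ dv₁) (S₂ : FlowSol c f q v₂ dv₂)
  (C : Coeff q Hinf) (N : Nonlin c f b β Hinf)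
include S₁ S₂ C N

theorem local_unique {R α : ℝ} (hR : 0 ≤ R) (h₁ : v₁ R = α) (h₂ : v₂ R = α) (hd₁ : dv₁ R = 0)
    (hd₂ : dv₂ R = 0) (hα : β < α) : ∃ ε > 0, ∀ t ∈ Icc R (R + ε), v₁ t = v₂ t := by
  have near : ∀ {v dv : ℝ → ℝ}, FlowSol c f q v dv → v R = α → dv R = 0 →
      ∃ ε > 0, ∀ t ∈ Icc R (R + ε), v t ∈ Icc β α := by
    intro v dv S h hd
    obtain ⟨ε, hε, hn⟩ := S.dv_neg_near C N hR hd (by rw [h]; exact N.b_lt.trans hα)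
    have hA := S.strictAnti hR (X := R + ε) fun t ht => hn t ⟨ht.1, ht.2.le⟩
    have h1 : ∀ᶠ t in 𝓝[≥] R, β < v t :=
      ((S.cont R hR).mono (Ici_subset_Ici.2 hR)).eventually (lt_mem_nhds (h ▸ hα))
    obtain ⟨y, hy, hsub⟩ := mem_nhdsGE_iff_exists_Ico_subset.1 h1
    have hy' : R < y := hy
    refine ⟨min ε ((y - R) / 2), lt_min hε (by linarith), fun t ht => ?_⟩
    have := min_le_left ε ((y - R) / 2)
    have := min_le_right ε ((y - R) / 2)
    have ht1 : t ≤ R + ε := by linarith [ht.2]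
    have ht2 : t < y := by linarith [ht.2]
    refine ⟨(hsub ⟨ht.1, ht2⟩ : β < v t).le, ?_⟩
    have := hA.antitoneOn ⟨le_rfl, ht.1.trans ht1⟩ ⟨ht.1, ht1⟩ ht.1
    rwa [h] at this
  obtain ⟨ε₁, hε₁, hn₁⟩ := near S₁ h₁ hd₁
  obtain ⟨ε₂, hε₂, hn₂⟩ := near S₂ h₂ hd₂
  obtain ⟨L, hL, hlip⟩ := N.lip β α (N.b_pos.trans N.b_lt) (h₁ ▸ S₁.mem R hR)
  set δ := min (min ε₁ ε₂) (min 1 (1 / (2 * L))) with hδ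
  have hδ0 : 0 < δ := by positivity
  have hδ₁ : δ ≤ ε₁ := (min_le_left _ _).trans (min_le_left _ _)
  have hδ₂ : δ ≤ ε₂ := (min_le_left _ _).trans (min_le_right _ _)
  have hδ1 : δ ≤ 1 := (min_le_right _ _).trans (min_le_left _ _)
  have hδL : L * δ ≤ 1 / 2 := by
    have : δ ≤ 1 / (2 * L) := (min_le_right _ _).trans (min_le_right _ _)
    rw [le_div_iff₀ (by positivity)] at this
    linarith
  have hcw : ContinuousOn (fun t => v₁ t - v₂ t) (Ici 0) := S₁.cont.sub S₂.cont
  have hsub : Icc R (R + δ) ⊆ Ici 0 := fun t ht => hR.trans ht.1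
  obtain ⟨t₀, ht₀, hmax⟩ := isCompact_Icc.exists_isMaxOn
    (nonempty_Icc.2 (by linarith : R ≤ R + δ)) (hcw.mono hsub).abs
  set M := |v₁ t₀ - v₂ t₀| with hM
  have hM0 : 0 ≤ M := abs_nonneg _
  have hMle : ∀ t ∈ Icc R (R + δ), |v₁ t - v₂ t| ≤ M := fun t ht => hmax ht
  have hdw : ∀ t ∈ Ioo R (R + δ), |dv₁ t - dv₂ t| ≤ M / 2 := by
    intro t ht
    have ht0 := hR.trans_lt ht.1
    have hq := C.pos t ht0
    have := abs_le_of_abs_deriv_le (g := fun s => q s * dv₁ s - q s * dv₂ s)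
      (g' := fun s => -(q s * f (v₁ s)) - -(q s * f (v₂ s))) (K := q t * (L * M)) ht.1.le
      (((S₁.qdv_cont C).sub (S₂.qdv_cont C)).mono fun s hs => hR.trans hs.1)
      (fun s hs => (S₁.qdv_der C (hR.trans_lt hs.1)).sub (S₂.qdv_der C (hR.trans_lt hs.1)))
      (fun s hs => by
        have hs0 := hR.trans_lt hs.1
        have hsm : s ∈ Icc R (R + δ) := ⟨hs.1.le, by linarith [hs.2, ht.2]⟩
        rw [show -(q s * f (v₁ s)) - -(q s * f (v₂ s)) = -(q s * (f (v₁ s) - f (v₂ s))) by ring,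
          abs_neg, abs_mul, abs_of_pos (C.pos s hs0)]
        have h1 := hlip (v₁ s) (hn₁ s ⟨hsm.1, by linarith [hsm.2]⟩) (v₂ s)
          (hn₂ s ⟨hsm.1, by linarith [hsm.2]⟩)
        have h2 := mul_le_mul_of_nonneg_left (hMle s hsm) hL.le
        exact mul_le_mul (C.mono s t hs0.le hs.2.le) (h1.trans h2) (abs_nonneg _) hq.le)
      (by simp [hd₁, hd₂])
    rw [← mul_sub, abs_mul, abs_of_pos hq, mul_assoc] at this
    have := le_of_mul_le_mul_left this hq
    have h3 : L * M * (t - R) ≤ L * M * δ := by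
      have : t - R ≤ δ := by linarith [ht.2]
      gcongr
    have h4 := mul_le_mul_of_nonneg_right hδL hM0
    linarith
  have hfin := abs_le_of_abs_deriv_le (g := fun s => v₁ s - v₂ s) (g' := fun s => dv₁ s - dv₂ s)
    (K := M / 2) ht₀.1 (hcw.mono fun s hs => hR.trans hs.1)
    (fun s hs => (S₁.vder s (hR.trans_lt hs.1)).sub (S₂.vder s (hR.trans_lt hs.1)))
    (fun s hs => hdw s ⟨hs.1, hs.2.trans_le ht₀.2⟩) (by simp [h₁, h₂])
  have hMz : M ≤ M / 2 := by
    have h5 : M / 2 * (t₀ - R) ≤ M / 2 * 1 := by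
      have : t₀ - R ≤ 1 := by linarith [ht₀.2]
      gcongr
    rw [← hM] at hfin
    linarith
  refine ⟨δ, hδ0, fun t ht => ?_⟩
  have := hMle t ht
  have h6 : |v₁ t - v₂ t| ≤ 0 := by linarith
  exact sub_eq_zero.1 (abs_nonpos_iff.1 h6)

variable (hv₁ : Tendsto v₁ atTop (𝓝 0)) (hv₂ : Tendsto v₂ atTop (𝓝 0))
include hv₁ hv₂

theorem piece_unique {R lo₁ lo₂ hi : ℝ} {r₁ r₂ : ℝ → ℝ} (K₁ : Piece v₁ dv₁ R lo₁ hi r₁)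
    (K₂ : Piece v₂ dv₂ R lo₂ hi r₂) (hβ : β < hi) {s : ℝ} (hs₁ : lo₁ < s) (hs₂ : lo₂ < s)
    (hs : s < hi) : r₁ s = r₂ s ∧ dv₁ (r₁ s) = dv₂ (r₂ s) := by
  have m₁ : s ∈ Ioo lo₁ hi := ⟨hs₁, hs⟩
  have m₂ : s ∈ Ioo lo₂ hi := ⟨hs₂, hs⟩
  obtain ⟨ε, hε, heq⟩ := local_unique S₁ S₂ C N K₁.nonneg K₁.top K₂.top K₁.crit K₂.crit hβ
  obtain ⟨t, ht1, ht2⟩ := exists_between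
    (lt_min (lt_min (K₁.gt s m₁) (K₂.gt s m₂)) (by linarith : R < R + ε))
  have ht₁ : t ∈ Ioo R (r₁ s) := ⟨ht1, ht2.trans_le ((min_le_left _ _).trans (min_le_left _ _))⟩
  have ht₂ : t ∈ Ioo R (r₂ s) := ⟨ht1, ht2.trans_le ((min_le_left _ _).trans (min_le_right _ _))⟩
  have htε : t ∈ Ioo R (R + ε) := ⟨ht1, ht2.trans_le (min_le_right _ _)⟩
  have hv : v₁ t = v₂ t := heq t ⟨htε.1.le, htε.2.le⟩
  have ht0 : 0 < t := K₁.nonneg.trans_lt ht1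
  have hdv : dv₁ t = dv₂ t := by
    refine ((S₁.vder t ht0).congr_of_eventuallyEq ?_).unique (S₂.vder t ht0)
    filter_upwards [Ioo_mem_nhds htε.1 htε.2] with x hx using (heq x ⟨hx.1.le, hx.2.le⟩).symm
  have hm := K₁.val_mem S₁ m₁ ht₁
  have hi₁ := K₁.left_inv' S₁ m₁ ht₁
  have hi₂ := K₂.left_inv' S₂ m₂ ht₂
  rw [← hv] at hi₂
  have := (branch_unique C N (K₁.branch S₁ C N hv₁) (K₂.branch S₂ C N hv₂) hm.1.le
    (fun x hx => ⟨hs₁.trans_le hx.1, hx.2.trans_lt hm.2⟩)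
    (fun x hx => ⟨hs₂.trans_le hx.1, hx.2.trans_lt hm.2⟩)).2
    ⟨hi₁.trans hi₂.symm, by simp only [hi₁, hi₂, hdv]⟩
  exact ⟨this.1, neg_injective this.2⟩

theorem tail_unique {R m : ℝ} {r₁ r₂ : ℝ → ℝ} (T₁ : Tail v₁ dv₁ R m r₁)
    (T₂ : Tail v₂ dv₂ R m r₂) (hβ : β < m) {t : ℝ} (ht : R ≤ t) : v₁ t = v₂ t := by
  have key : ∀ s ∈ Ioo 0 m, r₁ s = r₂ s := fun s hs =>
    (piece_unique S₁ S₂ C N hv₁ hv₂ T₁.piece T₂.piece hβ hs.1 hs.1 hs.2).1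
  rcases ht.eq_or_lt with h | h
  · rw [← h, T₁.piece.top, T₂.piece.top]
  · rcases T₁.cover t h with h₁ | ⟨hm₁, h₁⟩
    · rcases T₂.cover t h with h₂ | ⟨hm₂, h₂⟩
      · rw [h₁, h₂]
      · have := T₁.piece.val _ hm₂
        rwa [key _ hm₂, h₂] at this
    · have := T₂.piece.val _ hm₁
      rw [← key _ hm₁, h₁] at this
      exact this.symm

omit hv₁ hv₂ in
theorem descent_m_not_lt {R₁ R₂ m₁ m₂ α : ℝ} {r₁ r₂ : ℝ → ℝ}
    (hv₁ : Tendsto v₁ atTop (𝓝 0)) (hv₂ : Tendsto v₂ atTop (𝓝 0))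
    (D₁ : Descent v₁ dv₁ R₁ m₁ α r₁) (D₂ : Descent v₂ dv₂ R₂ m₂ α r₂) (hβ : β < α) :
    m₂ ≤ m₁ := by
  by_contra! hlt
  have hm : -m₁ ∈ Ioo (-m₂) α := ⟨neg_lt_neg hlt, D₁.piece.lt⟩
  have hB₂ := D₂.piece.branch S₂ C N hv₂
  have h1 : Tendsto (fun s => -dv₂ (r₂ s)) (𝓝[>] (-m₁)) (𝓝 (-dv₂ (r₂ (-m₁)))) :=
    (hB₂.pcont hm).tendsto.mono_left nhdsWithin_le_nhds
  have h2 : Tendsto (fun s => -dv₂ (r₂ s)) (𝓝[>] (-m₁)) (𝓝 0) := by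
    refine D₁.plim.congr' ?_
    filter_upwards [Ioo_mem_nhdsGT hm.2] with s hs
    rw [(piece_unique S₁ S₂ C N hv₁ hv₂ D₁.piece D₂.piece hβ hs.1 (hm.1.trans hs.1) hs.2).2]
  exact (hB₂.ppos _ hm).ne' (tendsto_nhds_unique h1 h2)

theorem descent_unique {R₁ R₂ m₁ m₂ α : ℝ} {r₁ r₂ : ℝ → ℝ}
    (D₁ : Descent v₁ dv₁ R₁ m₁ α r₁) (D₂ : Descent v₂ dv₂ R₂ m₂ α r₂) (hβ : β < α) :
    m₁ = m₂ ∧ R₁ = R₂ ∧ ∀ t, 0 ≤ t → t ≤ R₁ → v₁ t = v₂ t := by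
  have hm : m₁ = m₂ := le_antisymm (descent_m_not_lt S₂ S₁ C N hv₂ hv₁ D₂ D₁ hβ)
    (descent_m_not_lt S₁ S₂ C N hv₁ hv₂ D₁ D₂ hβ)
  subst hm
  have key : ∀ s ∈ Ioo (-m₁) α, r₁ s = r₂ s := fun s hs =>
    (piece_unique S₁ S₂ C N hv₁ hv₂ D₁.piece D₂.piece hβ hs.1 hs.1 hs.2).1
  have hR : R₁ = R₂ := by
    refine tendsto_nhds_unique D₁.rlim (D₂.rlim.congr' ?_)
    filter_upwards [Ioo_mem_nhdsGT D₁.piece.lt] with s hs using (key s hs).symm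
  subst hR
  refine ⟨rfl, rfl, fun t h0 ht => ?_⟩
  rcases h0.eq_or_lt with h | h
  · rw [← h, D₁.piece.top, D₂.piece.top]
  rcases ht.eq_or_lt with h' | h'
  · rw [h', D₁.bot, D₂.bot]
  · obtain ⟨hm, hr⟩ := D₁.cover t ⟨h, h'⟩
    have := D₂.piece.val _ hm
    rw [← key _ hm, hr] at this
    exact this.symm

end

section

variable {c : EReal} {f q : ℝ → ℝ} {b β Hinf : ℝ}

theorem tail_tail_compare {v₁ dv₁ v₂ dv₂ : ℝ → ℝ} (S₁ : FlowSol c f q v₁ dv₁)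
    (S₂ : FlowSol c f q v₂ dv₂) (C : Coeff q Hinf) (N : Nonlin c f b β Hinf)
    (hv₁ : Tendsto v₁ atTop (𝓝 0)) (hv₂ : Tendsto v₂ atTop (𝓝 0)) {R₁ R₂ m₁ m₂ : ℝ}
    {r₁ r₂ : ℝ → ℝ} (T₁ : Tail v₁ dv₁ R₁ m₁ r₁) (T₂ : Tail v₂ dv₂ R₂ m₂ r₂) (hβ : β < m₁)
    (hm : m₁ < m₂) :
    (∀ s, 0 < s → s ≤ β → r₂ s < r₁ s) ∧
      (∀ s, 0 < s → s < m₁ → -dv₁ (r₁ s) ≤ -dv₂ (r₂ s)) :=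
  tail_compare C N (T₁.piece.branch S₁ C N hv₁) (T₂.piece.branch S₂ C N hv₂) hβ hm T₁.lim T₂.lim
    (T₁.piece.p_top S₁) fun _ _ h1 h2 h3 h4 =>
      no_crossing_up S₁ S₂ C N T₁.piece T₂.piece N.b_pos.le N.b_pos.le hm h1 h2 h3 h4

/-- The data attached to a bound state with exactly one sign change. -/
structure TwoNode (c : EReal) (f q : ℝ → ℝ) (β : ℝ) (v dv : ℝ → ℝ) (R m : ℝ) (ρ r : ℝ → ℝ) :
    Prop where
  flow : FlowSol c f q v dv
  lim : Tendsto v atTop (𝓝 0)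
  top : β < v 0
  bot : β < m
  descent : Descent v dv R m (v 0) ρ
  tail : Tail (fun t => -v t) (fun t => -dv t) R m r

theorem exists_twoNode (C : Coeff q Hinf) (N : Nonlin c f b β Hinf) {u : ℝ → ℝ}
    (hu : IsSolutionE c f q u) (hpos : 0 < u 0) (hlim : Tendsto u atTop (𝓝 0))
    (hs : ExactSignChanges u 1) :
    ∃ R m ρ r, TwoNode c f q β u (derivWithin u (Ici 0)) R m ρ r := by
  obtain ⟨z, hz0, hzlt, hz⟩ := hs
  have S := flow_of_solution C N hu
  have h01 := hzlt 0 one_pos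
  have h0 := (hz 0 zero_le_one).1
  obtain ⟨h1, t₀, ht₀, hne⟩ := hz 1 le_rfl
  simp only [zero_add, zero_lt_one, if_true, pow_zero, one_mul, hz0, lt_irrefl, if_false, pow_one,
    neg_mul] at h0 h1 ht₀ h01
  have hnp : ∀ t, z 1 ≤ t → u t ≤ 0 := fun t ht => by linarith [h1 t ht]
  have hlt : u t₀ < 0 := lt_of_le_of_ne (hnp t₀ ht₀) fun h => hne (by rw [h, mul_zero])
  obtain ⟨hβ, R, m, ρ, D, hm, hneg⟩ :=
    S.exists_descent C N hlim hpos h01 (fun t h h' => h0 t ⟨h, h'⟩) hnp ht₀ hlt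
  have hlim' : Tendsto (fun t => -u t) atTop (𝓝 0) := by simpa using hlim.neg
  obtain ⟨-, r, T⟩ := (S.neg N).exists_tail C N hlim' D.pos.le (by simp [D.crit])
    (by rw [D.bot, neg_neg]; linarith [N.b_pos, N.b_lt])
    (fun t ht => neg_nonneg.2 (hneg t ht))
  rw [D.bot, neg_neg] at T
  exact ⟨R, m, ρ, r, S, hlim, hβ, hm, D, T⟩

theorem TwoNode.top_not_lt (C : Coeff q Hinf) (N : Nonlin c f b β Hinf)
    {v₁ dv₁ v₂ dv₂ ρ₁ ρ₂ r₁ r₂ : ℝ → ℝ} {R₁ R₂ m₁ m₂ : ℝ}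
    (U₁ : TwoNode c f q β v₁ dv₁ R₁ m₁ ρ₁ r₁) (U₂ : TwoNode c f q β v₂ dv₂ R₂ m₂ ρ₂ r₂) :
    v₂ 0 ≤ v₁ 0 := by
  by_contra! hα
  have D₁ := U₁.descent
  have D₂ := U₂.descent
  have S₁ := U₁.flow
  have S₂ := U₂.flow
  have A₁ := D₁.piece.branch S₁ C N U₁.lim
  have A₂ := D₂.piece.branch S₂ C N U₂.lim
  have hb := N.b_pos
  have hbβ := N.b_lt
  have hm₁ := U₁.bot
  have hm₂ := U₂.bot
  obtain ⟨hp, hy, hP⟩ := first_compare C N A₁ A₂ hm₁ hm₂ U₁.top hα (D₁.piece.p_top S₁)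
    fun s h1 h2 => first_order S₁ S₂ C N (by linarith) (by linarith) hα D₁.piece D₂.piece h1 h2
  have hm := first_min_lt C N A₁ A₂ D₁.pos D₂.pos hm₁ hm₂ U₁.top U₂.top hp hy
    D₁.plim D₂.plim D₁.rlim D₂.rlim
  have hl₁ : Tendsto (fun t => -v₁ t) atTop (𝓝 0) := by simpa using U₁.lim.neg
  have hl₂ : Tendsto (fun t => -v₂ t) atTop (𝓝 0) := by simpa using U₂.lim.neg
  have T₁ := U₁.tail
  have T₂ := U₂.tail
  obtain ⟨hr, hpp⟩ := tail_tail_compare (S₁.neg N) (S₂.neg N) C N hl₁ hl₂ T₁ T₂ hm₁ hm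
  have I₁ := (S₁.neg N).mem R₁ D₁.pos.le
  have I₂ := (S₂.neg N).mem R₂ D₂.pos.le
  simp only [D₁.bot, D₂.bot, neg_neg] at I₁ I₂
  have top₁ := T₁.piece.p_top (S₁.neg N)
  have top₂ := T₂.piece.p_top (S₂.neg N)
  exact loop_contradiction C N A₁ A₂ (T₁.piece.branch (S₁.neg N) C N hl₁)
    (T₂.piece.branch (S₂.neg N) C N hl₂) I₁ I₂ D₁.pos D₂.pos U₁.top U₂.top hm₁ hm D₁.rlim D₁.plim
    D₂.rlim D₂.plim (T₁.piece.r_top (S₁.neg N)) top₁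
    (T₂.piece.r_top (S₂.neg N)) top₂ T₂.lim
    (fun s h1 h2 => first_compare_below C N A₁ A₂ U₁.top U₂.top hp hy h2 h1 (by linarith)) hP hr hpp

theorem TwoNode.unique (C : Coeff q Hinf) (N : Nonlin c f b β Hinf)
    {v₁ dv₁ v₂ dv₂ ρ₁ ρ₂ r₁ r₂ : ℝ → ℝ} {R₁ R₂ m₁ m₂ : ℝ}
    (U₁ : TwoNode c f q β v₁ dv₁ R₁ m₁ ρ₁ r₁) (U₂ : TwoNode c f q β v₂ dv₂ R₂ m₂ ρ₂ r₂) {t : ℝ}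
    (ht : 0 ≤ t) : v₁ t = v₂ t := by
  have h0 : v₁ 0 = v₂ 0 := le_antisymm (U₂.top_not_lt C N U₁) (U₁.top_not_lt C N U₂)
  have D₂ := U₂.descent
  rw [← h0] at D₂
  obtain ⟨rfl, rfl, h⟩ :=
    descent_unique U₁.flow U₂.flow C N U₁.lim U₂.lim U₁.descent D₂ U₁.top
  rcases le_total t R₁ with h1 | h1
  · exact h t ht h1
  · have hl₁ : Tendsto (fun t => -v₁ t) atTop (𝓝 0) := by simpa using U₁.lim.neg
    have hl₂ : Tendsto (fun t => -v₂ t) atTop (𝓝 0) := by simpa using U₂.lim.neg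
    exact neg_injective (tail_unique (U₁.flow.neg N) (U₂.flow.neg N) C N hl₁ hl₂ U₁.tail U₂.tail
      U₁.bot h1)

theorem ground_top_not_lt {v₁ dv₁ v₂ dv₂ : ℝ → ℝ} (S₁ : FlowSol c f q v₁ dv₁)
    (S₂ : FlowSol c f q v₂ dv₂) (C : Coeff q Hinf) (N : Nonlin c f b β Hinf)
    (hv₁ : Tendsto v₁ atTop (𝓝 0)) (hv₂ : Tendsto v₂ atTop (𝓝 0)) {m₁ m₂ : ℝ}
    {r₁ r₂ : ℝ → ℝ} (T₁ : Tail v₁ dv₁ 0 m₁ r₁) (T₂ : Tail v₂ dv₂ 0 m₂ r₂) (hβ : β < m₁) :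
    m₂ ≤ m₁ := by
  by_contra! hm
  have hb := N.b_pos
  have h1 := (tail_tail_compare S₁ S₂ C N hv₁ hv₂ T₁ T₂ hβ hm).1 β (hb.trans N.b_lt) le_rfl
  have h2 := first_order S₁ S₂ C N hb.le hb.le hm T₁.piece T₂.piece N.b_lt hβ
  linarith

theorem ground_unique (C : Coeff q Hinf) (N : Nonlin c f b β Hinf) {u₁ u₂ : ℝ → ℝ}
    (hu₁ : IsSolutionE c f q u₁) (hu₂ : IsSolutionE c f q u₂) (hn₁ : ∀ r, 0 ≤ r → 0 ≤ u₁ r)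
    (hn₂ : ∀ r, 0 ≤ r → 0 ≤ u₂ r) (hp₁ : 0 < u₁ 0) (hp₂ : 0 < u₂ 0)
    (hl₁ : Tendsto u₁ atTop (𝓝 0)) (hl₂ : Tendsto u₂ atTop (𝓝 0)) {r : ℝ} (hr : 0 ≤ r) :
    u₁ r = u₂ r := by
  have S₁ := flow_of_solution C N hu₁
  have S₂ := flow_of_solution C N hu₂
  obtain ⟨hβ₁, r₁, T₁⟩ := S₁.exists_tail C N hl₁ le_rfl S₁.d0 hp₁ hn₁
  obtain ⟨hβ₂, r₂, T₂⟩ := S₂.exists_tail C N hl₂ le_rfl S₂.d0 hp₂ hn₂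
  have h0 : u₁ 0 = u₂ 0 := le_antisymm (ground_top_not_lt S₂ S₁ C N hl₂ hl₁ T₂ T₁ hβ₂)
    (ground_top_not_lt S₁ S₂ C N hl₁ hl₂ T₁ T₂ hβ₁)
  rw [← h0] at T₂
  exact tail_unique S₁ S₂ C N hl₁ hl₂ T₁ T₂ hβ₁ hr

end

end BoundState

/-- Under (f1), (f2), (f3), (f5) and (q1)-(q5), uniqueness of the
nonnegative bound state and of the bound state with exactly one sign change. -/
theorem uniqueness_first_second_bound_state_sublinear
    (c : EReal) (f q : ℝ → ℝ) (b β Hinf linf : ℝ) (hc : 0 < c)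
    (hf1 : CondF1 c f b β) (hf2 : CondF2 c f)
    (hq1 : CondQ1 q) (hq2 : CondQ2 q) (hq3 : CondQ3 q Hinf)
    (hq4 : CondQ4 q linf) (hq5 : CondQ5 q)
    (hf3 : CondF3 c f β Hinf) (hf5 : CondF5 c f b) :
    (∀ u₁ u₂ : ℝ → ℝ, IsSolutionE c f q u₁ → IsSolutionE c f q u₂ →
      (∀ r : ℝ, 0 ≤ r → 0 ≤ u₁ r) → (∀ r : ℝ, 0 ≤ r → 0 ≤ u₂ r) →
      0 < u₁ 0 → 0 < u₂ 0 →
      Tendsto u₁ atTop (nhds 0) → Tendsto u₂ atTop (nhds 0) →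
      ∀ r : ℝ, 0 ≤ r → u₁ r = u₂ r) ∧
    (∀ u₁ u₂ : ℝ → ℝ, IsSolutionE c f q u₁ → IsSolutionE c f q u₂ →
      0 < u₁ 0 → 0 < u₂ 0 →
      Tendsto u₁ atTop (nhds 0) → Tendsto u₂ atTop (nhds 0) →
      ExactSignChanges u₁ 1 → ExactSignChanges u₂ 1 →
      ∀ r : ℝ, 0 ≤ r → u₁ r = u₂ r) := by
  have C := BoundState.coeff_of_cond hq1 hq2 hq3 hq4 hq5
  have N := BoundState.nonlin_of_cond hf1 hf2 hf3 hf5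
  refine ⟨fun u₁ u₂ hu₁ hu₂ hn₁ hn₂ hp₁ hp₂ hl₁ hl₂ r hr =>
    BoundState.ground_unique C N hu₁ hu₂ hn₁ hn₂ hp₁ hp₂ hl₁ hl₂ hr,
    fun u₁ u₂ hu₁ hu₂ hp₁ hp₂ hl₁ hl₂ hs₁ hs₂ r hr => ?_⟩
  obtain ⟨R₁, m₁, ρ₁, r₁, U₁⟩ := BoundState.exists_twoNode C N hu₁ hp₁ hl₁ hs₁
  obtain ⟨R₂, m₂, ρ₂, r₂, U₂⟩ := BoundState.exists_twoNode C N hu₂ hp₂ hl₂ hs₂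
  exact U₁.unique C N U₂ hr
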